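/- Let F be a finite field of characteristic different from 2. Every square matrix A over F is congruent to a direct sum, uniquely determined up to permutation of summands, consisting of any number of summands of the following types: (i) J_n(0); (ii) [Φ ⟍ I_n], where Φ is an n×n nonsingular Frobenius block such that p_Φ(x) ≠ p_Φ^∨(x) or p_Φ(x) = x + (−1)^{n+1}, and Φ is determined up to replacement by the Frobenius block Ψ with χ_Ψ(x) = χ_Φ^∨(x); (iii) √TΦ, where Φ is a nonsingular Frobenius block such that p_Φ(x) = p_Φ^∨(x) and deg p_Φ(x) ≥ 2; (iv) for each n = 1,2,…: any number of summands Γ_n and at most one summand ζΓ_n, where ζ is a fixed nonsquare of F. -/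

import Mathlib

open Polynomial Matrix

namespace Can

noncomputable section

abbrev Mat (F : Type*) (n : ℕ) := Matrix (Fin n) (Fin n) F

variable {F : Type*} [Field F]

/-- conjugate transpose w.r.t. an involution σ -/
def ctr (σ : F →+* F) {m n : ℕ} (A : Matrix (Fin m) (Fin n) F) : Matrix (Fin n) (Fin m) F :=
  (A.map σ)ᵀ

/-- congruence: SᵀAS = B for a nonsingular S -/
def Congruent {n : ℕ} (A B : Mat F n) : Prop :=
  ∃ S : Mat F n, IsUnit S.det ∧ Sᵀ * A * S = B

/-- *congruence: S*AS = B for a nonsingular S -/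
def StarCongruent (σ : F →+* F) {n : ℕ} (A B : Mat F n) : Prop :=
  ∃ S : Mat F n, IsUnit S.det ∧ ctr σ S * A * S = B

/-- a square-matrix "summand" of unspecified size -/
abbrev Block (F : Type*) := Σ n : ℕ, Mat F n

def castMat {m n : ℕ} (h : m = n) (A : Mat F m) : Mat F n :=
  Matrix.reindex (finCongr h) (finCongr h) A

def BCong (X Y : Block F) : Prop :=
  ∃ h : X.1 = Y.1, Congruent (castMat h X.2) Y.2

def BStarCong (σ : F →+* F) (X Y : Block F) : Prop :=
  ∃ h : X.1 = Y.1, StarCongruent σ (castMat h X.2) Y.2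

/-- direct sum of a list of blocks -/
def bsum : List (Block F) → Block F
  | [] => ⟨0, 0⟩
  | X :: L => ⟨X.1 + (bsum L).1,
      Matrix.reindex finSumFinEquiv finSumFinEquiv (Matrix.fromBlocks X.2 0 0 (bsum L).2)⟩

/-- pairs of square matrices of the same size -/
abbrev PBlock (F : Type*) := Σ n : ℕ, Mat F n × Mat F n

def PCong (X Y : PBlock F) : Prop :=
  ∃ h : X.1 = Y.1, ∃ S : Mat F Y.1, IsUnit S.det ∧
    Sᵀ * castMat h X.2.1 * S = Y.2.1 ∧ Sᵀ * castMat h X.2.2 * S = Y.2.2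

def PStarCong (σ : F →+* F) (X Y : PBlock F) : Prop :=
  ∃ h : X.1 = Y.1, ∃ S : Mat F Y.1, IsUnit S.det ∧
    ctr σ S * castMat h X.2.1 * S = Y.2.1 ∧ ctr σ S * castMat h X.2.2 * S = Y.2.2

def psum : List (PBlock F) → PBlock F
  | [] => ⟨0, (0, 0)⟩
  | X :: L =>
      ⟨X.1 + (psum L).1,
        (Matrix.reindex finSumFinEquiv finSumFinEquiv (Matrix.fromBlocks X.2.1 0 0 (psum L).2.1),
         Matrix.reindex finSumFinEquiv finSumFinEquiv (Matrix.fromBlocks X.2.2 0 0 (psum L).2.2))⟩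

/-- lower-triangular Jordan block -/
def J (F : Type*) [Field F] (n : ℕ) (lam : F) : Mat F n :=
  Matrix.of fun i j => if i = j then lam else if (i : ℕ) = (j : ℕ) + 1 then 1 else 0

/-- the companion (Frobenius) matrix of a polynomial -/
def companion (F : Type*) [Field F] (f : Polynomial F) : Mat F f.natDegree :=
  Matrix.of fun i j => if (i : ℕ) = (j : ℕ) + 1 then 1
    else if (j : ℕ) + 1 = f.natDegree then -f.coeff i else 0

/-- f ↦ f^∨ (with respect to the involution σ) -/
def dualPoly (σ : F →+* F) (f : Polynomial F) : Polynomial F :=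
  Polynomial.C (σ (f.coeff 0))⁻¹ * (f.map σ).reverse

/-- the skew sum [A ⟍ B] = [[0, B], [A, 0]] -/
def skewSum {k l : ℕ} (A : Matrix (Fin k) (Fin l) F) (B : Matrix (Fin l) (Fin k) F) :
    Mat F (l + k) :=
  Matrix.reindex finSumFinEquiv finSumFinEquiv (Matrix.fromBlocks 0 B A 0)

/-- the matrix Γₙ -/
def Gamma (F : Type*) [Field F] (n : ℕ) : Mat F n :=
  Matrix.of fun i j =>
    if (i : ℕ) + (j : ℕ) + 1 = n ∨ (i : ℕ) + (j : ℕ) = n then (-1 : F) ^ (n - 1 - (i : ℕ)) else 0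

/-- Fₙ = [I | 0], an (n−1)×n matrix -/
def Fmat (F : Type*) [Field F] (n : ℕ) : Matrix (Fin (n - 1)) (Fin n) F :=
  Matrix.of fun i j => if (i : ℕ) = (j : ℕ) then 1 else 0

/-- Gₙ = [0 | I], an (n−1)×n matrix -/
def Gmat (F : Type*) [Field F] (n : ℕ) : Matrix (Fin (n - 1)) (Fin n) F :=
  Matrix.of fun i j => if (i : ℕ) + 1 = (j : ℕ) then 1 else 0

/-- the pair Bₙ of symmetric n×n matrices -/
def Bpair (F : Type*) [Field F] (n : ℕ) : Mat F n × Mat F n :=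
  (Matrix.of fun i j => if (i : ℕ) + (j : ℕ) + 2 = n then 1 else 0,
   Matrix.of fun i j => if (i : ℕ) + (j : ℕ) + 1 = n then 1 else 0)

/-- the pair Cₙ of a symmetric and a skew-symmetric n×n matrix -/
def Cpair (F : Type*) [Field F] (n : ℕ) : Mat F n × Mat F n :=
  if Odd n then
    (Matrix.of fun i j => if (i : ℕ) + (j : ℕ) + 1 = n then 1 else 0,
     Matrix.of fun i j =>
       if (i : ℕ) + (j : ℕ) + 2 = n ∧ i < j then 1
       else if (i : ℕ) + (j : ℕ) + 2 = n ∧ j < i then -1 else 0)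
  else
    (Matrix.of fun i j => if (i : ℕ) + (j : ℕ) + 2 = n then 1 else 0,
     Matrix.of fun i j =>
       if (i : ℕ) + (j : ℕ) + 1 = n ∧ i < j then 1
       else if (i : ℕ) + (j : ℕ) + 1 = n ∧ j < i then -1 else 0)

/-- at most one entry of the list satisfies P -/
def AtMostOne {α : Type*} (P : α → Prop) (L : List α) : Prop :=
  ¬ ∃ b₁ b₂ : α, List.Sublist [b₁, b₂] L ∧ P b₁ ∧ P b₂


section Stmt0
variable {F : Type*} [Field F]

/-- the summand [Φ ⟍ Iₙ] attached to the characteristic polynomial χ of the Frobenius block Φ -/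
def skewIBlock (χ : Polynomial F) : Block F :=
  ⟨χ.natDegree + χ.natDegree, skewSum (companion F χ) (1 : Mat F χ.natDegree)⟩

/-- type (i): Jₙ(0) -/
def T0i (b : Block F) : Prop := ∃ n : ℕ, 0 < n ∧ b = ⟨n, J F n 0⟩

/-- type (ii): [Φ ⟍ Iₙ], Φ an n×n nonsingular Frobenius block with
p_Φ ≠ p_Φ^∨ or p_Φ = x + (−1)^{n+1} -/
def T0ii (b : Block F) : Prop :=
  ∃ (pp : Polynomial F) (l : ℕ), pp.Monic ∧ Irreducible pp ∧ 0 < l ∧ (pp ^ l).eval 0 ≠ 0 ∧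
    (dualPoly (RingHom.id F) pp ≠ pp ∨ pp = X + C ((-1 : F) ^ ((pp ^ l).natDegree + 1))) ∧
    b = skewIBlock (pp ^ l)

/-- type (iii): √TΦ, Φ a nonsingular Frobenius block with p_Φ = p_Φ^∨, deg p_Φ ≥ 2 -/
def T0iii (sqrtT : (q : Polynomial F) → Mat F q.natDegree) (b : Block F) : Prop :=
  ∃ (pp : Polynomial F) (l : ℕ), pp.Monic ∧ Irreducible pp ∧ 0 < l ∧ (pp ^ l).eval 0 ≠ 0 ∧
    dualPoly (RingHom.id F) pp = pp ∧ 2 ≤ pp.natDegree ∧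
    b = ⟨(pp ^ l).natDegree, sqrtT (pp ^ l)⟩

/-- type (iv): Γₙ and ζΓₙ -/
def T0iv (ζ : F) (b : Block F) : Prop :=
  ∃ n : ℕ, 0 < n ∧ (b = ⟨n, Gamma F n⟩ ∨ b = ⟨n, ζ • Gamma F n⟩)

def Canon0 (ζ : F) (sqrtT : (q : Polynomial F) → Mat F q.natDegree) (L : List (Block F)) : Prop :=
  (∀ b ∈ L, T0i b ∨ T0ii b ∨ T0iii sqrtT b ∨ T0iv ζ b) ∧
  -- for each n, at most one summand ζΓₙ
  ∀ n : ℕ, AtMostOne (fun b => b = ⟨n, ζ • Gamma F n⟩) L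

/-- a type (ii) summand may be replaced by the one with χ_Ψ = χ_Φ^∨ -/
def Equiv0 (b c : Block F) : Prop :=
  b = c ∨
  ∃ (pp : Polynomial F) (l : ℕ), pp.Monic ∧ Irreducible pp ∧ 0 < l ∧ (pp ^ l).eval 0 ≠ 0 ∧
    (dualPoly (RingHom.id F) pp ≠ pp ∨ pp = X + C ((-1 : F) ^ ((pp ^ l).natDegree + 1))) ∧
    b = skewIBlock (pp ^ l) ∧ c = skewIBlock (dualPoly (RingHom.id F) (pp ^ l))

open LinearMap (BilinForm)

/-! ### Isometry of bilinear spaces -/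

/-- Two bilinear spaces are isometric. -/
def Isom {V W : Type*} [AddCommGroup V] [Module F V] [AddCommGroup W] [Module F W]
    (B : BilinForm F V) (C : BilinForm F W) : Prop :=
  ∃ e : V ≃ₗ[F] W, ∀ u v, C (e u) (e v) = B u v

/-- The orthogonal direct sum of two bilinear forms. -/
def prodForm {V W : Type*} [AddCommGroup V] [Module F V] [AddCommGroup W] [Module F W]
    (B : BilinForm F V) (C : BilinForm F W) : BilinForm F (V × W) :=
  B.compl₁₂ (LinearMap.fst F V W) (LinearMap.fst F V W) +
    C.compl₁₂ (LinearMap.snd F V W) (LinearMap.snd F V W)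

/-- The bilinear form on column vectors attached to a block. -/
def bf (X : Block F) : BilinForm F (Fin X.1 → F) := Matrix.toBilin' X.2

section Isometry

variable {V W V' W' U : Type*} [AddCommGroup V] [Module F V] [AddCommGroup W] [Module F W]
  [AddCommGroup V'] [Module F V'] [AddCommGroup W'] [Module F W'] [AddCommGroup U] [Module F U]

@[simp] lemma prodForm_apply (B : BilinForm F V) (C : BilinForm F W) (x y : V × W) :
    prodForm B C x y = B x.1 y.1 + C x.2 y.2 := rfl

lemma bf_apply (X : Block F) (u v : Fin X.1 → F) : bf X u v = u ⬝ᵥ X.2 *ᵥ v :=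
  Matrix.toBilin'_apply' _ _ _

lemma Isom.refl (B : BilinForm F V) : Isom B B := ⟨LinearEquiv.refl F V, fun _ _ => rfl⟩

lemma Isom.symm {B : BilinForm F V} {C : BilinForm F W} (h : Isom B C) : Isom C B := by
  obtain ⟨e, he⟩ := h
  exact ⟨e.symm, fun u v => by rw [← he]; simp⟩

lemma Isom.trans {B : BilinForm F V} {C : BilinForm F W} {D : BilinForm F U}
    (h : Isom B C) (h' : Isom C D) : Isom B D := by
  obtain ⟨e, he⟩ := h
  obtain ⟨e', he'⟩ := h'
  exact ⟨e.trans e', fun u v => by simp [he, he']⟩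

lemma Isom.prod {B : BilinForm F V} {C : BilinForm F W} {B' : BilinForm F V'} {C' : BilinForm F W'}
    (h : Isom B B') (h' : Isom C C') : Isom (prodForm B C) (prodForm B' C') := by
  obtain ⟨e, he⟩ := h
  obtain ⟨e', he'⟩ := h'
  exact ⟨e.prodCongr e', fun u v => by simp [he, he']⟩

lemma isom_prod_comm (B : BilinForm F V) (C : BilinForm F W) :
    Isom (prodForm B C) (prodForm C B) :=
  ⟨LinearEquiv.prodComm F V W, fun u v => by simp [add_comm]⟩

lemma isom_prod_assoc (B : BilinForm F V) (C : BilinForm F W) (D : BilinForm F U) :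
    Isom (prodForm (prodForm B C) D) (prodForm B (prodForm C D)) :=
  ⟨LinearEquiv.prodAssoc F V W U, fun u v => by simp [add_assoc]⟩

lemma isom_prod_of_subsingleton [Subsingleton V] (B : BilinForm F V) (C : BilinForm F W) :
    Isom C (prodForm B C) := by
  refine ⟨LinearEquiv.ofBijective (LinearMap.inr F V W) ⟨LinearMap.inr_injective, ?_⟩, ?_⟩
  · rintro ⟨a, b⟩
    exact ⟨b, by simp [Subsingleton.elim a 0]⟩
  · intro u v
    change B 0 _ + C u v = C u v
    simp

lemma bcong_iff_isom (X Y : Block F) : BCong X Y ↔ Isom (bf X) (bf Y) := by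
  obtain ⟨m, A⟩ := X
  obtain ⟨n, C⟩ := Y
  constructor
  · rintro ⟨h, S, hS, hSC⟩
    obtain rfl : m = n := h
    have hA : castMat rfl A = A := by ext; simp [castMat]
    simp only [hA] at hSC
    refine Isom.symm ⟨Matrix.toLinearEquiv' S
      ((Matrix.isUnit_iff_isUnit_det S).2 hS).invertible, fun u v => ?_⟩
    rw [bf_apply, bf_apply, ← hSC]
    simp [Matrix.toLinearEquiv', Matrix.mulVec_mulVec, Matrix.mul_assoc]
    rw [← Matrix.vecMul_transpose, ← Matrix.dotProduct_mulVec, Matrix.mulVec_mulVec]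
  · rintro h
    obtain ⟨e, he⟩ := h.symm
    have h : m = n := by simpa using (LinearEquiv.finrank_eq e).symm
    subst h
    have hA : castMat rfl A = A := by ext; simp [castMat]
    refine ⟨rfl, LinearMap.toMatrix' e.toLinearMap, ?_, ?_⟩
    · simpa using e.isUnit_det'
    · simp only [hA]
      ext i j
      have := he (Pi.single i 1) (Pi.single j 1)
      have hv : ∀ v, e v = LinearMap.toMatrix' e.toLinearMap *ᵥ v := fun v =>
        (LinearMap.toMatrix'_mulVec _ _).symm
      rw [bf_apply, bf_apply, hv, hv, ← Matrix.vecMul_transpose, ← Matrix.dotProduct_mulVec,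
        Matrix.mulVec_mulVec, Matrix.mulVec_mulVec] at this
      simpa [Matrix.mul_assoc] using this

lemma isom_fromBlocks {m n : ℕ} (A : Mat F m) (D : Mat F n) :
    Isom (prodForm (bf ⟨m, A⟩) (bf ⟨n, D⟩))
      (bf ⟨m + n, Matrix.reindex finSumFinEquiv finSumFinEquiv (Matrix.fromBlocks A 0 0 D)⟩) := by
  refine ⟨(LinearEquiv.sumArrowLequivProdArrow _ _ F F).symm.trans
    (LinearEquiv.funCongrLeft F F finSumFinEquiv.symm), fun u v => ?_⟩
  rw [bf_apply, prodForm_apply, bf_apply, bf_apply]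
  simp only [dotProduct, Matrix.mulVec]
  rw [← finSumFinEquiv.sum_comp]
  simp_rw [← finSumFinEquiv.sum_comp]
  simp [Fintype.sum_sum_type]
  rfl

lemma isom_bsum_cons (X : Block F) (L : List (Block F)) :
    Isom (prodForm (bf X) (bf (bsum L))) (bf (bsum (X :: L))) :=
  isom_fromBlocks X.2 (bsum L).2

lemma isom_bsum_perm {L L' : List (Block F)} (h : L.Perm L') :
    Isom (bf (bsum L)) (bf (bsum L')) := by
  induction h with
  | nil => exact Isom.refl _
  | cons X _ ih =>
    exact (isom_bsum_cons _ _).symm.trans (((Isom.refl _).prod ih).trans (isom_bsum_cons _ _))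
  | swap X Y L =>
    refine (isom_bsum_cons _ _).symm.trans (((Isom.refl _).prod (isom_bsum_cons _ _).symm).trans ?_)
    refine Isom.trans ?_ (((Isom.refl _).prod (isom_bsum_cons _ _)).trans (isom_bsum_cons _ _))
    exact (isom_prod_assoc _ _ _).symm.trans
      (((isom_prod_comm _ _).prod (Isom.refl _)).trans (isom_prod_assoc _ _ _))
  | trans _ _ h₁ h₂ => exact h₁.trans h₂

/-- Splitting off an orthogonal summand with a prescribed Gram matrix. -/
lemma exists_split {m : ℕ} {M : Mat F m} (B : BilinForm F V) (f : Fin m → V)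
    (φ : Fin m → V →ₗ[F] F) (hφ : ∀ i j, φ i (f j) = if i = j then 1 else 0)
    (hl : ∀ i v, B (f i) v = ∑ j, M i j * φ j v)
    (hr : ∀ i v, B v (f i) = ∑ j, φ j v * M j i) :
    ∃ T : Submodule F V, Isom (prodForm (bf ⟨m, M⟩) (B.domRestrict₁₂ T T)) B := by
  let Φ : V →ₗ[F] (Fin m → F) := LinearMap.pi φ
  let g : (Fin m → F) →ₗ[F] V := Fintype.linearCombination F f
  have hg : ∀ c, g c = ∑ i, c i • f i := fun c => Fintype.linearCombination_apply _ _ _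
  have hΦg : ∀ c, Φ (g c) = c := by
    intro c
    ext i
    simp [Φ, hg, hφ]
  have hgB : ∀ c v, B (g c) v = c ⬝ᵥ M *ᵥ (Φ v) := by
    intro c v
    simp [hg, hl, Φ, dotProduct, Matrix.mulVec]
  have hBg : ∀ c v, B v (g c) = (Φ v) ⬝ᵥ M *ᵥ c := by
    intro c v
    simp only [hg, map_sum, map_smul, hr, dotProduct, Matrix.mulVec,
      Finset.mul_sum, Φ, LinearMap.pi_apply, smul_eq_mul]
    rw [Finset.sum_comm]
    exact Finset.sum_congr rfl fun _ _ => Finset.sum_congr rfl fun _ _ => by ring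
  refine ⟨LinearMap.ker Φ, LinearEquiv.ofLinearMap
    (g.coprod (LinearMap.ker Φ).subtype)
    (Φ.prod ((LinearMap.id - g ∘ₗ Φ).codRestrict (LinearMap.ker Φ)
      fun v => by simp [hΦg])) ?_ ?_, ?_⟩
  · ext v
    simp
  · refine LinearMap.ext fun x => ?_
    obtain ⟨c, ⟨t, ht⟩⟩ := x
    have ht' : Φ t = 0 := ht
    ext <;> simp [hΦg, ht']
  · rintro ⟨c, ⟨t, ht⟩⟩ ⟨c', ⟨t', ht'⟩⟩
    have h1 : Φ t = 0 := ht
    have h2 : Φ t' = 0 := ht'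
    change B (g c + t) (g c' + t') = bf ⟨m, M⟩ c c' + B t t'
    simp only [map_add, LinearMap.add_apply, hgB, hBg, h1, h2, hΦg]
    simpa using (bf_apply ⟨m, M⟩ c c').symm

end Isometry

/-! ### Degenerate forms: splitting off a nilpotent Jordan block -/

/-- A sequence of vectors spanning an orthogonal summand with Gram matrix `J n 0`. -/
structure JChain {V : Type*} [AddCommGroup V] [Module F V] (B : BilinForm F V) (n : ℕ)
    (f : ℕ → V) : Prop where
  pos : 0 < n
  left : ∀ v, B (f 0) v = 0
  right : ∀ v, B v (f (n - 1)) = 0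
  mid : ∀ i, i + 2 < n → ∀ v, B (f (i + 2)) v = B v (f i)
  gram : ∀ i < n, ∀ j < n, B (f i) (f j) = if i = j + 1 then 1 else 0
  ne : f 0 ≠ 0

section Degenerate

variable {V : Type*} [AddCommGroup V] [Module F V]

/-- A functional vanishing wherever all `g x`, `x ∈ S`, vanish is of the form `g x`. -/
lemma exists_mem_eq_of_vanish [FiniteDimensional F V] {W : Type*} [AddCommGroup W] [Module F W]
    (g : W →ₗ[F] Module.Dual F V) (S : Submodule F W) (ψ : Module.Dual F V)
    (h : ∀ v, (∀ x ∈ S, g x v = 0) → ψ v = 0) : ∃ x ∈ S, ∀ v, g x v = ψ v := by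
  have h1 : ψ ∈ (S.map g).dualCoannihilator.dualAnnihilator := by
    rw [Submodule.mem_dualAnnihilator]
    intro v hv
    rw [Submodule.mem_dualCoannihilator] at hv
    exact h v fun x hx => hv _ ⟨x, hx, rfl⟩
  rw [Subspace.dualCoannihilator_dualAnnihilator_eq] at h1
  obtain ⟨x, hx, rfl⟩ := h1
  exact ⟨x, hx, fun _ => rfl⟩

lemma JChain.exists_split {B : BilinForm F V} {n : ℕ} {f : ℕ → V} (h : JChain B n f) :
    ∃ T : Submodule F V, Isom (prodForm (bf ⟨n, J F n 0⟩) (B.domRestrict₁₂ T T)) B := by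
  have hn := h.pos
  obtain ⟨χ, hχ⟩ : ∃ χ : V →ₗ[F] F, χ (f 0) = 1 := Module.Projective.exists_dual_eq_one F h.ne
  let φ : Fin n → V →ₗ[F] F := fun j =>
    if (j : ℕ) + 1 < n then B (f (j + 1)) else if n = 1 then χ else B.flip (f (j - 1))
  refine Can.exists_split B (fun i : Fin n => f i) φ ?_ ?_ ?_
  · intro i j
    have hi := i.2
    have hj := j.2
    simp only [φ, Fin.ext_iff]
    split_ifs with h1 h2 h3 h4 h5
    · rw [h.gram _ h1 _ hj, if_pos (by omega)]
    · rw [h.gram _ h1 _ hj, if_neg (by omega)]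
    · rw [show (j : ℕ) = 0 by omega, hχ]
    · omega
    · rw [LinearMap.BilinForm.flip_apply, h.gram _ hj _ (by omega), if_pos (by omega)]
    · rw [LinearMap.BilinForm.flip_apply, h.gram _ hj _ (by omega), if_neg (by omega)]
  · intro i v
    by_cases hi : (i : ℕ) = 0
    · simp only [hi, h.left]
      refine (Finset.sum_eq_zero fun j _ => ?_).symm
      simp [J, hi]
    · rw [Finset.sum_eq_single (⟨i - 1, by omega⟩ : Fin n)]
      · simp only [J, Matrix.of_apply, φ, Fin.ext_iff]
        rw [if_neg (by omega), if_pos (by omega), if_pos (by omega), one_mul,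
          show (i : ℕ) - 1 + 1 = i by omega]
      · intro j _ hj
        simp only [J, Matrix.of_apply]
        rw [Ne, Fin.ext_iff] at hj
        dsimp at hj
        split_ifs <;> first | omega | simp
      · simp
  · intro i v
    have hi2 := i.2
    by_cases hi : (i : ℕ) + 1 = n
    · rw [show (i : ℕ) = n - 1 by omega, h.right]
      refine (Finset.sum_eq_zero fun j _ => ?_).symm
      have := j.2
      simp only [J, Matrix.of_apply]
      split_ifs <;> first | omega | simp
    · rw [Finset.sum_eq_single (⟨i + 1, by omega⟩ : Fin n)]
      · simp only [J, Matrix.of_apply, φ, Fin.ext_iff]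
        split_ifs with h1 h2 h3 <;> first | omega | simp_all
        exact (h.mid _ h1 v).symm
      · intro j _ hj
        rw [Ne, Fin.ext_iff] at hj
        dsimp at hj
        simp only [J, Matrix.of_apply]
        split_ifs <;> first | omega | simp
      · simp

lemma exists_right_of_left [FiniteDimensional F V] (B : BilinForm F V)
    (h : ∃ l ≠ 0, ∀ v, B l v = 0) : ∃ r ≠ 0, ∀ v, B v r = 0 := by
  by_contra hc
  push Not at hc
  have hinj : Function.Injective B.flip := by
    rw [injective_iff_map_eq_zero]
    intro r hr
    by_contra hr0
    obtain ⟨v, hv⟩ := hc r hr0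
    exact hv (by simpa using LinearMap.congr_fun hr v)
  have hsurj : Function.Surjective B.flip :=
    (LinearMap.injective_iff_surjective_of_finrank_eq_finrank
      (Subspace.dual_finrank_eq).symm).1 hinj
  obtain ⟨l, hl0, hl⟩ := h
  refine hl0 ((Module.forall_dual_apply_eq_zero_iff F l).1 fun ψ => ?_)
  obtain ⟨v, rfl⟩ := hsurj ψ
  exact hl v

lemma exists_left_of_right [FiniteDimensional F V] (B : BilinForm F V)
    (h : ∃ r ≠ 0, ∀ v, B v r = 0) : ∃ l ≠ 0, ∀ v, B l v = 0 :=
  exists_right_of_left B.flip h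

lemma exists_jChain_aux (N : ℕ) : ∀ (V : Type*) [AddCommGroup V] [Module F V]
    [FiniteDimensional F V] (B : BilinForm F V), Module.finrank F V ≤ N →
    (∃ l ≠ 0, ∀ v, B l v = 0) → ∃ n f, JChain B n f := by
  induction N with
  | zero =>
    intro V _ _ _ B hN ⟨l, hl, _⟩
    have : Subsingleton V := (Module.finrank_zero_iff (R := F)).1 (by omega)
    exact absurd (Subsingleton.elim l 0) hl
  | succ N ih =>
    intro V _ _ _ B hN hdeg
    by_cases h1 : ∃ x ≠ 0, (∀ v, B x v = 0) ∧ ∀ v, B v x = 0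
    · obtain ⟨x, hx, hl, hr⟩ := h1
      exact ⟨1, fun _ => x, one_pos, hl, hr, fun i hi => by omega,
        fun i hi j hj => by rw [hl, if_neg (by omega)], hx⟩
    by_cases h2 : ∃ r l, (∀ v, B v r = 0) ∧ (∀ v, B l v = 0) ∧ B r l ≠ 0
    · obtain ⟨r, l, hr, hl, hrl⟩ := h2
      refine ⟨2, fun i => if i = 0 then l else (B r l)⁻¹ • r, two_pos, ?_, ?_, fun i hi => by omega,
        ?_, ?_⟩
      · simpa using hl
      · simpa using fun v => Or.inr (hr v)
      · intro i hi j hj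
        interval_cases i <;> interval_cases j <;> simp [hl, hr, hrl]
      · rintro rfl
        simp at hrl
    push Not at h1 h2
    obtain ⟨r, hr0, hr⟩ := exists_right_of_left B hdeg
    let L : Submodule F V := LinearMap.ker B
    have hL : ∀ l, l ∈ L ↔ ∀ v, B l v = 0 := fun l => by
      rw [LinearMap.mem_ker, LinearMap.ext_iff]; rfl
    let U : Submodule F V := ⨅ l : L, LinearMap.ker (B.flip l)
    have hU : ∀ x, x ∈ U ↔ ∀ l ∈ L, B x l = 0 := fun x => by simp [U, Submodule.mem_iInf]
    have hLU : L ≤ U := fun l hl => (hU l).2 fun l' _ => (hL l).1 hl l'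
    obtain ⟨W₀, hW₀⟩ := Submodule.exists_isCompl L
    let W := W₀ ⊓ U
    have hWL : ∀ x ∈ W, x ∈ L → x = 0 := fun x hx hx' =>
      (Submodule.disjoint_def.1 hW₀.disjoint) x hx' hx.1
    have hdec : ∀ x ∈ U, ∃ w ∈ W, ∃ l ∈ L, x = w + l := by
      intro x hx
      obtain ⟨l, hl, w, hw, rfl⟩ :=
        Submodule.mem_sup.1 (hW₀.sup_eq_top ▸ Submodule.mem_top (x := x))
      refine ⟨w, ⟨hw, ?_⟩, l, hl, add_comm _ _⟩
      simpa using U.sub_mem hx (hLU hl)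
    have hWU : ∀ w ∈ W, ∀ l ∈ L, B w l = 0 := fun w hw => (hU w).1 hw.2
    have hLz : ∀ l ∈ L, ∀ v, B l v = 0 := fun l hl => (hL l).1 hl
    have hWlt : Module.finrank F W < Module.finrank F V := by
      obtain ⟨l, hl0, hl⟩ := hdeg
      refine Submodule.finrank_lt fun htop => hl0 (hWL l ?_ ((hL l).2 hl))
      rw [htop]; trivial
    obtain ⟨m, e₀, he⟩ := ih W (B.domRestrict₁₂ W W) (by omega) (by
      apply exists_left_of_right
      obtain ⟨w, hw, l, hl, rfl⟩ := hdec r ((hU r).2 fun l hl => h2 r l hr (hLz l hl))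
      refine ⟨⟨w, hw⟩, fun h0 => ?_, fun v => ?_⟩
      · have : w = 0 := congrArg Subtype.val h0
        subst this
        obtain ⟨v, hv⟩ := h1 _ hr0 (by simpa using hLz l hl)
        exact hv (hr v)
      · have := hr v
        rw [map_add, hWU v v.2 l hl, add_zero] at this
        exact this)
    obtain ⟨e, hee⟩ : ∃ e : ℕ → V, ∀ i, e i = e₀ i := ⟨_, fun _ => rfl⟩
    have heW : ∀ i, e i ∈ W := fun i => hee i ▸ (e₀ i).2
    have hgram : ∀ i < m, ∀ j < m, B (e i) (e j) = if i = j + 1 then 1 else 0 := by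
      intro i hi j hj
      rw [hee, hee]; exact he.gram i hi j hj
    have hmid : ∀ i, i + 2 < m → ∀ w ∈ W, B (e (i + 2)) w = B w (e i) := by
      intro i hi w hw
      rw [hee, hee]; exact he.mid i hi ⟨w, hw⟩
    have hleft : ∀ w ∈ W, B (e 0) w = 0 := fun w hw => by
      rw [hee]; exact he.left ⟨w, hw⟩
    have hright : ∀ w ∈ W, B w (e (m - 1)) = 0 := fun w hw => by
      rw [hee]; exact he.right ⟨w, hw⟩
    have hm := he.pos
    have he0 : e 0 ≠ 0 := fun h0 => he.ne (Subtype.ext ((hee 0).symm.trans h0))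
    have F1 : ∀ ψ : Module.Dual F V, (∀ w ∈ W, ψ w = 0) → (∀ l ∈ L, ψ l = 0) →
        ∃ l ∈ L, ∀ v, B v l = ψ v := by
      intro ψ hW hL'
      refine exists_mem_eq_of_vanish B.flip L ψ fun v hv => ?_
      obtain ⟨w, hw, l, hl, rfl⟩ := hdec v ((hU v).2 hv)
      rw [map_add, hW w hw, hL' l hl, add_zero]
    obtain ⟨l₀, hl₀L, hl₀⟩ := F1 (B (e 0)) hleft (hWU _ (heW 0))
    obtain ⟨c, hcl, hcc, hec, hc1⟩ : ∃ c, B c l₀ = 1 ∧ B c c = 0 ∧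
        (∀ j < m, B (e j) c = if j = 0 then 1 else 0) ∧ (1 < m → ∀ v, B v c = B (e 1) v) := by
      by_cases hm1 : 1 < m
      · obtain ⟨c, -, hc⟩ := exists_mem_eq_of_vanish B.flip ⊤ (B (e 1)) fun v hv => by
          exact hWU _ (heW 1) v ((hL v).2 fun x => by simpa using hv x trivial)
        change ∀ v, B v c = B (e 1) v at hc
        refine ⟨c, ?_, ?_, ?_, fun _ => hc⟩
        · rw [hl₀, hc, hgram _ hm1 _ hm, if_pos rfl]
        · rw [hc, hc, hgram _ hm1 _ hm1, if_neg (by omega)]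
        · intro j hj
          rw [hc, hgram _ hm1 _ hj]
          exact if_congr (by omega) rfl rfl
      · have hne : e 0 ∉ L := fun h => he0 (hWL _ (heW 0) h)
        rw [hL] at hne
        push Not at hne
        obtain ⟨d, hd⟩ := hne
        rw [← hl₀] at hd
        have hs : B ((B d l₀)⁻¹ • d) l₀ = 1 := by simp [hd]
        obtain ⟨d', hd'⟩ : ∃ d', d' = (B d l₀)⁻¹ • d := ⟨_, rfl⟩
        rw [← hd'] at hs
        have hcl : B (d' - B d' d' • l₀) l₀ = 1 := by simp [hs, hLz _ hl₀L]
        refine ⟨d' - B d' d' • l₀, hcl, ?_, ?_, fun h => absurd h hm1⟩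
        · simp [hs, hLz _ hl₀L]
        · intro j hj
          rw [show j = 0 by omega, ← hl₀, hcl, if_pos rfl]
    have hex : ∀ i, ∃ l ∈ L, (i + 2 < m → ∀ v, B v (e i + l) = B (e (i + 2)) v) ∧
        (i + 1 = m → ∀ v, B v (e i + l) = 0) ∧ (i + 2 = m → B c (e i + l) = 0) := by
      intro i
      rcases lt_trichotomy (i + 2) m with h | h | h
      · obtain ⟨l, hl, hl'⟩ := F1 (B (e (i + 2)) - B.flip (e i))
          (fun w hw => by simp [hmid i h w hw])
          (fun l hl => by simp [hLz l hl, hWU _ (heW _) l hl])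
        exact ⟨l, hl, fun _ v => by simp [hl'], fun _ => by omega, fun _ => by omega⟩
      · refine ⟨-B c (e i) • l₀, L.smul_mem _ hl₀L, fun _ => by omega, fun _ => by omega,
          fun _ => ?_⟩
        simp [hcl]
      · by_cases h' : i + 1 = m
        · obtain ⟨l, hl, hl'⟩ := F1 (- B.flip (e i))
            (fun w hw => by simpa [← h'] using hright w hw)
            (fun l hl => by simp [hLz l hl])
          exact ⟨l, hl, fun _ => by omega, fun _ v => by simp [hl'], fun _ => by omega⟩
        · exact ⟨0, L.zero_mem, fun _ => by omega, fun _ => by omega, fun _ => by omega⟩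
    choose l hlL hl1 hl2 hl3 using hex
    have hB : ∀ i v, B (e i + l i) v = B (e i) v := fun i v => by simp [hLz _ (hlL i)]
    have hce : ∀ j < m, B c (e j + l j) = 0 := by
      intro j hj
      rcases lt_trichotomy (j + 2) m with h | h | h
      · rw [hl1 j h, hec _ h, if_neg (by omega)]
      · exact hl3 j h
      · exact hl2 j (by omega) c
    refine ⟨m + 2, fun i => if i = 0 then l₀ else if i = 1 then c else e (i - 2) + l (i - 2),
      by omega, ?_, ?_, ?_, ?_, ?_⟩
    · simpa using hLz l₀ hl₀L
    · intro v
      rw [if_neg (by omega), if_neg (by omega), show m + 2 - 1 - 2 = m - 1 by omega]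
      exact hl2 _ (by omega) v
    · intro i hi v
      rw [if_neg (by omega), if_neg (by omega), Nat.add_sub_cancel, hB]
      split_ifs with h h'
      · rw [h, hl₀]
      · rw [h', hc1 (by omega)]
      · obtain ⟨k, rfl⟩ : ∃ k, i = k + 2 := ⟨i - 2, by omega⟩
        rw [Nat.add_sub_cancel, hl1 k (by omega)]
    · intro i hi j hj
      have hsplit : ∀ k < m + 2, k = 0 ∨ k = 1 ∨ ∃ k' < m, k = k' + 2 := by
        intro k hk
        by_cases h0 : k = 0
        · exact Or.inl h0
        by_cases h1 : k = 1
        · exact Or.inr (Or.inl h1)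
        exact Or.inr (Or.inr ⟨k - 2, by omega, by omega⟩)
      rcases hsplit i hi with rfl | rfl | ⟨i, hi', rfl⟩ <;>
      rcases hsplit j hj with rfl | rfl | ⟨j, hj', rfl⟩
      · simp [hLz _ hl₀L]
      · simp [hLz _ hl₀L]
      · simp [hLz _ hl₀L]
      · simp [hcl]
      · simp [hcc]
      · simpa using hce j hj'
      · simp [hLz _ (hlL _), hWU _ (heW _) _ hl₀L]
      · simp [hLz _ (hlL _), hec _ hi']
      · simp [hLz _ (hlL _), hWU _ (heW _) _ (hlL _), hgram _ hi' _ hj']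
    · simp only [if_true]
      rintro rfl
      simp at hcl

/-- A degenerate form contains a chain spanning an orthogonal summand `J n 0`. -/
lemma exists_jChain [FiniteDimensional F V] (B : BilinForm F V) (h : ∃ l ≠ 0, ∀ v, B l v = 0) :
    ∃ n f, JChain B n f :=
  exists_jChain_aux _ V B le_rfl h

end Degenerate

/-! ### The asymmetry of a nondegenerate form -/

section Action

variable {V : Type*} [AddCommGroup V] [Module F V] {σ τ : Module.End F V}

lemma aeval_mul_apply (f g : F[X]) (v : V) : aeval σ (f * g) v = aeval σ f (aeval σ g v) := by
  rw [map_mul, Module.End.mul_apply]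

lemma aeval_apply_comm (f g : F[X]) (v : V) :
    aeval σ f (aeval σ g v) = aeval σ g (aeval σ f v) := by
  rw [← aeval_mul_apply, mul_comm, aeval_mul_apply]

lemma aeval_eq_zero_of_dvd {f g : F[X]} {v : V} (hf : aeval σ f v = 0) (h : f ∣ g) :
    aeval σ g v = 0 := by
  obtain ⟨k, rfl⟩ := h
  rw [mul_comm, aeval_mul_apply, hf, map_zero]

lemma aeval_eq_of_dvd_sub {q f g : F[X]} {v : V} (hq : aeval σ q v = 0) (h : q ∣ f - g) :
    aeval σ f v = aeval σ g v := by
  have := aeval_eq_zero_of_dvd hq h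
  rwa [map_sub, LinearMap.sub_apply, sub_eq_zero] at this

lemma aeval_mem_span {q : F[X]} (hq : q.Monic) {v : V} (hv : aeval σ q v = 0) (f : F[X]) :
    aeval σ f v ∈ Submodule.span F (Set.range fun i : Fin q.natDegree => (σ ^ (i : ℕ)) v) := by
  have hd : q ∣ f - f %ₘ q := ⟨f /ₘ q, by rw [sub_eq_iff_eq_add', modByMonic_add_div]⟩
  rw [aeval_eq_of_dvd_sub hv hd]
  by_cases h1 : q = 1
  · simp [h1]
  rw [aeval_eq_sum_range' (natDegree_modByMonic_lt f hq h1), LinearMap.sum_apply]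
  refine Submodule.sum_mem _ fun i hi => Submodule.smul_mem _ _ (Submodule.subset_span ?_)
  exact ⟨⟨i, Finset.mem_range.1 hi⟩, rfl⟩

end Action

section Asymmetry

variable {V : Type*} [AddCommGroup V] [Module F V]

/-- `σ` is the asymmetry of the nondegenerate form `B`, and `τ` is its inverse. -/
structure Asym (B : BilinForm F V) (σ τ : Module.End F V) : Prop where
  swap : ∀ u v, B u v = B (σ v) u
  right_inv : ∀ v, σ (τ v) = v
  left_inv : ∀ v, τ (σ v) = v
  nondeg : ∀ u, (∀ v, B u v = 0) → u = 0

lemma exists_asym [FiniteDimensional F V] (B : BilinForm F V)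
    (h : ∀ u, (∀ v, B u v = 0) → u = 0) : ∃ σ τ, Asym B σ τ := by
  have h' : ∀ v, (∀ u, B u v = 0) → v = 0 := by
    by_contra hc
    push Not at hc
    obtain ⟨v, hv, hv0⟩ := hc
    obtain ⟨l, hl, hl'⟩ := exists_left_of_right B ⟨v, hv0, hv⟩
    exact hl (h l hl')
  have hi : Function.Injective B := (injective_iff_map_eq_zero _).2 fun u hu =>
    h u fun v => LinearMap.congr_fun hu v
  have hi' : Function.Injective B.flip := (injective_iff_map_eq_zero _).2 fun u hu =>
    h' u fun v => LinearMap.congr_fun hu v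
  let e : V ≃ₗ[F] Module.Dual F V :=
    LinearMap.linearEquivOfInjective B hi Subspace.dual_finrank_eq.symm
  let e' : V ≃ₗ[F] Module.Dual F V :=
    LinearMap.linearEquivOfInjective B.flip hi' Subspace.dual_finrank_eq.symm
  refine ⟨(e'.trans e.symm).toLinearMap, (e.trans e'.symm).toLinearMap, fun u v => ?_, fun v => ?_,
    fun v => ?_, h⟩
  · have : e ((e'.trans e.symm) v) = e' v := by simp
    exact (LinearMap.congr_fun this u).symm
  · simp
  · simp

namespace Asym

variable {B : BilinForm F V} {σ τ : Module.End F V} (hB : Asym B σ τ)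
include hB

lemma nondeg_right (v : V) (h : ∀ u, B u v = 0) : v = 0 := by
  have := hB.nondeg (σ v) fun u => by rw [← hB.swap, h]
  rw [← hB.left_inv v, this, map_zero]

lemma adj_one (u v : V) : B (σ u) v = B u (τ v) := by
  rw [hB.swap u, hB.right_inv, hB.swap v, ← hB.swap, hB.swap v u]

lemma adj_one' (u v : V) : B u (σ v) = B (τ u) v := by
  conv_lhs => rw [← hB.right_inv u, hB.adj_one, hB.left_inv]

lemma adj (f : F[X]) (u v : V) : B (aeval σ f u) v = B u (aeval τ f v) := by
  induction f using Polynomial.induction_on generalizing u with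
  | C a => simp
  | add p q hp hq => simp [hp, hq]
  | monomial n a ih =>
    rw [show C a * X ^ (n + 1) = C a * X ^ n * X by ring, aeval_mul_apply, aeval_X, ih, hB.adj_one,
      mul_comm _ X, aeval_mul_apply X, aeval_X]

end Asym

/-- Splitting off a nondegenerate invariant subspace. -/
lemma exists_split_of_inv {B : BilinForm F V} {σ τ : Module.End F V} (hB : Asym B σ τ) {m : ℕ}
    {M : Mat F m} (f : Fin m → V) (φ : Fin m → V →ₗ[F] F)
    (hφ : ∀ i j, φ i (f j) = if i = j then 1 else 0)
    (hr : ∀ i v, B v (f i) = ∑ j, φ j v * M j i)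
    (hτ : ∀ i, τ (f i) ∈ Submodule.span F (Set.range f)) :
    ∃ T : Submodule F V, Isom (prodForm (bf ⟨m, M⟩) (B.domRestrict₁₂ T T)) B := by
  refine exists_split B f φ hφ (fun i v => ?_) hr
  have hM : ∀ i j, B (f j) (f i) = M j i := fun i j => by simp [hr, hφ]
  have key : ∀ z ∈ Submodule.span F (Set.range f), ∀ v, B v z = ∑ j, φ j v * B (f j) z := by
    intro z hz
    induction hz using Submodule.span_induction with
    | mem x hx =>
      obtain ⟨k, rfl⟩ := hx
      intro v
      simp only [hM, hr k v]
    | zero => simp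
    | add x y _ _ hx hy =>
      intro v
      simp only [map_add, hx v, hy v, mul_add, Finset.sum_add_distrib]
    | smul a x _ hx =>
      intro v
      simp only [map_smul, smul_eq_mul, hx v, Finset.mul_sum]
      exact Finset.sum_congr rfl fun _ _ => by ring
  rw [hB.swap, hB.adj_one, key _ (hτ i)]
  refine Finset.sum_congr rfl fun j _ => ?_
  rw [← hB.adj_one, ← hB.swap, hM, mul_comm]

/-- An ideal of `F[X]` containing `p ^ l` but not `p ^ (l - 1)` consists of multiples of `p ^ l`. -/
lemma pow_dvd_of_mem {p : F[X]} (hp : Irreducible p) {l : ℕ} (I : Ideal F[X]) (h1 : p ^ l ∈ I)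
    (h2 : p ^ (l - 1) ∉ I) {f : F[X]} (hf : f ∈ I) : p ^ l ∣ f := by
  obtain ⟨g, rfl⟩ := IsPrincipalIdealRing.principal I
  rw [Ideal.submodule_span_eq] at h1 h2 hf
  rw [Ideal.mem_span_singleton] at h1 h2 hf
  obtain ⟨k, hk, hg⟩ := (dvd_prime_pow hp.prime _).1 h1
  rcases hk.lt_or_eq with h | rfl
  · exact absurd (hg.dvd.trans (pow_dvd_pow p (by omega))) h2
  · exact hg.symm.dvd.trans hf

end Asymmetry

/-! ### Splitting off skew sums -/

/-- The largest ideal on which a functional on `F[X]` vanishes. -/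
def funcIdeal (lam : F[X] →ₗ[F] F) : Ideal F[X] where
  carrier := {h | ∀ f, lam (f * h) = 0}
  add_mem' ha hb f := by rw [mul_add, map_add, ha f, hb f, add_zero]
  zero_mem' f := by simp
  smul_mem' c h hh f := by rw [smul_eq_mul, ← mul_assoc]; exact hh _

/-- A polynomial with nonzero constant term admits an inverse of `X` modulo it. -/
lemma exists_inverse_X {q : F[X]} (h0 : q.eval 0 ≠ 0) : ∃ T : F[X], q ∣ X * T - 1 := by
  have hc : IsCoprime (X : F[X]) q := (irreducible_X.coprime_iff_not_dvd).2 fun h =>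
    h0 (by rw [← coeff_zero_eq_eval_zero]; exact X_dvd_iff.1 h)
  obtain ⟨a, b, hab⟩ := hc
  exact ⟨a, -b, by rw [← hab]; ring⟩

section Skew

variable {V : Type*} [AddCommGroup V] [Module F V] {B : BilinForm F V} {σ τ : Module.End F V}

namespace Asym

/-- The functional `f ↦ B (f(σ) u) w`. -/
def func (B : BilinForm F V) (σ : Module.End F V) (u w : V) : F[X] →ₗ[F] F :=
  (B.flip w) ∘ₗ (LinearMap.applyₗ u ∘ₗ (aeval σ).toLinearMap)

lemma func_apply (u w : V) (f : F[X]) : func B σ u w f = B (aeval σ f u) w := rfl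

lemma dvd_of_func {p : F[X]} (hp : Irreducible p) {l : ℕ} {u w : V}
    (hu : aeval σ (p ^ l) u = 0) {r : F[X]} (hr : B (aeval σ (r * p ^ (l - 1)) u) w ≠ 0)
    {f : F[X]} (hf : ∀ g, B (aeval σ (g * f) u) w = 0) : p ^ l ∣ f := by
  refine pow_dvd_of_mem hp (funcIdeal (func B σ u w)) (fun g => ?_) (fun h => hr ?_) hf
  · rw [func_apply, aeval_mul_apply, hu, map_zero, map_zero, LinearMap.zero_apply]
  · exact h r

variable (hB : Asym B σ τ)
include hB

lemma symm_asym : Asym B.flip τ σ where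
  swap u v := by
    change B v u = B u (τ v)
    rw [← hB.adj_one, ← hB.swap]
  right_inv := hB.left_inv
  left_inv := hB.right_inv
  nondeg := hB.nondeg_right

lemma inv_apply {q T : F[X]} (hT : q ∣ X * T - 1) {v : V} (hv : aeval σ q v = 0) :
    τ v = aeval σ T v := by
  have := aeval_eq_zero_of_dvd hv hT
  rw [map_sub, LinearMap.sub_apply, map_one, Module.End.one_apply, sub_eq_zero, aeval_mul_apply,
    aeval_X] at this
  rw [← this, hB.left_inv, this]

lemma dvd_of_pairing {p : F[X]} (hp : Irreducible p) (hm : p.Monic) {l : ℕ} {u w : V}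
    (hu : aeval σ (p ^ l) u = 0) (huw : B (aeval σ (p ^ (l - 1)) u) w ≠ 0) {g : F[X]}
    (h : ∀ i < (p ^ l).natDegree, B ((σ ^ i) u) (aeval τ g w) = 0) : p ^ l ∣ g := by
  refine dvd_of_func (B := B) (w := w) hp hu (r := 1) (by rwa [one_mul]) fun f => ?_
  rw [mul_comm, aeval_mul_apply, hB.adj]
  generalize hz : aeval σ f u = z
  have hz' : z ∈ Submodule.span F (Set.range fun i : Fin (p ^ l).natDegree => (σ ^ (i : ℕ)) u) :=
    hz ▸ aeval_mem_span (hm.pow l) hu f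
  clear hz
  induction hz' using Submodule.span_induction with
  | mem x hx =>
    obtain ⟨i, rfl⟩ := hx
    exact h i i.2
  | zero => simp
  | add x y _ _ hx hy => rw [map_add, LinearMap.add_apply, hx, hy, add_zero]
  | smul a x _ hx => rw [map_smul, LinearMap.smul_apply, hx, smul_zero]

lemma exists_dual {p : F[X]} (hp : Irreducible p) (hm : p.Monic) {l d : ℕ}
    (hd : (p ^ l).natDegree = d) {u w : V}
    (hu : aeval σ (p ^ l) u = 0) (huw : B (aeval σ (p ^ (l - 1)) u) w ≠ 0) (c : Fin d → F) :
    ∃ g : F[X], ∀ i : Fin d, B ((σ ^ (i : ℕ)) u) (aeval τ g w) = c i := by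
  let L : degreeLT F d →ₗ[F] (Fin d → F) := LinearMap.pi fun i =>
    B ((σ ^ (i : ℕ)) u) ∘ₗ (LinearMap.applyₗ w ∘ₗ (aeval τ).toLinearMap) ∘ₗ Submodule.subtype _
  have hL : ∀ g i, L g i = B ((σ ^ (i : ℕ)) u) (aeval τ (g : F[X]) w) := fun g i => rfl
  have hinj : Function.Injective L := by
    rw [injective_iff_map_eq_zero]
    intro g hg
    have h2 : p ^ l ∣ (g : F[X]) := by
      refine hB.dvd_of_pairing hp hm hu huw fun i hi => ?_
      rw [← hL g ⟨i, hd ▸ hi⟩, hg]; rfl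
    refine Subtype.ext (eq_zero_of_dvd_of_degree_lt h2 ?_)
    rw [degree_eq_natDegree (hm.pow l).ne_zero, hd]
    exact mem_degreeLT.1 g.2
  have hfr : Module.finrank F (degreeLT F d) = Module.finrank F (Fin d → F) :=
    (degreeLTEquiv F d).finrank_eq
  have : FiniteDimensional F (degreeLT F d) :=
    Module.Finite.equiv (degreeLTEquiv F d).symm
  obtain ⟨g, hg⟩ := (LinearMap.injective_iff_surjective_of_finrank_eq_finrank hfr).1 hinj c
  exact ⟨g, fun i => by rw [← hL, hg]⟩

omit hB in
lemma apply_pow_eq_sum_companion {q : F[X]} (hq : q.Monic) {u : V} (hu : aeval σ q u = 0)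
    (i : Fin q.natDegree) :
    σ ((σ ^ (i : ℕ)) u) = ∑ j : Fin q.natDegree, companion F q j i • (σ ^ (j : ℕ)) u := by
  rw [← Module.End.mul_apply, ← pow_succ']
  by_cases hi : (i : ℕ) + 1 = q.natDegree
  · rw [aeval_eq_sum_range, Finset.sum_range_succ, hq.coeff_natDegree, one_smul,
      LinearMap.add_apply, add_eq_zero_iff_eq_neg', LinearMap.sum_apply, ← Finset.sum_neg_distrib,
      Finset.sum_range] at hu
    rw [hi, hu]
    refine Finset.sum_congr rfl fun j _ => ?_
    have := j.2
    simp only [companion, Matrix.of_apply]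
    rw [if_neg (by omega), if_pos hi, neg_smul, LinearMap.smul_apply]
  · have h := i.2
    rw [Finset.sum_eq_single (⟨i + 1, by omega⟩ : Fin q.natDegree)]
    · simp [companion]
    · intro j _ hj
      rw [Ne, Fin.ext_iff] at hj
      dsimp at hj
      simp [companion, hj, hi]
    · simp

/-- Two paired totally isotropic cyclic subspaces span a skew sum. -/
lemma exists_split_skew {p : F[X]} (hp : Irreducible p) (hm : p.Monic) (h0 : p.eval 0 ≠ 0) {l : ℕ}
    {u w : V} (hu : aeval σ (p ^ l) u = 0) (hw : aeval τ (p ^ l) w = 0)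
    (huw : B (aeval σ (p ^ (l - 1)) u) w ≠ 0)
    (huu : ∀ f g : F[X], B (aeval σ f u) (aeval σ g u) = 0)
    (hww : ∀ f g : F[X], B (aeval τ f w) (aeval τ g w) = 0) :
    ∃ T : Submodule F V, Isom (prodForm (bf (skewIBlock (p ^ l))) (B.domRestrict₁₂ T T)) B := by
  obtain ⟨T, hT⟩ := exists_inverse_X (q := p ^ l) (by rw [eval_pow]; exact pow_ne_zero _ h0)
  choose g hg using fun j : Fin (p ^ l).natDegree =>
    hB.exists_dual hp hm rfl hu huw (fun i => if i = j then 1 else 0)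
  have hq := hm.pow l
  let x : Fin (p ^ l).natDegree → V := fun i => (σ ^ (i : ℕ)) u
  have hx : ∀ i, x i = aeval σ (X ^ (i : ℕ) : F[X]) u := fun i => by simp [x]
  let y : Fin (p ^ l).natDegree → V := fun j => aeval τ (g j) w
  have hxx : ∀ i j, B (x i) (x j) = 0 := fun i j => by rw [hx, hx, huu]
  have hyy : ∀ i j, B (y i) (y j) = 0 := fun i j => hww _ _
  have hxy : ∀ i j, B (x i) (y j) = if i = j then 1 else 0 := fun i j => hg j i
  have hσx : ∀ i, σ (x i) = ∑ j, companion F (p ^ l) j i • x j :=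
    apply_pow_eq_sum_companion hq hu
  let f : Fin ((p ^ l).natDegree + (p ^ l).natDegree) → V := Sum.elim x y ∘ finSumFinEquiv.symm
  let φ : Fin ((p ^ l).natDegree + (p ^ l).natDegree) → V →ₗ[F] F :=
    Sum.elim (fun i => B.flip (y i)) (fun i => B (x i)) ∘ finSumFinEquiv.symm
  refine exists_split_of_inv hB f φ ?_ ?_ ?_
  · intro i j
    obtain ⟨i, rfl⟩ := finSumFinEquiv.surjective i
    obtain ⟨j, rfl⟩ := finSumFinEquiv.surjective j
    rcases i with i | i <;> rcases j with j | j
    · simp [-finSumFinEquiv_apply_left, -finSumFinEquiv_apply_right, φ, f, hxy, eq_comm]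
    · simp [-finSumFinEquiv_apply_left, -finSumFinEquiv_apply_right, φ, f, hyy]
    · simp [-finSumFinEquiv_apply_left, -finSumFinEquiv_apply_right, φ, f, hxx]
    · simp [-finSumFinEquiv_apply_left, -finSumFinEquiv_apply_right, φ, f, hxy]
  · intro i v
    obtain ⟨i, rfl⟩ := finSumFinEquiv.surjective i
    rw [← Equiv.sum_comp finSumFinEquiv, Fintype.sum_sum_type]
    rcases i with i | i
    · have : B v (x i) = ∑ j, companion F (p ^ l) j i * B (x j) v := by
        rw [hB.swap, hσx]
        simp
      simpa [-finSumFinEquiv_apply_left, -finSumFinEquiv_apply_right, φ, f, skewSum, mul_comm]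
        using this
    · simp [-finSumFinEquiv_apply_left, -finSumFinEquiv_apply_right, φ, f, skewSum,
        Matrix.one_apply]
  · intro i
    obtain ⟨i, rfl⟩ := finSumFinEquiv.surjective i
    rcases i with i | i
    · have h1 : τ (x i) ∈ Submodule.span F (Set.range x) := by
        rw [hB.inv_apply hT (v := x i) (by rw [hx, aeval_apply_comm, hu, map_zero]), hx,
          ← aeval_mul_apply]
        exact aeval_mem_span hq hu _
      simp only [f, Function.comp_apply, Equiv.symm_apply_apply, Sum.elim_inl]
      refine Submodule.span_mono ?_ h1
      rintro _ ⟨j, rfl⟩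
      exact ⟨finSumFinEquiv (Sum.inl j),
        by simp [-finSumFinEquiv_apply_left, -finSumFinEquiv_apply_right]⟩
    · have h1 : τ (y i) ∈ Submodule.span F (Set.range y) := by
        have h2 : τ (y i) = ∑ j, B (x j) (τ (y i)) • y j := by
          have h3 : τ (y i) - ∑ j, B (x j) (τ (y i)) • y j =
              aeval τ (X * g i - ∑ j, C (B (x j) (τ (y i))) * g j) w := by
            simp [y, map_sum, LinearMap.sum_apply]
          rw [← sub_eq_zero, h3]
          refine aeval_eq_zero_of_dvd hw (hB.dvd_of_pairing hp hm hu huw fun k hk => ?_)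
          rw [← h3]
          change B (x ⟨k, hk⟩) _ = 0
          simp [hxy]
        rw [h2]
        exact Submodule.sum_mem _ fun j _ => Submodule.smul_mem _ _ (Submodule.subset_span ⟨j, rfl⟩)
      simp only [f, Function.comp_apply, Equiv.symm_apply_apply, Sum.elim_inr]
      refine Submodule.span_mono ?_ h1
      rintro _ ⟨j, rfl⟩
      exact ⟨finSumFinEquiv (Sum.inr j),
        by simp [-finSumFinEquiv_apply_left, -finSumFinEquiv_apply_right]⟩

end Asym
end Skew

/-! ### Norms from rings with involution -/

/-- A fixed unit that is a norm modulo a nilpotent element is a norm. -/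
lemma exists_norm_of_isNilpotent {R : Type*} [CommRing R] (ℓ : ℕ) [Fact ℓ.Prime] [CharP R ℓ]
    (hℓ : Odd ℓ) (bar : R →+* R) {a c : R} (ha : IsUnit a) (hbar : bar a = a)
    (hn : IsNilpotent (a - c * bar c)) : ∃ c', a = c' * bar c' := by
  obtain ⟨k, hk⟩ := hn
  have hN : a ^ ℓ ^ k = (c * bar c) ^ ℓ ^ k := by
    rw [← sub_eq_zero, ← sub_pow_char_pow]
    exact pow_eq_zero_of_le (Nat.lt_pow_self (Fact.out : ℓ.Prime).one_lt).le hk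
  obtain ⟨m, hm⟩ := hℓ.pow (n := k)
  obtain ⟨u, rfl⟩ := ha
  have hub : bar ((u⁻¹ : Rˣ) : R) = ((u⁻¹ : Rˣ) : R) := by
    have h1 : bar ((u⁻¹ : Rˣ) : R) * (u : R) = 1 := by
      rw [← hbar, ← map_mul, Units.inv_mul, map_one]
    exact (Units.inv_eq_of_mul_eq_one_left h1).symm
  refine ⟨c ^ ℓ ^ k * ((u⁻¹ : Rˣ) : R) ^ m, ?_⟩
  rw [map_mul, map_pow, map_pow, hub]
  have h2 : (u : R) * ((u⁻¹ : Rˣ) : R) = 1 := Units.mul_inv u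
  calc (u : R) = u * (u * ((u⁻¹ : Rˣ) : R)) ^ (2 * m) := by rw [h2, one_pow, mul_one]
    _ = (u : R) ^ ℓ ^ k * ((u⁻¹ : Rˣ) : R) ^ m * ((u⁻¹ : Rˣ) : R) ^ m := by rw [hm]; ring
    _ = _ := by rw [hN]; ring

/-- Norms from a finite field to the fixed field of an involution are surjective. -/
lemma exists_norm_of_field {K : Type*} [Field K] [Finite K] (h2 : (2 : K) ≠ 0) (bar : K →+* K)
    (hinv : ∀ x, bar (bar x) = x) {t : K} (ht : bar t ≠ t) {a : K} (ha : bar a = a) :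
    ∃ c, a = c * bar c := by
  let K₀ : Subfield K := RingHom.eqLocusField bar (RingHom.id K)
  have hK₀ : ∀ x, x ∈ K₀ ↔ bar x = x := fun x => Iff.rfl
  have := Fintype.ofFinite K₀
  have hodd : Fintype.card K₀ % 2 = 1 := by
    refine FiniteField.odd_card_of_char_ne_two fun h => h2 ?_
    have : ((2 : K₀) : K) = 0 := by
      have h3 : CharP K₀ 2 := h ▸ ringChar.charP K₀
      rw [CharTwo.two_eq_zero]; rfl
    exact this
  have hδ : bar (t - bar t) = -(t - bar t) := by rw [map_sub, hinv]; ring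
  have hδ0 : t - bar t ≠ 0 := fun h => ht (sub_eq_zero.1 h).symm
  let e : K₀ := ⟨(t - bar t) ^ 2, by rw [hK₀, map_pow, hδ, neg_sq]⟩
  have he : -e ≠ 0 := neg_ne_zero.2 fun h => pow_ne_zero 2 hδ0 (congrArg Subtype.val h)
  obtain ⟨x, y, hxy⟩ := FiniteField.exists_root_sum_quadratic (R := K₀)
    (f := X ^ 2 - C ⟨a, ha⟩) (g := C (-e) * X ^ 2) (degree_X_pow_sub_C (by decide) _)
    (by rw [degree_C_mul_X_pow 2 he]; rfl) hodd
  have hxy' := congrArg Subtype.val hxy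
  simp [e] at hxy'
  refine ⟨x + y * (t - bar t), ?_⟩
  rw [map_add, map_mul, hδ, (hK₀ x).1 x.2, (hK₀ y).1 y.2]
  linear_combination -hxy'

lemma exists_bar {q : F[X]} (h0 : q.eval 0 ≠ 0) (hd : dualPoly (RingHom.id F) q = q) :
    ∃ bar : AdjoinRoot q →ₐ[F] AdjoinRoot q, AdjoinRoot.root q * bar (AdjoinRoot.root q) = 1 := by
  obtain ⟨T, hT⟩ := exists_inverse_X h0
  have h1 : AdjoinRoot.root q * AdjoinRoot.mk q T = 1 := by
    rw [← AdjoinRoot.mk_X, ← map_mul, ← sub_eq_zero, ← map_one (AdjoinRoot.mk q), ← map_sub,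
      AdjoinRoot.mk_eq_zero]
    exact hT
  let : Invertible (AdjoinRoot.mk q T) := ⟨AdjoinRoot.root q, h1, by rw [mul_comm, h1]⟩
  have h2 := eval₂_reverse_mul_pow (algebraMap F (AdjoinRoot q)) (AdjoinRoot.mk q T) q
  have h3 : q.reverse = C (q.coeff 0) * q := by
    rw [dualPoly, RingHom.id_apply, Polynomial.map_id] at hd
    have h := congrArg (C (q.coeff 0) * ·) hd
    rwa [← mul_assoc, ← C_mul, mul_inv_cancel₀ (by rwa [coeff_zero_eq_eval_zero]), C_1,
      one_mul] at h
  have h4 : eval₂ (Algebra.ofId F (AdjoinRoot q) : F →+* AdjoinRoot q) (AdjoinRoot.mk q T) q =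
      0 := by
    change eval₂ (algebraMap F (AdjoinRoot q)) _ q = 0
    rw [← h2, h3, eval₂_mul, show ⅟(AdjoinRoot.mk q T) = AdjoinRoot.root q from rfl,
      AdjoinRoot.algebraMap_eq, AdjoinRoot.eval₂_root, mul_zero, zero_mul]
  refine ⟨AdjoinRoot.liftAlgHom q (Algebra.ofId F _) (AdjoinRoot.mk q T) h4, ?_⟩
  rw [AdjoinRoot.liftAlgHom_root, h1]

lemma dualPoly_mul (f g : F[X]) : dualPoly (RingHom.id F) (f * g) =
    dualPoly (RingHom.id F) f * dualPoly (RingHom.id F) g := by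
  simp only [dualPoly, Polynomial.map_id, reverse_mul_of_domain, mul_coeff_zero, RingHom.id_apply,
    mul_inv, C_mul]
  ring

lemma dualPoly_pow (f : F[X]) (l : ℕ) : dualPoly (RingHom.id F) (f ^ l) =
    dualPoly (RingHom.id F) f ^ l := by
  induction l with
  | zero => simp [dualPoly, show reverse (1 : F[X]) = 1 by rw [← C_1, reverse_C]]
  | succ l ih => rw [pow_succ, dualPoly_mul, ih, pow_succ]

section Bar

variable {q : F[X]} {bar : AdjoinRoot q →ₐ[F] AdjoinRoot q}
  (hbar : AdjoinRoot.root q * bar (AdjoinRoot.root q) = 1)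
include hbar

lemma bar_bar (x : AdjoinRoot q) : bar (bar x) = x := by
  have : bar.comp bar = AlgHom.id F _ := by
    refine AdjoinRoot.algHom_ext ?_
    rw [AlgHom.comp_apply, AlgHom.id_apply]
    have h := congrArg bar hbar
    rw [map_mul, map_one, mul_comm] at h
    exact left_inv_eq_right_inv h (by rw [mul_comm, hbar])
  exact DFunLike.congr_fun this x

end Bar

section Unit

lemma isUnit_mk {p f : F[X]} (hp : Irreducible p) (hf : ¬ p ∣ f) (l : ℕ) :
    IsUnit (AdjoinRoot.mk (p ^ l) f) := by
  obtain ⟨a, b, hab⟩ := ((hp.coprime_iff_not_dvd).2 hf).pow_left (m := l)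
  refine IsUnit.of_mul_eq_one (AdjoinRoot.mk (p ^ l) b) ?_
  rw [mul_comm, ← map_mul, ← map_one (AdjoinRoot.mk (p ^ l)), ← hab, map_add, map_mul _ a,
    AdjoinRoot.mk_self, mul_zero, zero_add]

variable (h2 : (2 : F) ≠ 0) {p : F[X]} (hp : Irreducible p) {l : ℕ} (hl : 0 < l)
  {bar : AdjoinRoot (p ^ l) →ₐ[F] AdjoinRoot (p ^ l)}
include h2 hp hl

lemma exists_norm_of_dvd [Finite F] {a c : AdjoinRoot (p ^ l)} (ha : IsUnit a) (hba : bar a = a)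
    {f : F[X]} (hf : p ∣ f) (hac : a - c * bar c = AdjoinRoot.mk _ f) :
    ∃ c, a = c * bar c := by
  obtain ⟨ℓ, hℓ⟩ := CharP.exists F
  have hℓp : Fact ℓ.Prime := ⟨(CharP.char_is_prime F ℓ)⟩
  have hnt : Nontrivial (AdjoinRoot (p ^ l)) := AdjoinRoot.nontrivial _ fun h => by
    rw [degree_pow] at h
    have := degree_pos_of_irreducible hp
    rw [nsmul_eq_mul] at h
    rcases mul_eq_zero.1 h with h | h
    · exact hl.ne' (by exact_mod_cast h)
    · exact this.ne' h
  have : CharP (AdjoinRoot (p ^ l)) ℓ :=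
    charP_of_injective_algebraMap (algebraMap F _).injective ℓ
  have hodd : Odd ℓ := hℓp.out.odd_of_ne_two fun h => h2 (by
    subst h; exact CharP.cast_eq_zero F 2)
  refine exists_norm_of_isNilpotent ℓ hodd bar.toRingHom ha hba (c := c) ⟨l, ?_⟩
  change (a - c * bar c) ^ l = 0
  rw [hac, ← map_pow, AdjoinRoot.mk_eq_zero]
  exact pow_dvd_pow_of_dvd hf l

lemma exists_norm_of_two_le [Finite F]
    (hbar : AdjoinRoot.root (p ^ l) * bar (AdjoinRoot.root (p ^ l)) = 1)
    (h0 : p.eval 0 ≠ 0) (hd : dualPoly (RingHom.id F) p = p)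
    (hdeg : 2 ≤ p.natDegree) {a : AdjoinRoot (p ^ l)} (ha : IsUnit a) (hba : bar a = a) :
    ∃ c, a = c * bar c := by
  have : Fact (Irreducible p) := ⟨hp⟩
  obtain ⟨bar', hbar'⟩ := exists_bar h0 hd
  let π : AdjoinRoot (p ^ l) →ₐ[F] AdjoinRoot p :=
    AdjoinRoot.algHomOfDvd F (p ^ l) p (dvd_pow_self p hl.ne')
  have hπr : π (AdjoinRoot.root _) = AdjoinRoot.root _ := AdjoinRoot.algHomOfDvd_root ..
  have hπ : ∀ x, π (bar x) = bar' (π x) := by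
    have : π.comp bar = bar'.comp π := by
      refine AdjoinRoot.algHom_ext ?_
      rw [AlgHom.comp_apply, AlgHom.comp_apply, hπr]
      have h := congrArg π hbar
      rw [map_mul, map_one, hπr, mul_comm] at h
      exact left_inv_eq_right_inv h hbar'
    exact DFunLike.congr_fun this
  have hπs : ∀ f, π (AdjoinRoot.mk _ f) = AdjoinRoot.mk _ f := fun f => by
    rw [← AdjoinRoot.aeval_eq, ← aeval_algHom_apply, hπr, AdjoinRoot.aeval_eq]
  have hfin : Finite (AdjoinRoot p) := by
    have := (AdjoinRoot.powerBasis hp.ne_zero).finite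
    exact Module.finite_of_finite F
  have hroot : bar' (AdjoinRoot.root p) ≠ AdjoinRoot.root p := by
    intro h
    rw [h, ← AdjoinRoot.mk_X, ← map_mul, ← sub_eq_zero, ← map_one (AdjoinRoot.mk p), ← map_sub,
      AdjoinRoot.mk_eq_zero, show (X * X - 1 : F[X]) = (X - C 1) * (X - C (-1)) by
        simp only [C_1, C_neg]; ring] at hbar'
    rcases hp.prime.dvd_or_dvd hbar' with h | h
    · have := natDegree_le_of_dvd h (X_sub_C_ne_zero _)
      rw [natDegree_X_sub_C] at this
      omega
    · have := natDegree_le_of_dvd h (X_sub_C_ne_zero _)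
      rw [natDegree_X_sub_C] at this
      omega
  obtain ⟨c₀, hc₀⟩ := exists_norm_of_field (K := AdjoinRoot p)
    (by
      have := (algebraMap F (AdjoinRoot p)).injective.ne h2
      rwa [map_ofNat, map_zero] at this)
    bar'.toRingHom (bar_bar hbar') hroot (a := π a) (by
      change bar' (π a) = π a
      rw [← hπ, hba])
  obtain ⟨c, rfl⟩ := AdjoinRoot.mk_surjective c₀
  obtain ⟨f, hf⟩ := AdjoinRoot.mk_surjective (a - AdjoinRoot.mk _ c * bar (AdjoinRoot.mk _ c))
  refine exists_norm_of_dvd h2 hp hl ha hba (f := f) ?_ hf.symm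
  have h3 : π (AdjoinRoot.mk _ f) = 0 := by
    rw [hf, map_sub, map_mul, hπ, hπs]
    exact sub_eq_zero.2 hc₀
  rwa [hπs, AdjoinRoot.mk_eq_zero] at h3

omit hp in
lemma exists_norm_of_X_sub_C [Fintype F] {ζ : F} (hζ : ¬ IsSquare ζ) {lam : F}
    (hlam : p = X - C lam) {f : F[X]} (hf : ¬ p ∣ f)
    (hba : bar (AdjoinRoot.mk _ f) = AdjoinRoot.mk _ f) :
    (∃ c, AdjoinRoot.mk _ f = c * bar c) ∨ ∃ c, AdjoinRoot.mk _ (C ζ * f) = c * bar c := by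
  have hp : Irreducible p := hlam ▸ irreducible_X_sub_C lam
  have key : ∀ g : F[X], ¬ p ∣ g → bar (AdjoinRoot.mk _ g) = AdjoinRoot.mk _ g →
      IsSquare (g.eval lam) → ∃ c, AdjoinRoot.mk (p ^ l) g = c * bar c := by
    intro g hg hbg ⟨c, hc⟩
    refine exists_norm_of_dvd h2 hp hl (isUnit_mk hp hg l) hbg (c := algebraMap F _ c)
      (f := g - C (g.eval lam)) (hlam ▸ X_sub_C_dvd_sub_C_eval) ?_
    rw [AlgHom.commutes, hc, ← map_mul, map_sub]
    rfl
  have hζ0 : ζ ≠ 0 := fun h => hζ (h ▸ IsSquare.zero)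
  have hf0 : f.eval lam ≠ 0 := by rwa [hlam, dvd_iff_isRoot] at hf
  by_cases hsq : IsSquare (f.eval lam)
  · exact Or.inl (key f hf hba hsq)
  · refine Or.inr (key (C ζ * f) ?_ ?_ ?_)
    · rw [hlam, dvd_iff_isRoot, IsRoot.def, eval_mul, eval_C]
      exact mul_ne_zero hζ0 hf0
    · rw [map_mul, map_mul, hba]
      congr 1
      exact bar.commutes ζ
    · have hchar : ringChar F ≠ 2 := fun h => h2 (by
        have : CharP F 2 := h ▸ ringChar.charP F
        exact CharTwo.two_eq_zero)
      classical
      rw [eval_mul, eval_C, ← quadraticChar_one_iff_isSquare (mul_ne_zero hζ0 hf0), map_mul,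
        quadraticChar_neg_one_iff_not_isSquare.2 hζ, quadraticChar_neg_one_iff_not_isSquare.2 hsq]
      rfl

end Unit

/-! ### Splitting off cyclic summands -/

section Cyclic

variable {V V' : Type*} [AddCommGroup V] [Module F V] [AddCommGroup V'] [Module F V']
  {B : BilinForm F V} {σ τ : Module.End F V} {B' : BilinForm F V'} {ρ ρ' : Module.End F V'}

lemma pow_dvd_of_aeval_eq_zero {p : F[X]} (hp : Irreducible p) {l : ℕ} {v : V}
    (hv : aeval σ (p ^ l) v = 0) (hv' : aeval σ (p ^ (l - 1)) v ≠ 0) {f : F[X]}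
    (hf : aeval σ f v = 0) : p ^ l ∣ f := by
  let I : Ideal F[X] :=
    { carrier := {f | aeval σ f v = 0}
      add_mem' := fun {a b} ha hb => by
        change aeval σ (a + b) v = 0
        rw [map_add, LinearMap.add_apply, show aeval σ a v = 0 from ha,
          show aeval σ b v = 0 from hb, add_zero]
      zero_mem' := by simp
      smul_mem' := fun c f hf => aeval_eq_zero_of_dvd hf (dvd_mul_left f c) }
  exact pow_dvd_of_mem hp I hv hv' hf

lemma exists_aeval_eq {p : F[X]} (hp : Irreducible p) {l m : ℕ} (hd : (p ^ l).natDegree = m)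
    {ρ : Module.End F (Fin m → F)} {g : Fin m → F} (hg : aeval ρ (p ^ l) g = 0)
    (hg' : aeval ρ (p ^ (l - 1)) g ≠ 0) (x : Fin m → F) : ∃ f : F[X], aeval ρ f g = x := by
  let ψ : degreeLT F m →ₗ[F] (Fin m → F) :=
    (LinearMap.applyₗ g ∘ₗ (aeval ρ).toLinearMap) ∘ₗ Submodule.subtype _
  have hinj : Function.Injective ψ := by
    refine (injective_iff_map_eq_zero ψ).2 fun f hf => Subtype.ext ?_
    refine eq_zero_of_dvd_of_degree_lt (pow_dvd_of_aeval_eq_zero hp hg hg' hf) ?_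
    rw [degree_eq_natDegree (pow_ne_zero l hp.ne_zero), hd]
    exact mem_degreeLT.1 f.2
  have := Module.Finite.equiv (degreeLTEquiv F m).symm
  have hsurj : Function.Surjective ψ :=
    (LinearMap.injective_iff_surjective_of_finrank_eq_finrank
      (degreeLTEquiv F m).finrank_eq).1 hinj
  obtain ⟨f, hf⟩ := hsurj x
  exact ⟨f, hf⟩

namespace Asym

lemma aeval_inv (hB : Asym B σ τ) {q T : F[X]} (hT : q ∣ X * T - 1) {v : V}
    (hv : aeval σ q v = 0) (g : F[X]) : aeval τ g v = aeval σ (g.comp T) v := by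
  induction g using Polynomial.induction_on with
  | C a => simp
  | add p q hp hq => simp [hp, hq]
  | monomial n a ih =>
    rw [show C a * X ^ (n + 1) = X * (C a * X ^ n) by ring, aeval_mul_apply, aeval_X, ih]
    conv_rhs => rw [mul_comp, X_comp, aeval_mul_apply]
    refine hB.inv_apply hT ?_
    rw [aeval_apply_comm, hv, map_zero]

lemma bar_apply (hB : Asym B σ τ) {q : F[X]} {bar : AdjoinRoot q →ₐ[F] AdjoinRoot q}
    (hbar : AdjoinRoot.root q * bar (AdjoinRoot.root q) = 1) {v : V} (hv : aeval σ q v = 0)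
    {g h : F[X]} (hgh : AdjoinRoot.mk q h = bar (AdjoinRoot.mk q g)) :
    aeval τ g v = aeval σ h v := by
  obtain ⟨T, hT⟩ := AdjoinRoot.mk_surjective (bar (AdjoinRoot.root q))
  have hT' : q ∣ X * T - 1 := by
    rw [← AdjoinRoot.mk_eq_zero, map_sub, map_mul, hT, AdjoinRoot.mk_X, hbar, map_one, sub_self]
  rw [hB.aeval_inv hT' hv]
  refine aeval_eq_of_dvd_sub hv ?_
  rw [← AdjoinRoot.mk_eq_mk, hgh, ← AdjoinRoot.aeval_eq g, ← aeval_algHom_apply, ← hT,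
    ← AdjoinRoot.aeval_eq (g.comp T), ← AdjoinRoot.aeval_eq T, aeval_comp]

lemma adj' (hB : Asym B σ τ) (f : F[X]) (u v : V) : B u (aeval σ f v) = B (aeval τ f u) v := by
  induction f using Polynomial.induction_on generalizing v with
  | C a => simp
  | add p q hp hq => simp [hp, hq]
  | monomial n a ih =>
    rw [show C a * X ^ (n + 1) = C a * X ^ n * X by ring, aeval_mul_apply, aeval_X, ih, hB.adj_one',
      mul_comm _ X, aeval_mul_apply X, aeval_X]

variable {p : F[X]} {l : ℕ} {bar : AdjoinRoot (p ^ l) →ₐ[F] AdjoinRoot (p ^ l)}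

lemma apply_aeval_aeval (hB : Asym B σ τ)
    (hbar : AdjoinRoot.root (p ^ l) * bar (AdjoinRoot.root (p ^ l)) = 1) {u w : V}
    (hw : aeval σ (p ^ l) w = 0) {f g h : F[X]}
    (hgh : AdjoinRoot.mk (p ^ l) h = bar (AdjoinRoot.mk _ g)) :
    B (aeval σ f w) (aeval σ g u) = B (aeval σ (h * f) w) u := by
  rw [hB.adj', aeval_mul_apply, hB.bar_apply hbar (by
    rw [aeval_apply_comm, hw, map_zero]) hgh]


lemma linearMap_eq_of_eq_on_X_pow {N : Type*} [AddCommGroup N] [Module F N] {q : F[X]}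
    (hq : q.Monic) {L L' : F[X] →ₗ[F] N} (h : ∀ f, q ∣ f → L f = L' f)
    (hX : ∀ i < q.natDegree, L (X ^ i) = L' (X ^ i)) : L = L' := by
  refine LinearMap.ext fun f => ?_
  rw [← modByMonic_add_div f q, map_add, map_add, h _ (dvd_mul_right _ _)]
  congr 1
  by_cases hq1 : q = 1
  · simp [hq1]
  rw [as_sum_range' (f %ₘ q) q.natDegree (natDegree_modByMonic_lt _ hq hq1), map_sum, map_sum]
  refine Finset.sum_congr rfl fun i hi => ?_
  rw [← smul_X_eq_monomial, map_smul, map_smul, hX i (Finset.mem_range.1 hi)]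

/-- Two cyclic forms with the same annihilator differ by a self-conjugate unit. -/
lemma exists_unit_of_cyclic (hB : Asym B σ τ) (hB' : Asym B' ρ ρ') (hp : Irreducible p)
    (hm : p.Monic) (hl : 0 < l)
    (hbar : AdjoinRoot.root (p ^ l) * bar (AdjoinRoot.root (p ^ l)) = 1) {u : V} {g : V'}
    (hu : aeval σ (p ^ l) u = 0) (hg : aeval ρ (p ^ l) g = 0)
    {r s : F[X]} (hr : B (aeval σ (r * p ^ (l - 1)) u) u ≠ 0)
    (hs : B' (aeval ρ (s * p ^ (l - 1)) g) g ≠ 0) :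
    ∃ a, ¬ p ∣ a ∧ bar (AdjoinRoot.mk _ a) = AdjoinRoot.mk _ a ∧
      ∀ f : F[X], B' (aeval ρ f g) g = B (aeval σ (f * a) u) u := by
  obtain ⟨a₀, ha₀⟩ := hB.exists_dual hp hm rfl hu (w := aeval τ r u)
    (by rwa [← hB.adj, ← aeval_mul_apply]) fun i => B' (aeval ρ (X ^ (i : ℕ) : F[X]) g) g
  have key : ∀ f : F[X], B' (aeval ρ f g) g = B (aeval σ (f * (a₀ * r)) u) u := by
    have : func B' ρ g g = func B σ u u ∘ₗ LinearMap.mulRight F (a₀ * r) := by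
      refine linearMap_eq_of_eq_on_X_pow (hm.pow l) (fun f hf => ?_) fun i hi => ?_
      · rw [LinearMap.comp_apply, LinearMap.mulRight_apply, func_apply, func_apply,
          aeval_eq_zero_of_dvd hg hf, aeval_eq_zero_of_dvd hu (hf.mul_right _)]
        simp
      · rw [LinearMap.comp_apply, LinearMap.mulRight_apply, func_apply, func_apply, ← ha₀ ⟨i, hi⟩,
          ← hB.adj, ← hB.adj, show X ^ i * (a₀ * r) = r * (a₀ * X ^ i) by ring, aeval_mul_apply,
          aeval_mul_apply, map_pow, aeval_X]
    exact fun f => DFunLike.congr_fun this f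
  have hpl : p ^ (l - 1) * p = p ^ l := by rw [← pow_succ, Nat.sub_add_cancel hl]
  generalize a₀ * r = a at key
  refine ⟨a, ?_, ?_, key⟩
  · rintro ⟨b, rfl⟩
    rw [key, show s * p ^ (l - 1) * (p * b) = p ^ l * (s * b) by rw [← hpl]; ring,
      aeval_eq_zero_of_dvd hu (dvd_mul_right _ _)] at hs
    simp at hs
  · obtain ⟨a', ha'⟩ := AdjoinRoot.mk_surjective (bar (AdjoinRoot.mk _ a))
    rw [← ha', AdjoinRoot.mk_eq_mk]
    refine dvd_of_func (B := B) (w := u) hp hu hr fun f => ?_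
    obtain ⟨h, hh⟩ := AdjoinRoot.mk_surjective (bar (AdjoinRoot.mk _ f))
    obtain ⟨k, hk⟩ := AdjoinRoot.mk_surjective (bar (AdjoinRoot.mk _ (h * X * a)))
    have h1 : B (aeval σ (f * a) u) u = B (aeval σ (h * X * a) u) u := by
      rw [← key, ← key, hB'.swap, ← hB'.apply_aeval_aeval hbar hg hh, aeval_X]
    have h2 : B (aeval σ (h * X * a) u) u = B (aeval σ (f * a') u) u := by
      have h3 := hB.apply_aeval_aeval hbar hu (f := X) (u := u) hk
      rw [aeval_X] at h3
      rw [hB.swap, h3]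
      rw [aeval_eq_of_dvd_sub hu (f := k * X) (g := f * a')]
      rw [← AdjoinRoot.mk_eq_mk]
      simp only [map_mul, hk, hh, bar_bar hbar, AdjoinRoot.mk_X, ha']
      linear_combination (AdjoinRoot.mk _ f * bar (AdjoinRoot.mk _ a)) * hbar
    rw [mul_sub, map_sub, LinearMap.sub_apply, map_sub, LinearMap.sub_apply, h1, h2, sub_self]

/-- A vector whose cyclic form agrees with a matrix model splits off the model. -/
lemma exists_split_of_func (hB : Asym B σ τ) {m : ℕ} {M : Mat F m} (hM : IsUnit M.det)
    {ρ ρ' : Module.End F (Fin m → F)} (hB' : Asym (bf ⟨m, M⟩) ρ ρ') (hp : Irreducible p)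
    (hd : (p ^ l).natDegree = m)
    (hbar : AdjoinRoot.root (p ^ l) * bar (AdjoinRoot.root (p ^ l)) = 1) {u : V} {g : Fin m → F}
    (hu : aeval σ (p ^ l) u = 0) (hg : aeval ρ (p ^ l) g = 0) (hg' : aeval ρ (p ^ (l - 1)) g ≠ 0)
    (h : ∀ f : F[X], B (aeval σ f u) u = bf ⟨m, M⟩ (aeval ρ f g) g) :
    ∃ T : Submodule F V, Isom (prodForm (bf ⟨m, M⟩) (B.domRestrict₁₂ T T)) B := by
  choose s hs using fun i : Fin m => exists_aeval_eq hp hd hg hg' (Pi.single i 1)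
  have hBs : ∀ i j, B (aeval σ (s i) u) (aeval σ (s j) u) = M i j := fun i j => by
    obtain ⟨t, ht⟩ := AdjoinRoot.mk_surjective (bar (AdjoinRoot.mk _ (s j)))
    rw [hB.apply_aeval_aeval hbar hu ht, h, ← hB'.apply_aeval_aeval hbar hg ht, hs, hs, bf_apply]
    simp
  refine exists_split_of_inv hB (M := M) (fun i => aeval σ (s i) u)
    (fun j => ∑ i, M⁻¹ i j • B.flip (aeval σ (s i) u)) (fun j k => ?_) (fun i v => ?_) fun i => ?_
  · have : ∑ i, M k i * M⁻¹ i j = (1 : Mat F m) k j := by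
      rw [← Matrix.mul_nonsing_inv M hM, Matrix.mul_apply]
    simp only [LinearMap.sum_apply, LinearMap.smul_apply, LinearMap.BilinForm.flip_apply, hBs,
      smul_eq_mul]
    simp only [mul_comm (M⁻¹ _ _), this, Matrix.one_apply, eq_comm]
  · have : ∀ k, ∑ j, M⁻¹ k j * M j i = (1 : Mat F m) k i := fun k => by
      rw [← Matrix.nonsing_inv_mul M hM, Matrix.mul_apply]
    simp only [LinearMap.sum_apply, LinearMap.smul_apply, LinearMap.BilinForm.flip_apply,
      smul_eq_mul, Finset.sum_mul]
    rw [Finset.sum_comm]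
    simp only [mul_right_comm _ _ (M _ _), ← Finset.sum_mul, this, Matrix.one_apply]
    simp
  · obtain ⟨t, ht⟩ := AdjoinRoot.mk_surjective (bar (AdjoinRoot.mk (p ^ l) X))
    have h1 : τ (aeval σ (s i) u) = aeval σ (t * s i) u := by
      have := hB.bar_apply hbar (v := aeval σ (s i) u) (by rw [aeval_apply_comm, hu, map_zero]) ht
      rwa [aeval_X, ← aeval_mul_apply] at this
    have h2 : aeval ρ (t * s i - ∑ j, C (aeval ρ (t * s i) g j) * s j) g = 0 := by
      rw [map_sub, LinearMap.sub_apply, map_sum, LinearMap.sum_apply, sub_eq_zero]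
      simp only [aeval_mul_apply, hs, aeval_C]
      ext k
      simp [Pi.single_apply]
    rw [h1, aeval_eq_of_dvd_sub hu (pow_dvd_of_aeval_eq_zero hp hg hg' h2), map_sum,
      LinearMap.sum_apply]
    refine Submodule.sum_mem _ fun j _ => ?_
    rw [aeval_mul_apply, aeval_C]
    exact Submodule.smul_mem _ _ (Submodule.subset_span ⟨j, rfl⟩)

end Asym

end Cyclic

/-! ### Cyclic models -/

/-- The form of `M` is nondegenerate and its asymmetry is cyclic with minimal polynomial `p ^ l`. -/
def IsCyc (p : F[X]) (l m : ℕ) (M : Mat F m) : Prop :=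
  IsUnit M.det ∧ (p ^ l).natDegree = m ∧ ∃ ρ ρ' : Module.End F (Fin m → F), ∃ g,
    Asym (bf ⟨m, M⟩) ρ ρ' ∧ aeval ρ (p ^ l) g = 0 ∧ aeval ρ (p ^ (l - 1)) g ≠ 0

lemma bf_smul (c : F) {m : ℕ} (M : Mat F m) (u v : Fin m → F) :
    bf ⟨m, c • M⟩ u v = c * bf ⟨m, M⟩ u v := by
  rw [bf_apply, bf_apply, Matrix.smul_mulVec, dotProduct_smul, smul_eq_mul]

lemma Asym.smul_matrix {m : ℕ} {M : Mat F m} {ρ ρ' : Module.End F (Fin m → F)}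
    (hA : Asym (bf ⟨m, M⟩) ρ ρ') {c : F} (hc : c ≠ 0) : Asym (bf ⟨m, c • M⟩) ρ ρ' where
  swap u v := by rw [bf_smul, bf_smul, hA.swap]
  right_inv := hA.right_inv
  left_inv := hA.left_inv
  nondeg u hu := hA.nondeg u fun v => by
    have := hu v
    rw [bf_smul] at this
    exact (mul_eq_zero.1 this).resolve_left hc

lemma isUnit_det_smul {m : ℕ} {M : Mat F m} (hM : IsUnit M.det) {c : F} (hc : c ≠ 0) :
    IsUnit (c • M).det := by
  rw [Matrix.det_smul]
  exact (IsUnit.mk0 _ (pow_ne_zero _ hc)).mul hM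

section Split

variable {V : Type*} [AddCommGroup V] [Module F V]
  {B : BilinForm F V} {σ τ : Module.End F V} {p : F[X]} {l : ℕ}
  {bar : AdjoinRoot (p ^ l) →ₐ[F] AdjoinRoot (p ^ l)}

namespace Asym

lemma exists_split_of_norm (hB : Asym B σ τ) {m : ℕ} {M : Mat F m} (hM : IsUnit M.det)
    {ρ ρ' : Module.End F (Fin m → F)} (hB' : Asym (bf ⟨m, M⟩) ρ ρ') (hp : Irreducible p)
    (hd : (p ^ l).natDegree = m)
    (hbar : AdjoinRoot.root (p ^ l) * bar (AdjoinRoot.root (p ^ l)) = 1) {u : V} {g : Fin m → F}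
    (hu : aeval σ (p ^ l) u = 0) (hg : aeval ρ (p ^ l) g = 0) (hg' : aeval ρ (p ^ (l - 1)) g ≠ 0)
    {a : F[X]} (h : ∀ f : F[X], bf ⟨m, M⟩ (aeval ρ f g) g = B (aeval σ (f * a) u) u)
    (hc : ∃ c, AdjoinRoot.mk (p ^ l) a = c * bar c) :
    ∃ T : Submodule F V, Isom (prodForm (bf ⟨m, M⟩) (B.domRestrict₁₂ T T)) B := by
  obtain ⟨c, hc⟩ := hc
  obtain ⟨c, rfl⟩ := AdjoinRoot.mk_surjective c
  obtain ⟨d, hd'⟩ := AdjoinRoot.mk_surjective (bar (AdjoinRoot.mk _ c))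
  have hcu : aeval σ (p ^ l) (aeval σ c u) = 0 := by rw [aeval_apply_comm, hu, map_zero]
  refine hB.exists_split_of_func hM hB' hp hd hbar hcu hg hg' fun f => ?_
  rw [← aeval_mul_apply, hB.apply_aeval_aeval hbar hu hd', h,
    aeval_eq_of_dvd_sub hu (f := d * (f * c)) (g := f * a)]
  rw [← AdjoinRoot.mk_eq_mk]
  simp only [map_mul, hc, hd']
  ring

variable (hB : Asym B σ τ) (h2 : (2 : F) ≠ 0) (hp : Irreducible p) (hm : p.Monic) (hl : 0 < l)
  (h0 : p.eval 0 ≠ 0) (hd : dualPoly (RingHom.id F) p = p) {m : ℕ} {M : Mat F m}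
  (hM : IsCyc p l m M) {u : V} (hu : aeval σ (p ^ l) u = 0) {r : F[X]}
  (hr : B (aeval σ (r * p ^ (l - 1)) u) u ≠ 0)
include hB hp hm hl hu hr hM

lemma _root_.Can.IsCyc.exists_unit
    (hbar : AdjoinRoot.root (p ^ l) * bar (AdjoinRoot.root (p ^ l)) = 1) :
    ∃ ρ ρ' : Module.End F (Fin m → F), ∃ g, Asym (bf ⟨m, M⟩) ρ ρ' ∧ aeval ρ (p ^ l) g = 0 ∧
      aeval ρ (p ^ (l - 1)) g ≠ 0 ∧ ∃ a, ¬ p ∣ a ∧ bar (AdjoinRoot.mk _ a) = AdjoinRoot.mk _ a ∧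
      ∀ f : F[X], bf ⟨m, M⟩ (aeval ρ f g) g = B (aeval σ (f * a) u) u := by
  obtain ⟨hM1, hM2, ρ, ρ', g, hA, hg, hg'⟩ := hM
  refine ⟨ρ, ρ', g, hA, hg, hg', ?_⟩
  obtain ⟨x, hx⟩ : ∃ x, bf ⟨m, M⟩ (aeval ρ (p ^ (l - 1)) g) x ≠ 0 := by
    by_contra! hc
    exact hg' (hA.nondeg _ hc)
  obtain ⟨s, rfl⟩ := exists_aeval_eq hp hM2 hg hg' x
  obtain ⟨t, ht⟩ := AdjoinRoot.mk_surjective (bar (AdjoinRoot.mk _ s))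
  rw [hA.apply_aeval_aeval hbar hg ht] at hx
  exact hB.exists_unit_of_cyclic hA hp hm hl hbar hu hg hr hx

include h2 h0 hd

lemma exists_split_of_two_le [Finite F] (hdeg : 2 ≤ p.natDegree) :
    ∃ T : Submodule F V, Isom (prodForm (bf ⟨m, M⟩) (B.domRestrict₁₂ T T)) B := by
  obtain ⟨bar, hbar⟩ := exists_bar (q := p ^ l) (by rw [eval_pow]; exact pow_ne_zero _ h0)
    (by rw [dualPoly_pow, hd])
  obtain ⟨ρ, ρ', g, hA, hg, hg', a, ha, hba, h⟩ := hM.exists_unit hB hp hm hl hu hr hbar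
  exact hB.exists_split_of_norm hM.1 hA hp hM.2.1 hbar hu hg hg' h
    (exists_norm_of_two_le h2 hp hl hbar h0 hd hdeg (isUnit_mk hp ha l) hba)

lemma exists_split_of_X_sub_C [Fintype F] {ζ : F} (hζ : ¬ IsSquare ζ) {lam : F}
    (hlam : p = X - C lam) :
    (∃ T : Submodule F V, Isom (prodForm (bf ⟨m, M⟩) (B.domRestrict₁₂ T T)) B) ∨
    ∃ T : Submodule F V, Isom (prodForm (bf ⟨m, ζ • M⟩) (B.domRestrict₁₂ T T)) B := by
  obtain ⟨bar, hbar⟩ := exists_bar (q := p ^ l) (by rw [eval_pow]; exact pow_ne_zero _ h0)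
    (by rw [dualPoly_pow, hd])
  have hζ0 : ζ ≠ 0 := fun h => hζ (h ▸ IsSquare.zero)
  obtain ⟨ρ, ρ', g, hA, hg, hg', a, ha, hba, h⟩ := hM.exists_unit hB hp hm hl hu hr hbar
  rcases exists_norm_of_X_sub_C h2 hl hζ hlam ha hba with hc | hc
  · exact Or.inl (hB.exists_split_of_norm hM.1 hA hp hM.2.1 hbar hu hg hg' h hc)
  · refine Or.inr (hB.exists_split_of_norm (isUnit_det_smul hM.1 hζ0) (hA.smul_matrix hζ0) hp
      hM.2.1 hbar hu hg hg' (a := C ζ * a) (fun f => ?_) hc)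
    rw [bf_smul, h, mul_left_comm, aeval_mul_apply (C ζ), aeval_C, Module.algebraMap_end_apply,
      map_smul, LinearMap.smul_apply, smul_eq_mul]

end Asym

end Split

section Models

lemma asym_of_eq {m : ℕ} {M S : Mat F m} (hM : IsUnit M.det) (h : M = Mᵀ * S) :
    Asym (bf ⟨m, M⟩) (Matrix.toLin' S) (Matrix.toLin' S⁻¹) := by
  have hS : IsUnit S.det := by
    rw [h, Matrix.det_mul] at hM
    exact isUnit_of_mul_isUnit_right hM
  refine ⟨fun u v => ?_, fun v => ?_, fun v => ?_, fun u hu => ?_⟩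
  · rw [bf_apply, bf_apply, Matrix.toLin'_apply]
    conv_lhs => rw [dotProduct_comm, h]
    rw [← Matrix.mulVec_mulVec, Matrix.mulVec_transpose, ← Matrix.dotProduct_mulVec]
  · rw [Matrix.toLin'_apply, Matrix.toLin'_apply, Matrix.mulVec_mulVec, Matrix.mul_nonsing_inv _ hS,
      Matrix.one_mulVec]
  · rw [Matrix.toLin'_apply, Matrix.toLin'_apply, Matrix.mulVec_mulVec, Matrix.nonsing_inv_mul _ hS,
      Matrix.one_mulVec]
  · refine dotProduct_eq_zero u fun w => ?_
    have := hu (M⁻¹ *ᵥ w)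
    rwa [bf_apply, Matrix.mulVec_mulVec, Matrix.mul_nonsing_inv _ hM, Matrix.one_mulVec] at this

lemma exists_companion_cyclic {p : F[X]} (hp : Irreducible p) (hm : p.Monic) {l : ℕ} (hl : 0 < l) :
    ∃ g, aeval (Matrix.toLin' (companion F (p ^ l))) (p ^ l) g = 0 ∧
      aeval (Matrix.toLin' (companion F (p ^ l))) (p ^ (l - 1)) g ≠ 0 := by
  have hpos : 0 < (p ^ l).natDegree := by
    rw [natDegree_pow]
    exact Nat.mul_pos hl hp.natDegree_pos
  set S := companion F (p ^ l) with hS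
  have hmon : (p ^ l).Monic := hm.pow l
  have hS' : ∀ v i, Matrix.toLin' S v i = ∑ j, S i j * v j := fun v i => rfl
  have hpow : ∀ i (hi : i < (p ^ l).natDegree),
      (Matrix.toLin' S ^ i) (Pi.single ⟨0, hpos⟩ 1) = Pi.single ⟨i, hi⟩ 1 := by
    intro i
    induction i with
    | zero => intro _; rfl
    | succ i ih =>
      intro hi
      rw [pow_succ', Module.End.mul_apply, ih (by omega), Matrix.toLin'_apply,
        Matrix.mulVec_single_one]
      ext j
      simp only [hS, companion, Matrix.col_apply, Matrix.of_apply, Pi.single_apply, Fin.ext_iff]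
      rw [if_neg (c := i + 1 = _) hi.ne]
  have hlow : ∀ f : F[X], f.natDegree < (p ^ l).natDegree →
      aeval (Matrix.toLin' S) f (Pi.single ⟨0, hpos⟩ 1) =
        fun i : Fin (p ^ l).natDegree => f.coeff (i : ℕ) := by
    intro f hf
    rw [aeval_eq_sum_range' hf, LinearMap.sum_apply, ← Fin.sum_univ_eq_sum_range
      (fun i => (f.coeff i • Matrix.toLin' S ^ i) (Pi.single ⟨0, hpos⟩ 1))]
    ext j
    rw [Finset.sum_apply]
    simp only [LinearMap.smul_apply, hpow _ (Fin.is_lt _)]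
    simp [Pi.single_apply]
  refine ⟨Pi.single ⟨0, hpos⟩ 1, ?_, ?_⟩
  · have hlt : (p ^ l - X ^ (p ^ l).natDegree).natDegree < (p ^ l).natDegree := by
      exact IsMonicOfDegree.natDegree_sub_lt hpos.ne' ⟨rfl, hmon⟩
        ⟨natDegree_X_pow _, monic_X_pow _⟩
    have h1 := hlow _ hlt
    rw [map_sub, LinearMap.sub_apply, sub_eq_iff_eq_add] at h1
    rw [h1, map_pow, aeval_X]
    obtain ⟨d, hd⟩ : ∃ d, (p ^ l).natDegree = d + 1 := ⟨_, (Nat.succ_pred hpos.ne').symm⟩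
    have h2 : Matrix.toLin' S ^ (p ^ l).natDegree = Matrix.toLin' S * Matrix.toLin' S ^ d := by
      rw [← pow_succ', ← hd]
    rw [h2, Module.End.mul_apply, hpow d (by omega), Matrix.toLin'_apply, Matrix.mulVec_single_one]
    ext j
    simp only [hS, companion, Matrix.col_apply, Matrix.of_apply, Pi.add_apply, Pi.zero_apply]
    rw [if_neg (by have := j.2; omega), if_pos hd.symm, coeff_sub, coeff_X_pow,
      if_neg (by have := j.2; omega)]
    ring
  · rw [hlow]
    · intro h0
      have hd : (p ^ (l - 1)).natDegree < (p ^ l).natDegree := by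
        rw [natDegree_pow, natDegree_pow]
        exact Nat.mul_lt_mul_of_pos_right (by omega) hp.natDegree_pos
      have := congrFun h0 ⟨_, hd⟩
      simp only [Pi.zero_apply] at this
      exact (hm.pow (l - 1)).ne_zero (leadingCoeff_eq_zero.1 this)
    · rw [natDegree_pow, natDegree_pow]
      exact Nat.mul_lt_mul_of_pos_right (by omega) hp.natDegree_pos

lemma isCyc_of_companion {p : F[X]} (hp : Irreducible p) (hm : p.Monic) {l : ℕ} (hl : 0 < l)
    {M : Mat F (p ^ l).natDegree} (hM : IsUnit M.det) (h : M = Mᵀ * companion F (p ^ l)) :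
    IsCyc p l (p ^ l).natDegree M := by
  obtain ⟨g, hg, hg'⟩ := exists_companion_cyclic hp hm hl
  exact ⟨hM, rfl, _, _, g, asym_of_eq hM h, hg, hg'⟩

lemma isUnit_det_Gamma (n : ℕ) : IsUnit (Gamma F n).det := by
  have h := Matrix.det_permute' (Fin.revPerm (n := n)) (Gamma F n)
  have h2 : ((Gamma F n).submatrix id Fin.revPerm).det =
      ∏ i : Fin n, (-1 : F) ^ (n - 1 - (i : ℕ)) := by
    rw [Matrix.det_of_isLowerTriangular]
    · refine Finset.prod_congr rfl fun i _ => ?_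
      simp only [Gamma, Matrix.submatrix_apply, Matrix.of_apply, id, Fin.revPerm_apply, Fin.val_rev]
      rw [if_pos (by omega)]
    · intro i j hij
      have := Fin.lt_def.1 (OrderDual.toDual_lt_toDual.1 hij)
      simp only [Gamma, Matrix.submatrix_apply, Matrix.of_apply, id, Fin.revPerm_apply, Fin.val_rev]
      rw [if_neg (by omega)]
  rw [h2] at h
  have h3 : IsUnit (∏ i : Fin n, (-1 : F) ^ (n - 1 - (i : ℕ))) :=
    IsUnit.mk0 _ (Finset.prod_ne_zero_iff.2 fun i _ => pow_ne_zero _ (by simp))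
  rw [h] at h3
  exact isUnit_of_mul_isUnit_right h3

/-- The asymmetry of `Γₙ`. -/
def gammaAsym (F : Type*) [Field F] (n : ℕ) : Mat F n :=
  Matrix.of fun i j => if i = j then (-1) ^ (n + 1) else if i < j then 2 * (-1) ^ (n + 1) else 0

lemma Gamma_eq (n : ℕ) : Gamma F n = (Gamma F n)ᵀ * gammaAsym F n := by
  ext i j
  have hi := i.2
  have hj := j.2
  rw [Matrix.mul_apply]
  have h0 : ∀ k : Fin n, (k : ℕ) + i + 1 ≠ n → (k : ℕ) + i ≠ n →
      (Gamma F n)ᵀ i k * gammaAsym F n k j = 0 := fun k h1 h2 => by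
    rw [Matrix.transpose_apply, Gamma, Matrix.of_apply, if_neg (by omega), zero_mul]
  by_cases hi0 : (i : ℕ) = 0
  · rw [Finset.sum_eq_single (⟨n - 1, by omega⟩ : Fin n)]
    · simp only [Gamma, gammaAsym, Matrix.transpose_apply, Matrix.of_apply, Fin.ext_iff, Fin.lt_def,
        hi0]
      rw [if_pos (c := n - 1 + 0 + 1 = n ∨ _) (by omega), if_neg (c := n - 1 < (j : ℕ)) (by omega),
        Nat.sub_self, Nat.sub_zero, show n + 1 = n - 1 + 2 by omega, pow_add]
      split_ifs
      all_goals first | omega | ring1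
    · exact fun k _ hk => h0 k (fun h => hk (Fin.ext (by simp only; omega))) (by have := k.2; omega)
    · simp
  · rw [Finset.sum_eq_add (⟨n - 1 - i, by omega⟩ : Fin n) (⟨n - i, by omega⟩ : Fin n)]
    · simp only [Gamma, gammaAsym, Matrix.transpose_apply, Matrix.of_apply, Fin.ext_iff, Fin.lt_def]
      rw [if_pos (c := n - 1 - (i : ℕ) + i + 1 = n ∨ _) (by omega),
        if_pos (c := n - (i : ℕ) + i + 1 = n ∨ _) (by omega),
        show n - 1 - (n - 1 - (i : ℕ)) = i - 1 + 1 by omega,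
        show n - 1 - (n - (i : ℕ)) = i - 1 by omega,
        show n + 1 = i - 1 + 1 + (n - 1 - i) + 2 by omega]
      have hx : (-1 : F) ^ ((i : ℕ) - 1) * (-1 : F) ^ ((i : ℕ) - 1) = 1 := by
        rw [← mul_pow]; simp
      simp only [pow_add, pow_one]
      generalize (-1 : F) ^ ((i : ℕ) - 1) = x at hx
      generalize (-1 : F) ^ (n - 1 - (i : ℕ)) = y
      split_ifs
      all_goals first | omega | ring1 | linear_combination (-y) * hx
    · exact fun h => by have := Fin.ext_iff.1 h; simp only at this; omega
    · exact fun k _ hk => h0 k (fun h => hk.1 (Fin.ext (by simp only; omega)))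
        (fun h => hk.2 (Fin.ext (by simp only; omega)))
    · simp
    · simp

lemma isCyc_Gamma (h2 : (2 : F) ≠ 0) {n : ℕ} (hn : 0 < n) :
    IsCyc (X - C ((-1 : F) ^ (n + 1))) n n (Gamma F n) := by
  refine ⟨isUnit_det_Gamma n, ?_, _, _, Pi.single ⟨n - 1, by omega⟩ 1,
    asym_of_eq (isUnit_det_Gamma n) (Gamma_eq n), ?_⟩
  · rw [natDegree_pow, natDegree_X_sub_C, mul_one]
  set lam : F := (-1) ^ (n + 1) with hlam
  have hlam0 : 2 * lam ≠ 0 := mul_ne_zero h2 (pow_ne_zero _ (by simp))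
  set N := aeval (Matrix.toLin' (gammaAsym F n)) (X - C lam) with hN
  have hN' : ∀ v i, N v i = ∑ j, if i < j then 2 * lam * v j else 0 := by
    intro v i
    have : N v i = ∑ j, gammaAsym F n i j * v j - lam * v i := by
      rw [hN, map_sub, aeval_X, aeval_C]
      rfl
    rw [this, show lam * v i = ∑ j, if j = i then lam * v j else 0 by simp,
      ← Finset.sum_sub_distrib]
    refine Finset.sum_congr rfl fun j _ => ?_
    rcases lt_trichotomy i j with hij | rfl | hij
    · simp [gammaAsym, hij, hij.ne, hij.ne', hlam]
    · simp [gammaAsym, hlam]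
    · simp [gammaAsym, hij.not_gt, hij.ne, hij.ne']
  have key : ∀ k, (∀ i : Fin n, n ≤ i + k → (N ^ k) (Pi.single ⟨n - 1, by omega⟩ 1) i = 0) ∧
      ∀ i : Fin n, i + k + 1 = n → (N ^ k) (Pi.single ⟨n - 1, by omega⟩ 1) i = (2 * lam) ^ k := by
    intro k
    induction k with
    | zero =>
      refine ⟨fun i hi => ?_, fun i hi => ?_⟩
      · have := i.2; omega
      · rw [show i = ⟨n - 1, by omega⟩ from Fin.ext (by simp; omega)]
        simp
    | succ k ih =>
      rw [pow_succ', Module.End.mul_apply]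
      generalize (N ^ k) (Pi.single ⟨n - 1, by omega⟩ 1) = x at ih
      refine ⟨fun i hi => ?_, fun i hi => ?_⟩
      · rw [hN']
        refine Finset.sum_eq_zero fun j _ => ?_
        split_ifs with hij
        · rw [ih.1 j (by have := Fin.lt_def.1 hij; omega), mul_zero]
        · rfl
      · rw [hN', Finset.sum_eq_single ⟨i + 1, by omega⟩]
        · rw [if_pos (Fin.lt_def.2 (by simp)), ih.2 _ (by simp; omega), pow_succ']
        · intro j _ hj
          split_ifs with hij
          · rw [ih.1 j ?_, mul_zero]
            have := Fin.lt_def.1 hij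
            have := Fin.val_ne_of_ne hj
            simp at this
            omega
          · rfl
        · simp
  have hpow : ∀ k, aeval (Matrix.toLin' (gammaAsym F n)) ((X - C lam) ^ k) = N ^ k := fun k =>
    map_pow _ _ _
  rw [hpow, hpow]
  refine ⟨funext fun i => (key n).1 i (by omega), fun h => ?_⟩
  have h1 := (key (n - 1)).2 ⟨0, hn⟩ (by simp; omega)
  rw [h] at h1
  exact pow_ne_zero _ hlam0 h1.symm

end Models

/-! ### Unipotent asymmetries -/

section Unipotent

variable {V : Type*} [AddCommGroup V] [Module F V]
  {B : BilinForm F V} {σ τ : Module.End F V}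

namespace Asym

/-- Modulo the next power of `X - C lam`, polynomials act through their value at `lam`. -/
lemma apply_eq_eval_mul {lam : F} {j : ℕ} {x y : V}
    (h : ∀ f : F[X], B (aeval σ (f * (X - C lam) ^ (j + 1)) x) y = 0) (f : F[X]) :
    B (aeval σ (f * (X - C lam) ^ j) x) y =
      f.eval lam * B (aeval σ ((X - C lam) ^ j) x) y := by
  obtain ⟨g, hg⟩ : X - C lam ∣ f - C (f.eval lam) := X_sub_C_dvd_sub_C_eval
  have h1 := h g
  rw [show g * (X - C lam) ^ (j + 1) = f * (X - C lam) ^ j - C (f.eval lam) * (X - C lam) ^ j by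
    rw [← sub_mul, hg]; ring, map_sub, LinearMap.sub_apply, map_sub, LinearMap.sub_apply,
    sub_eq_zero] at h1
  rw [h1, aeval_mul_apply, aeval_C, Module.algebraMap_end_apply, map_smul, LinearMap.smul_apply,
    smul_eq_mul]

variable (hB : Asym B σ τ) {lam : F} (hlam : lam * lam = 1) {l : ℕ}
include hB hlam

lemma exists_conj : ∃ T : F[X], (0 < l → T.eval lam = lam) ∧
    ∀ x y, aeval σ ((X - C lam) ^ l) x = 0 → ∀ s, ∀ f : F[X],
      B (aeval σ f x) (aeval σ ((X - C lam) ^ s) y) =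
      B (aeval σ ((-C lam * T) ^ s * (X - C lam) ^ s * f) x) y := by
  have hlam0 : lam ≠ 0 := fun h => by simp [h] at hlam
  obtain ⟨T, hT⟩ := exists_inverse_X (q := (X - C lam) ^ l) (by
    rw [eval_pow]
    exact pow_ne_zero _ (by simpa using hlam0))
  refine ⟨T, fun hl => ?_, fun x y hx s f => ?_⟩
  · have h1 := eval_dvd (x := lam) hT
    rw [eval_pow, eval_sub, eval_X, eval_C, sub_self, zero_pow hl.ne', zero_dvd_iff, eval_sub,
      eval_mul, eval_X, eval_one] at h1
    linear_combination lam * h1 - eval lam T * hlam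
  · have hfx : aeval σ ((X - C lam) ^ l) (aeval σ f x) = 0 := by
      rw [aeval_apply_comm, hx, map_zero]
    rw [hB.adj', hB.aeval_inv hT hfx, aeval_mul_apply _ f]
    congr 2
    refine aeval_eq_of_dvd_sub hfx ?_
    rw [pow_comp, sub_comp, X_comp, C_comp, ← mul_pow]
    refine dvd_trans ?_ (sub_dvd_pow_sub_pow _ _ s)
    refine hT.trans ⟨C lam, ?_⟩
    have : C lam * C lam = (1 : F[X]) := by rw [← C_mul, hlam, C_1]
    linear_combination -T * this

variable (hl : 0 < l)
include hl

lemma apply_pow_swap {j : ℕ} {x y : V} (hx : aeval σ ((X - C lam) ^ l) x = 0)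
    (h : ∀ f : F[X], B (aeval σ (f * (X - C lam) ^ (j + 1)) x) y = 0) :
    B (aeval σ ((X - C lam) ^ j) y) x = (-1) ^ j * lam * B (aeval σ ((X - C lam) ^ j) x) y := by
  obtain ⟨T, hT, hconj⟩ := hB.exists_conj hlam (l := l)
  have h1 := hconj x y hx j X
  rw [aeval_X, ← hB.swap] at h1
  rw [h1, mul_right_comm, apply_eq_eval_mul h, eval_mul, eval_pow, eval_mul, eval_neg, eval_C,
    hT hl, eval_X]
  congr 2
  rw [neg_mul, hlam]

variable (h2 : (2 : F) ≠ 0) (hlam' : lam = (-1) ^ l)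
include h2 hlam'

lemma exists_isotropic {u w : V} (hu : aeval σ ((X - C lam) ^ l) u = 0)
    (hw : aeval σ ((X - C lam) ^ l) w = 0) (huw : B (aeval σ ((X - C lam) ^ (l - 1)) u) w ≠ 0) :
    ∃ u, aeval σ ((X - C lam) ^ l) u = 0 ∧ B (aeval σ ((X - C lam) ^ (l - 1)) u) w ≠ 0 ∧
      ∀ f : F[X], B (aeval σ f u) u = 0 := by
  obtain ⟨T, hT, hconj⟩ := hB.exists_conj hlam (l := l)
  have hzero : ∀ {x : V} (y : V), aeval σ ((X - C lam) ^ l) x = 0 → ∀ {k : ℕ}, l ≤ k → ∀ f : F[X],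
      B (aeval σ (f * (X - C lam) ^ k) x) y = 0 := fun y hx k hk f => by
    rw [aeval_eq_zero_of_dvd hx ((pow_dvd_pow _ hk).mul_left f), map_zero, LinearMap.zero_apply]
  have key : ∀ i, i ≤ l → ∃ u, aeval σ ((X - C lam) ^ l) u = 0 ∧
      B (aeval σ ((X - C lam) ^ (l - 1)) u) w ≠ 0 ∧
      ∀ f : F[X], B (aeval σ (f * (X - C lam) ^ (l - i)) u) u = 0 := by
    intro i
    induction i with
    | zero => exact fun _ => ⟨u, hu, huw, hzero u hu le_rfl⟩
    | succ i ih =>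
      intro hi
      obtain ⟨u, hu, huw, hiso⟩ := ih (by omega)
      obtain ⟨j, hj⟩ : ∃ j, l - i = j + 1 := ⟨l - i - 1, by omega⟩
      rw [hj] at hiso
      rw [show l - (i + 1) = j by omega]
      rcases Nat.even_or_odd i with hie | hio
      · refine ⟨u, hu, huw, fun f => ?_⟩
        have h3 := hB.apply_pow_swap hlam hl hu hiso
        have h4 : (-1 : F) ^ j * lam = -1 := by
          rw [hlam', ← pow_add, Odd.neg_one_pow]
          rw [show j + l = i + (2 * j + 1) by omega]
          exact hie.add_odd ⟨j, rfl⟩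
        rw [h4] at h3
        have h5 : 2 * B (aeval σ ((X - C lam) ^ j) u) u = 0 := by linear_combination h3
        rw [apply_eq_eval_mul hiso, (mul_eq_zero.1 h5).resolve_left h2, mul_zero]
      · set β := B (aeval σ ((X - C lam) ^ (l - 1)) u) w with hβ
        have hβ' : B (aeval σ ((X - C lam) ^ (l - 1)) w) u = -β := by
          have h4 : (-1 : F) ^ (l - 1) * lam = -1 := by
            rw [hlam', ← pow_add, Odd.neg_one_pow ⟨l - 1, by omega⟩]
          rw [hB.apply_pow_swap hlam hl hu (hzero w hu (by omega)), h4, neg_one_mul]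
        set c := B (aeval σ ((X - C lam) ^ j) u) u / (2 * β) with hc
        have hipos := hio.pos
        have hsum : ∀ f : F[X], aeval σ f (u + c • aeval σ ((X - C lam) ^ i) w) =
            aeval σ f u + c • aeval σ (f * (X - C lam) ^ i) w := fun f => by
          rw [map_add, map_smul, aeval_mul_apply]
        refine ⟨u + c • aeval σ ((X - C lam) ^ i) w, ?_, ?_, fun f => ?_⟩
        · rw [hsum, hu, mul_comm, aeval_mul_apply, hw, map_zero, smul_zero, add_zero]
        · rw [hsum, ← pow_add, ← one_mul ((X - C lam) ^ (l - 1 + i)), map_add, map_smul,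
            LinearMap.add_apply, LinearMap.smul_apply, hzero w hw (by omega), smul_zero, add_zero]
          exact huw
        · have t1 := apply_eq_eval_mul hiso f
          have t2 : B (aeval σ (f * (X - C lam) ^ j * (X - C lam) ^ i) w) u = f.eval lam * -β := by
            rw [mul_assoc, ← pow_add, show j + i = l - 1 by omega,
              apply_eq_eval_mul (hzero u hw (by omega)), hβ']
          have t3 : B (aeval σ (f * (X - C lam) ^ j) u) (aeval σ ((X - C lam) ^ i) w) =
              f.eval lam * -β := by
            rw [hconj u w hu, show (-C lam * T) ^ i * (X - C lam) ^ i * (f * (X - C lam) ^ j) =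
              ((-C lam * T) ^ i * f) * (X - C lam) ^ (j + i) by ring, show j + i = l - 1 by omega,
              apply_eq_eval_mul (hzero w hu (by omega)), eval_mul, eval_pow, eval_mul, eval_neg,
              eval_C, hT hl, neg_mul, hlam, hio.neg_one_pow]
            ring
          have t4 : B (aeval σ (f * (X - C lam) ^ j * (X - C lam) ^ i) w)
              (aeval σ ((X - C lam) ^ i) w) = 0 := by
            rw [hconj w w hw, show (-C lam * T) ^ i * (X - C lam) ^ i *
              (f * (X - C lam) ^ j * (X - C lam) ^ i) =
              ((-C lam * T) ^ i * f) * (X - C lam) ^ (j + i + i) by ring]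
            exact hzero w hw (by omega) _
          rw [hsum]
          simp only [map_add, map_smul, LinearMap.add_apply, LinearMap.smul_apply, smul_eq_mul]
          rw [t1, t2, t3, t4, hc]
          field_simp
          ring
  obtain ⟨u, hu, huw, h⟩ := key l le_rfl
  refine ⟨u, hu, huw, fun f => ?_⟩
  have := h f
  rwa [Nat.sub_self, pow_zero, mul_one] at this

end Asym

end Unipotent

/-! ### Splitting a canonical block off a nondegenerate form -/

section Nondegenerate

variable {V : Type*} [AddCommGroup V] [Module F V]
  {B : BilinForm F V} {σ τ : Module.End F V}

lemma natDegree_reverse_of_eval {p : F[X]} (h0 : p.eval 0 ≠ 0) :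
    p.reverse.natDegree = p.natDegree := by
  rw [reverse_natDegree, natTrailingDegree_eq_zero.2 (Or.inr (by rwa [coeff_zero_eq_eval_zero])),
    Nat.sub_zero]

lemma natDegree_dualPoly {p : F[X]} (h0 : p.eval 0 ≠ 0) :
    (dualPoly (RingHom.id F) p).natDegree = p.natDegree := by
  rw [dualPoly, natDegree_C_mul (inv_ne_zero (by simpa [coeff_zero_eq_eval_zero] using h0)),
    Polynomial.map_id, natDegree_reverse_of_eval h0]

lemma monic_dualPoly {p : F[X]} (h0 : p.eval 0 ≠ 0) : (dualPoly (RingHom.id F) p).Monic := by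
  have h1 : p.coeff 0 ≠ 0 := by rwa [coeff_zero_eq_eval_zero]
  rw [dualPoly, Monic, leadingCoeff_mul, leadingCoeff_C, Polynomial.map_id, reverse_leadingCoeff,
    trailingCoeff, natTrailingDegree_eq_zero.2 (Or.inr h1), RingHom.id_apply, inv_mul_cancel₀ h1]

lemma dualPoly_eq_of_dvd_comp {p : F[X]} (hp : Irreducible p) (hm : p.Monic) (h0 : p.eval 0 ≠ 0)
    {T : F[X]} (hT : p ∣ X * T - 1) (h : p ∣ p.comp T) : dualPoly (RingHom.id F) p = p := by
  have := Fact.mk hp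
  have h1 : AdjoinRoot.root p * AdjoinRoot.mk p T = 1 := by
    have := AdjoinRoot.mk_eq_zero.2 hT
    rwa [map_sub, map_mul, AdjoinRoot.mk_X, map_one, sub_eq_zero] at this
  let : Invertible (AdjoinRoot.mk p T) := ⟨AdjoinRoot.root p, h1, by rw [mul_comm, h1]⟩
  have h2 := eval₂_reverse_mul_pow (AdjoinRoot.of p) (AdjoinRoot.mk p T) p
  have h3 : eval₂ (AdjoinRoot.of p) (AdjoinRoot.mk p T) p = AdjoinRoot.mk p (p.comp T) := by
    rw [Polynomial.comp, hom_eval₂]; rfl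
  rw [h3, AdjoinRoot.mk_eq_zero.2 h, mul_eq_zero] at h2
  have h4 : eval₂ (AdjoinRoot.of p) (AdjoinRoot.root p) p.reverse = 0 :=
    h2.resolve_right (pow_ne_zero _ fun h => by simp [h] at h1)
  have h5 : p ∣ p.reverse := by
    rwa [← AdjoinRoot.mk_eq_zero, ← AdjoinRoot.aeval_eq, aeval_def]
  refine eq_of_monic_of_dvd_of_natDegree_le hm (monic_dualPoly h0) ?_ (natDegree_dualPoly h0).le
  rw [dualPoly, Polynomial.map_id]
  exact h5.mul_left _

namespace Asym

variable (hB : Asym B σ τ)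
include hB

lemma apply_eq_zero_of_dualPoly_ne {p : F[X]} (hp : Irreducible p) (hm : p.Monic)
    (h0 : p.eval 0 ≠ 0) (hd : dualPoly (RingHom.id F) p ≠ p) {l : ℕ} (hl : 0 < l) {x y : V}
    (hx : aeval σ (p ^ l) x = 0) (hy : aeval σ (p ^ l) y = 0) : B x y = 0 := by
  obtain ⟨T, hT⟩ := exists_inverse_X (q := p ^ l) (by rw [eval_pow]; exact pow_ne_zero _ h0)
  obtain ⟨a, b, hab⟩ : IsCoprime ((p.comp T) ^ l) (p ^ l) := by
    refine IsCoprime.pow ((hp.coprime_iff_not_dvd.2 fun h => hd ?_).symm)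
    exact dualPoly_eq_of_dvd_comp hp hm h0 ((dvd_pow_self p hl.ne').trans hT) h
  have hax : aeval σ (p ^ l) (aeval σ a x) = 0 := by rw [aeval_apply_comm, hx, map_zero]
  have h1 : x = aeval τ (p ^ l) (aeval σ a x) := by
    rw [hB.aeval_inv hT hax, pow_comp, ← aeval_mul_apply, mul_comm]
    rw [eq_comm, aeval_eq_of_dvd_sub hx (g := 1) ⟨-b, by linear_combination hab⟩, map_one,
      Module.End.one_apply]
  rw [h1, ← hB.adj', hy, map_zero]

omit hB in
lemma aeval_eq_zero_of_asym (hB : Asym B σ τ) {f : F[X]} (h : aeval σ f = 0) : aeval τ f = 0 := by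
  ext v
  exact hB.nondeg_right _ fun u => by rw [← hB.adj, h, LinearMap.zero_apply, map_zero,
    LinearMap.zero_apply]

lemma exists_primary [FiniteDimensional F V] [Nontrivial V] :
    ∃ (p : F[X]) (l : ℕ) (u w : V), Irreducible p ∧ p.Monic ∧ p.eval 0 ≠ 0 ∧ 0 < l ∧
      aeval σ (p ^ l) u = 0 ∧ aeval τ (p ^ l) w = 0 ∧ B (aeval σ (p ^ (l - 1)) u) w ≠ 0 := by
  have hσi : IsIntegral F σ := Algebra.IsIntegral.isIntegral σ
  have hμ := minpoly.monic hσi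
  obtain ⟨p, hm, hp, hpμ⟩ := exists_monic_irreducible_factor _ (minpoly.not_isUnit F σ)
  have hfin : FiniteMultiplicity p (minpoly F σ) :=
    FiniteMultiplicity.of_not_isUnit hp.not_isUnit hμ.ne_zero
  obtain ⟨b, hb, hpb⟩ := hfin.exists_eq_pow_mul_and_not_dvd
  set l := multiplicity p (minpoly F σ) with hl
  have hl0 : 0 < l := by
    rcases Nat.eq_zero_or_pos l with h | h
    · rw [h, pow_zero, one_mul] at hb
      exact absurd (hb ▸ hpμ) hpb
    · exact h
  have hlt : ∀ f : F[X], f ≠ 0 → f.natDegree < (minpoly F σ).natDegree → aeval σ f ≠ 0 :=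
    fun f hf hd h => absurd (natDegree_le_of_dvd (minpoly.dvd F σ h) hf) (by omega)
  have hb0 : b ≠ 0 := fun h => hpb (h ▸ dvd_zero p)
  have h0 : p.eval 0 ≠ 0 := by
    intro h
    obtain ⟨g, hg⟩ : X ∣ minpoly F σ := by
      refine dvd_trans ?_ hpμ
      have := dvd_iff_isRoot.2 h
      simpa using this
    have hg0 : g ≠ 0 := by rintro rfl; exact hμ.ne_zero (by rw [hg, mul_zero])
    refine hlt g hg0 (by rw [hg, natDegree_X_mul hg0]; omega) (LinearMap.ext fun v => ?_)
    have := LinearMap.congr_fun (minpoly.aeval F σ) v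
    rw [hg, aeval_mul_apply, aeval_X, LinearMap.zero_apply] at this
    rw [← hB.left_inv (aeval σ g v), this, map_zero, LinearMap.zero_apply]
  obtain ⟨v, hv⟩ : ∃ v, aeval σ (p ^ (l - 1) * b) v ≠ 0 := by
    by_contra! h
    refine hlt _ (mul_ne_zero (pow_ne_zero _ hp.ne_zero) hb0) ?_ (LinearMap.ext h)
    rw [hb, natDegree_mul (pow_ne_zero _ hp.ne_zero) hb0,
      natDegree_mul (pow_ne_zero _ hp.ne_zero) hb0, natDegree_pow, natDegree_pow]
    have := hp.natDegree_pos
    have : (l - 1) * p.natDegree < l * p.natDegree := Nat.mul_lt_mul_of_pos_right (by omega) this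
    omega
  have hu : aeval σ (p ^ l) (aeval σ b v) = 0 := by
    rw [← aeval_mul_apply, ← hb, minpoly.aeval, LinearMap.zero_apply]
  rw [aeval_mul_apply] at hv
  obtain ⟨y, hy⟩ : ∃ y, B (aeval σ (p ^ (l - 1)) (aeval σ b v)) y ≠ 0 := by
    by_contra! h
    exact hv (hB.nondeg _ h)
  obtain ⟨a, c, hac⟩ : IsCoprime (p ^ l) b := (hp.coprime_iff_not_dvd.2 hpb).pow_left
  refine ⟨p, l, aeval σ b v, aeval τ (c * b) y, hp, hm, h0, hl0, hu, ?_, ?_⟩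
  · rw [← aeval_mul_apply, show p ^ l * (c * b) = c * (p ^ l * b) by ring, ← hb, map_mul,
      hB.aeval_eq_zero_of_asym (minpoly.aeval F σ), mul_zero, LinearMap.zero_apply]
  · rw [← hB.adj, ← aeval_mul_apply, aeval_eq_of_dvd_sub hu (g := p ^ (l - 1))
      ⟨-a * p ^ (l - 1), by linear_combination p ^ (l - 1) * hac⟩]
    exact hy

lemma exists_split_of_dualPoly_ne {p : F[X]} (hp : Irreducible p) (hm : p.Monic)
    (h0 : p.eval 0 ≠ 0) (hd : dualPoly (RingHom.id F) p ≠ p) {l : ℕ} (hl : 0 < l) {u w : V}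
    (hu : aeval σ (p ^ l) u = 0) (hw : aeval τ (p ^ l) w = 0)
    (huw : B (aeval σ (p ^ (l - 1)) u) w ≠ 0) :
    ∃ T : Submodule F V, Isom (prodForm (bf (skewIBlock (p ^ l))) (B.domRestrict₁₂ T T)) B := by
  refine hB.exists_split_skew hp hm h0 hu hw huw (fun f g => ?_) (fun f g => ?_)
  · refine hB.apply_eq_zero_of_dualPoly_ne hp hm h0 hd hl ?_ ?_ <;>
    rw [aeval_apply_comm, hu, map_zero]
  · refine hB.symm_asym.apply_eq_zero_of_dualPoly_ne hp hm h0 hd hl (x := aeval τ g w)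
      (y := aeval τ f w) ?_ ?_ <;>
    rw [aeval_apply_comm, hw, map_zero]

variable {p : F[X]} {l : ℕ} {bar : AdjoinRoot (p ^ l) →ₐ[F] AdjoinRoot (p ^ l)}
  (hbar : AdjoinRoot.root (p ^ l) * bar (AdjoinRoot.root (p ^ l)) = 1)
include hbar

lemma aeval_inv_eq_zero {w : V} (hw : aeval σ (p ^ l) w = 0) : aeval τ (p ^ l) w = 0 := by
  rw [hB.bar_apply hbar hw (h := 0) (by simp), map_zero, LinearMap.zero_apply]

/-- For a self-dual `p` of degree at least two, some cyclic vector is not self-orthogonal. -/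
lemma exists_apply_self_ne (hp : Irreducible p) (hl : 0 < l) (hdeg : 2 ≤ p.natDegree) {u w : V}
    (hu : aeval σ (p ^ l) u = 0) (hw : aeval σ (p ^ l) w = 0)
    (huw : B (aeval σ (p ^ (l - 1)) u) w ≠ 0) :
    ∃ u r, aeval σ (p ^ l) u = 0 ∧ B (aeval σ (r * p ^ (l - 1)) u) u ≠ 0 := by
  by_contra! H
  obtain ⟨h₁, hh₁⟩ := AdjoinRoot.mk_surjective (bar (AdjoinRoot.mk (p ^ l) (p ^ (l - 1))))
  obtain ⟨h₂, hh₂⟩ := AdjoinRoot.mk_surjective (bar (AdjoinRoot.mk (p ^ l) (X * p ^ (l - 1))))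
  have hker : ∀ f : F[X], ∀ {v : V}, aeval σ (p ^ l) v = 0 → aeval σ (p ^ l) (aeval σ f v) = 0 :=
    fun f v hv => by rw [aeval_apply_comm, hv, map_zero]
  have pol : ∀ r : F[X], ∀ x y : V, aeval σ (p ^ l) x = 0 → aeval σ (p ^ l) y = 0 →
      B (aeval σ (r * p ^ (l - 1)) x) y = -B (aeval σ (r * p ^ (l - 1)) y) x := by
    intro r x y hx hy
    have h1 := H (x + y) r (by rw [map_add, hx, hy, add_zero])
    simp only [map_add, LinearMap.add_apply, H x r hx, H y r hy] at h1
    linear_combination h1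
  have e1 : ∀ g : F[X], B (aeval σ (g * p ^ (l - 1)) u) w = -B (aeval σ (h₁ * (X * g)) u) w := by
    intro g
    have := pol 1 (aeval σ g u) w (hker g hu) hw
    rw [one_mul, ← aeval_mul_apply, mul_comm, hB.swap _ (aeval σ g u),
      show σ (aeval σ g u) = aeval σ (X * g) u by rw [aeval_mul_apply, aeval_X]] at this
    rw [this, hB.apply_aeval_aeval hbar hu hh₁]
  have e2 : ∀ g : F[X], B (aeval σ (X * g * p ^ (l - 1)) u) w = -B (aeval σ (h₁ * g) u) w := by
    intro g
    have := pol X (aeval σ g u) w (hker g hu) hw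
    rw [← aeval_mul_apply, show X * p ^ (l - 1) * g = X * g * p ^ (l - 1) by ring,
      hB.swap _ (aeval σ g u),
      show σ (aeval σ g u) = aeval σ (X * g) u by rw [aeval_mul_apply, aeval_X]] at this
    rw [this, hB.apply_aeval_aeval hbar hu hh₂]
    congr 3
    refine aeval_eq_of_dvd_sub hu (AdjoinRoot.mk_eq_mk.1 ?_)
    simp only [map_mul, hh₁, hh₂, AdjoinRoot.mk_X]
    linear_combination AdjoinRoot.mk (p ^ l) g * bar (AdjoinRoot.mk (p ^ l) (p ^ (l - 1))) * hbar
  have h3 : p ^ l ∣ (X ^ 2 - 1) * p ^ (l - 1) := by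
    refine dvd_of_func hp hu (r := 1) (w := w) (by rwa [one_mul]) fun g => ?_
    have t1 := e2 (X * g)
    have t2 := e1 g
    rw [show g * ((X ^ 2 - 1) * p ^ (l - 1)) = X * (X * g) * p ^ (l - 1) - g * p ^ (l - 1) by ring,
      map_sub, LinearMap.sub_apply, map_sub, LinearMap.sub_apply, t1, t2, sub_self]
  have h4 : p ∣ (X - C 1) * (X - C (-1)) := by
    have : p * p ^ (l - 1) ∣ (X ^ 2 - 1) * p ^ (l - 1) := by
      rwa [← pow_succ', Nat.sub_add_cancel hl]
    have := (mul_dvd_mul_iff_right (pow_ne_zero _ hp.ne_zero)).1 this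
    rwa [show (X ^ 2 - 1 : F[X]) = (X - C 1) * (X - C (-1)) by simp; ring] at this
  rcases hp.prime.dvd_or_dvd h4 with h | h <;>
  · have := natDegree_le_of_dvd h (X_sub_C_ne_zero _)
    rw [natDegree_X_sub_C] at this
    omega

end Asym

lemma eq_X_sub_C_of_natDegree_le {p : F[X]} (hp : Irreducible p) (hm : p.Monic)
    (hdeg : ¬ 2 ≤ p.natDegree) : ∃ lam, p = X - C lam := by
  have h := hp.natDegree_pos
  refine ⟨-p.coeff 0, ?_⟩
  conv_lhs => rw [eq_X_add_C_of_natDegree_le_one (p := p) (by omega)]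
  have : p.coeff 1 = 1 := by
    have := hm.coeff_natDegree
    rwa [show p.natDegree = 1 by omega] at this
  rw [this, C_1, one_mul, C_neg, sub_neg_eq_add]

lemma mul_self_of_dualPoly {lam : F} (h0 : lam ≠ 0)
    (hd : dualPoly (RingHom.id F) (X - C lam) = X - C lam) : lam * lam = 1 := by
  have h := congrArg (fun q => coeff q 0) hd
  simp only [dualPoly, Polynomial.map_id, RingHom.id_apply, coeff_C_mul, coeff_zero_reverse,
    leadingCoeff_X_sub_C, coeff_sub, coeff_X_zero, coeff_C_zero, zero_sub, mul_one] at h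
  field_simp at h
  linear_combination h

/-- `sqrtT` assigns to every self-dual Frobenius block of type (iii) a matrix `M` with
`M = Mᵀ * Φ`. -/
def IsCosquareRoot (sqrtT : (q : F[X]) → Mat F q.natDegree) : Prop :=
  ∀ (p : F[X]) (l : ℕ), p.Monic → Irreducible p → 0 < l →
    (p ^ l).eval 0 ≠ 0 → dualPoly (RingHom.id F) p = p → 2 ≤ p.natDegree →
    IsUnit (sqrtT (p ^ l)).det ∧ sqrtT (p ^ l) = (sqrtT (p ^ l))ᵀ * companion F (p ^ l)

variable [FiniteDimensional F V] [Nontrivial V]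

lemma exists_split_of_asym [Fintype F] (h2 : (2 : F) ≠ 0) {ζ : F} (hζ : ¬ IsSquare ζ)
    {sqrtT : (q : F[X]) → Mat F q.natDegree}
    (hsqrtT : IsCosquareRoot sqrtT)
    (hB : Asym B σ τ) :
    ∃ b : Block F, (T0ii b ∨ T0iii sqrtT b ∨ T0iv ζ b) ∧
      ∃ T : Submodule F V, Isom (prodForm (bf b) (B.domRestrict₁₂ T T)) B := by
  obtain ⟨p, l, u, w, hp, hm, h0, hl, hu, hw, huw⟩ := hB.exists_primary
  have h0' : (p ^ l).eval 0 ≠ 0 := by rw [eval_pow]; exact pow_ne_zero _ h0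
  by_cases hd : dualPoly (RingHom.id F) p = p
  swap
  · exact ⟨_, Or.inl ⟨p, l, hm, hp, hl, h0', Or.inl hd, rfl⟩,
      hB.exists_split_of_dualPoly_ne hp hm h0 hd hl hu hw huw⟩
  obtain ⟨bar, hbar⟩ := exists_bar h0' (by rw [dualPoly_pow, hd])
  replace hw : aeval σ (p ^ l) w = 0 := hB.symm_asym.aeval_inv_eq_zero hbar hw
  by_cases hdeg : 2 ≤ p.natDegree
  · obtain ⟨u, r, hu, hr⟩ := hB.exists_apply_self_ne hbar hp hl hdeg hu hw huw
    obtain ⟨hM, hM'⟩ := hsqrtT p l hm hp hl h0' hd hdeg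
    exact ⟨_, Or.inr (Or.inl ⟨p, l, hm, hp, hl, h0', hd, hdeg, rfl⟩),
      hB.exists_split_of_two_le h2 hp hm hl h0 hd (isCyc_of_companion hp hm hl hM hM') hu hr hdeg⟩
  obtain ⟨lam, rfl⟩ := eq_X_sub_C_of_natDegree_le hp hm hdeg
  have hlam : lam * lam = 1 := mul_self_of_dualPoly (by simpa using h0) hd
  have hzero : ∀ {x : V} (y : V), aeval σ ((X - C lam) ^ l) x = 0 → ∀ f : F[X],
      B (aeval σ (f * (X - C lam) ^ (l - 1 + 1)) x) y = 0 := fun y hx f => by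
    rw [Nat.sub_add_cancel hl, aeval_mul_apply, hx, map_zero, map_zero, LinearMap.zero_apply]
  have hswap := fun {x y : V} (hx : aeval σ ((X - C lam) ^ l) x = 0) =>
    hB.apply_pow_swap hlam hl (y := y) hx (hzero y hx)
  by_cases hlam' : lam = (-1) ^ l
  · have h3 : (-1 : F) ^ (l - 1) * lam = -1 := by
      rw [hlam', ← pow_add, Odd.neg_one_pow ⟨l - 1, by omega⟩]
    obtain ⟨u', hu', huw', hiso⟩ := hB.exists_isotropic hlam hl h2 hlam' hu hw huw
    obtain ⟨w', hw', huw'', hiso'⟩ := hB.exists_isotropic hlam hl h2 hlam' hw hu'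
      (by rw [hswap hu', h3]; simpa using huw')
    have h4 : B (aeval σ ((X - C lam) ^ (l - 1)) u') w' ≠ 0 := by
      rw [hswap hw', h3]; simpa using huw''
    have h5 : ∀ {x : V}, aeval σ ((X - C lam) ^ l) x = 0 → (∀ f : F[X], B (aeval σ f x) x = 0) →
        ∀ f g : F[X], B (aeval σ f x) (aeval σ g x) = 0 := fun {x} hx h f g => by
      obtain ⟨k, hk⟩ := AdjoinRoot.mk_surjective (bar (AdjoinRoot.mk _ g))
      rw [hB.apply_aeval_aeval hbar hx hk, h]
    refine ⟨_, Or.inl ⟨X - C lam, l, hm, hp, hl, h0', Or.inr ?_, rfl⟩,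
      hB.exists_split_skew hp hm h0 hu' (hB.aeval_inv_eq_zero hbar hw') h4 (h5 hu' hiso)
        fun f g => ?_⟩
    · rw [natDegree_pow, natDegree_X_sub_C, mul_one, hlam', pow_succ, mul_neg_one, C_neg,
        sub_eq_add_neg]
    · obtain ⟨f', hf'⟩ := AdjoinRoot.mk_surjective (bar (AdjoinRoot.mk _ f))
      obtain ⟨g', hg'⟩ := AdjoinRoot.mk_surjective (bar (AdjoinRoot.mk _ g))
      rw [hB.bar_apply hbar hw' hf', hB.bar_apply hbar hw' hg', h5 hw' hiso']
  · replace hlam' : lam = (-1) ^ (l + 1) := by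
      rcases mul_self_eq_one_iff.1 hlam with h | h <;> rcases Nat.even_or_odd l with e | e
      · exact absurd (h.trans e.neg_one_pow.symm) hlam'
      · rw [h, e.add_one.neg_one_pow]
      · rw [h, e.add_one.neg_one_pow]
      · exact absurd (h.trans e.neg_one_pow.symm) hlam'
    have h3 : (-1 : F) ^ (l - 1) * lam = 1 := by
      rw [hlam', ← pow_add, Even.neg_one_pow ⟨l, by omega⟩]
    obtain ⟨x, hx, hxx⟩ : ∃ x, aeval σ ((X - C lam) ^ l) x = 0 ∧
        B (aeval σ (1 * (X - C lam) ^ (l - 1)) x) x ≠ 0 := by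
      simp only [one_mul]
      by_contra! H
      have h4 := H (u + w) (by rw [map_add, hu, hw, add_zero])
      have h5 := hswap (y := w) hu
      rw [h3, one_mul] at h5
      simp only [map_add, LinearMap.add_apply, H u hu, H w hw, h5] at h4
      refine huw ((mul_eq_zero.1 (?_ : (2 : F) * _ = 0)).resolve_left h2)
      linear_combination h4
    have hG := isCyc_Gamma (F := F) h2 hl
    rw [← hlam'] at hG
    rcases hB.exists_split_of_X_sub_C h2 hp hm hl h0 hd hG hx hxx hζ rfl with h | h
    · exact ⟨_, Or.inr (Or.inr ⟨l, hl, Or.inl rfl⟩), h⟩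
    · exact ⟨_, Or.inr (Or.inr ⟨l, hl, Or.inr rfl⟩), h⟩

end Nondegenerate

/-! ### Existence of the canonical form -/

section Existence

lemma exists_sq_add_sq [Fintype F] (h2 : (2 : F) ≠ 0) (x : F) : ∃ a b : F, a * a + b * b = x := by
  have hodd : Fintype.card F % 2 = 1 :=
    FiniteField.odd_card_of_char_ne_two fun h => h2 (by
      have := CharP.cast_eq_zero F (ringChar F)
      rw [h] at this
      exact_mod_cast this)
  obtain ⟨a, b, hab⟩ := FiniteField.exists_root_sum_quadratic (degree_X_pow 2)
    (degree_X_pow_sub_C (by decide : 0 < 2) x) hodd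
  refine ⟨a, b, ?_⟩
  simp only [eval_C, eval_X, eval_pow, eval_sub] at hab
  linear_combination hab

lemma isom_smul_prod_smul [Fintype F] (h2 : (2 : F) ≠ 0) {c : F} (hc : c ≠ 0) {n : ℕ}
    (M : Mat F n) : Isom (prodForm (bf ⟨n, c • M⟩) (bf ⟨n, c • M⟩))
      (prodForm (bf ⟨n, M⟩) (bf ⟨n, M⟩)) := by
  obtain ⟨a, b, hab⟩ := exists_sq_add_sq h2 c
  let S := LinearMap.fst F (Fin n → F) (Fin n → F)
  let T := LinearMap.snd F (Fin n → F) (Fin n → F)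
  refine ⟨LinearEquiv.ofLinearMap ((a • S - b • T).prod (b • S + a • T))
    ((c⁻¹ • (a • S + b • T)).prod (c⁻¹ • (a • T - b • S))) ?_ ?_, fun u v => ?_⟩
  · refine LinearMap.ext fun x => Prod.ext (funext fun i => ?_) (funext fun i => ?_)
    · simp [S, T]; field_simp; linear_combination x.1 i * hab
    · simp [S, T]; field_simp; linear_combination x.2 i * hab
  · refine LinearMap.ext fun x => Prod.ext (funext fun i => ?_) (funext fun i => ?_)
    · simp [S, T]; field_simp; linear_combination x.1 i * hab
    · simp [S, T]; field_simp; linear_combination x.2 i * hab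
  · rw [prodForm_apply, prodForm_apply]
    refine Eq.trans ?_ (congrArg₂ (· + ·) (bf_smul c M u.1 v.1) (bf_smul c M u.2 v.2)).symm
    simp [S, T]
    linear_combination (bf ⟨n, M⟩ u.1 v.1 + bf ⟨n, M⟩ u.2 v.2) * hab

variable {ζ : F} {sqrtT : (q : F[X]) → Mat F q.natDegree}

/-- The summands allowed in the canonical form. -/
def IsSummand (ζ : F) (sqrtT : (q : F[X]) → Mat F q.natDegree) (b : Block F) : Prop :=
  T0i b ∨ T0ii b ∨ T0iii sqrtT b ∨ T0iv ζ b

lemma IsSummand.pos {b : Block F} (h : IsSummand ζ sqrtT b) : 0 < b.1 := by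
  rcases h with ⟨n, hn, rfl⟩ | ⟨p, l, hm, hp, hl, -, -, rfl⟩ | ⟨p, l, hm, hp, hl, -, -, -, rfl⟩ |
    ⟨n, hn, rfl | rfl⟩
  · exact hn
  · have : 0 < (p ^ l).natDegree := by
      rw [natDegree_pow]; exact Nat.mul_pos hl hp.natDegree_pos
    exact Nat.add_pos_left this _
  · show 0 < (p ^ l).natDegree
    rw [natDegree_pow]; exact Nat.mul_pos hl hp.natDegree_pos
  · exact hn
  · exact hn

lemma Gamma_ne_smul (hζ : ¬ IsSquare ζ) {m n : ℕ} (hn : 0 < n) :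
    (⟨n, Gamma F n⟩ : Block F) ≠ ⟨m, ζ • Gamma F m⟩ := by
  intro h
  obtain ⟨rfl, h⟩ := Sigma.mk.inj_iff.1 h
  have h1 := congrFun (congrFun (eq_of_heq h) ⟨n - 1, by omega⟩) ⟨0, hn⟩
  simp [Gamma, Nat.sub_add_cancel hn] at h1
  exact hζ (h1 ▸ ⟨1, by simp⟩)

lemma Canon0.cons {b : Block F} {L : List (Block F)} (hL : Canon0 ζ sqrtT L)
    (hb : IsSummand ζ sqrtT b) (h : ∀ n, b = ⟨n, ζ • Gamma F n⟩ → b ∉ L) :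
    Canon0 ζ sqrtT (b :: L) := by
  refine ⟨?_, fun n => ?_⟩
  · rintro c (_ | ⟨_, hc⟩)
    exacts [hb, hL.1 c hc]
  · rintro ⟨b₁, b₂, hs, h₁, h₂⟩
    cases hs with
    | cons _ hs => exact hL.2 n ⟨b₁, b₂, hs, h₁, h₂⟩
    | cons_cons _ hs =>
      refine h n h₁ ?_
      rw [h₁, ← h₂]
      exact List.singleton_sublist.1 hs

lemma Canon0.sublist {L L' : List (Block F)} (hL : Canon0 ζ sqrtT L) (h : L'.Sublist L) :
    Canon0 ζ sqrtT L' :=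
  ⟨fun c hc => hL.1 c (h.subset hc), fun n ⟨b₁, b₂, hs, h₁, h₂⟩ =>
    hL.2 n ⟨b₁, b₂, hs.trans h, h₁, h₂⟩⟩

lemma Canon0.perm {L L' : List (Block F)} (hL : Canon0 ζ sqrtT L) (h : L.Perm L') :
    Canon0 ζ sqrtT L' := by
  refine ⟨fun c hc => hL.1 c (h.mem_iff.2 hc), fun n ⟨b₁, b₂, hs, h₁, h₂⟩ => hL.2 n ?_⟩
  obtain ⟨l, hl, hl'⟩ := List.exists_perm_sublist hs h.symm
  dsimp only at h₁ h₂
  subst h₁ h₂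
  rw [show [(⟨n, ζ • Gamma F n⟩ : Block F), ⟨n, ζ • Gamma F n⟩] = List.replicate 2 _ from rfl,
    List.perm_replicate] at hl
  exact ⟨_, _, (hl ▸ hl' : (List.replicate 2 _).Sublist L), rfl, rfl⟩

lemma exists_canon_cons [Fintype F] (h2 : (2 : F) ≠ 0) (hζ : ¬ IsSquare ζ)
    {b : Block F} {L : List (Block F)} (hL : Canon0 ζ sqrtT L) (hb : IsSummand ζ sqrtT b) :
    ∃ L', Canon0 ζ sqrtT L' ∧ Isom (bf (bsum L')) (bf (bsum (b :: L))) := by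
  classical
  by_cases h : ∀ n, b = ⟨n, ζ • Gamma F n⟩ → b ∉ L
  · exact ⟨_, hL.cons hb h, Isom.refl _⟩
  push Not at h
  obtain ⟨n, rfl, hmem⟩ := h
  have hn : 0 < n := hb.pos
  have hperm := List.perm_cons_erase hmem
  set L₀ := L.erase ⟨n, ζ • Gamma F n⟩
  have hG : IsSummand ζ sqrtT ⟨n, Gamma F n⟩ := Or.inr (Or.inr (Or.inr ⟨n, hn, Or.inl rfl⟩))
  have hne : ∀ m, (⟨n, Gamma F n⟩ : Block F) ≠ ⟨m, ζ • Gamma F m⟩ := fun m => Gamma_ne_smul hζ hn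
  refine ⟨⟨n, Gamma F n⟩ :: ⟨n, Gamma F n⟩ :: L₀,
    ((hL.sublist List.erase_sublist).cons hG fun m hm => absurd hm (hne m)).cons hG
      fun m hm => absurd hm (hne m), ?_⟩
  have h1 : ∀ c : Block F, Isom (prodForm (prodForm (bf c) (bf c)) (bf (bsum L₀)))
      (bf (bsum (c :: c :: L₀))) := fun c =>
    (isom_prod_assoc _ _ _).trans (((Isom.refl _).prod (isom_bsum_cons _ _)).trans
      (isom_bsum_cons _ _))
  refine (h1 _).symm.trans (((isom_smul_prod_smul h2 (c := ζ) ?_ _).symm.prod (Isom.refl _)).trans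
    ((h1 _).trans (isom_bsum_perm (hperm.symm.cons _))))
  rintro rfl
  exact hζ ⟨0, by simp⟩

lemma exists_split_block [Fintype F] (h2 : (2 : F) ≠ 0) (hζ : ¬ IsSquare ζ)
    (hsqrtT : IsCosquareRoot sqrtT) {V : Type*} [AddCommGroup V] [Module F V]
    [FiniteDimensional F V] [Nontrivial V] (B : BilinForm F V) :
    ∃ b, IsSummand ζ sqrtT b ∧
      ∃ T : Submodule F V, Isom (prodForm (bf b) (B.domRestrict₁₂ T T)) B := by
  by_cases h : ∃ x ≠ 0, ∀ v, B x v = 0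
  · obtain ⟨n, f, hf⟩ := exists_jChain B h
    exact ⟨_, Or.inl ⟨n, hf.pos, rfl⟩, hf.exists_split⟩
  · push Not at h
    obtain ⟨σ, τ, hB⟩ := exists_asym B fun u hu => by
      by_contra hu'
      obtain ⟨v, hv⟩ := h u hu'
      exact hv (hu v)
    obtain ⟨b, hb, T, hT⟩ := exists_split_of_asym h2 hζ hsqrtT hB
    exact ⟨b, Or.inr hb, T, hT⟩

lemma exists_canon_aux [Fintype F] (h2 : (2 : F) ≠ 0) (hζ : ¬ IsSquare ζ)
    (hsqrtT : IsCosquareRoot sqrtT) (N : ℕ) : ∀ (V : Type*) [AddCommGroup V] [Module F V]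
    [FiniteDimensional F V] (B : BilinForm F V), Module.finrank F V ≤ N →
    ∃ L, Canon0 ζ sqrtT L ∧ Isom (bf (bsum L)) B := by
  induction N with
  | zero =>
    intro V _ _ _ B hN
    have hV : Subsingleton V := Module.finrank_zero_iff.1 (Nat.le_zero.1 hN)
    refine ⟨[], ⟨by simp, fun n ⟨b₁, b₂, hs, _⟩ => by simp at hs⟩, ?_⟩
    have : Subsingleton (Fin (bsum ([] : List (Block F))).1 → F) :=
      inferInstanceAs (Subsingleton (Fin 0 → F))
    exact ⟨0, fun u v => by rw [Subsingleton.elim u 0]; simp⟩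
  | succ N ih =>
    intro V _ _ _ B hN
    rcases subsingleton_or_nontrivial V with hV | hV
    · exact ih V B (by rw [Module.finrank_zero_of_subsingleton]; exact Nat.zero_le _)
    obtain ⟨b, hb, T, hT⟩ := exists_split_block h2 hζ hsqrtT B
    have hfin : Module.finrank F T ≤ N := by
      obtain ⟨e, -⟩ := hT
      have h1 := e.finrank_eq
      rw [Module.finrank_prod, Module.finrank_fin_fun] at h1
      have := hb.pos
      omega
    obtain ⟨L, hL, hiso⟩ := ih T (B.domRestrict₁₂ T T) hfin
    obtain ⟨L', hL', hiso'⟩ := exists_canon_cons h2 hζ hL hb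
    exact ⟨L', hL', hiso'.trans ((isom_bsum_cons _ _).symm.trans
      (((Isom.refl _).prod hiso).trans hT))⟩

lemma exists_canon [Fintype F] (h2 : (2 : F) ≠ 0) (hζ : ¬ IsSquare ζ)
    (hsqrtT : IsCosquareRoot sqrtT) (X : Block F) :
    ∃ L, Canon0 ζ sqrtT L ∧ BCong X (bsum L) := by
  obtain ⟨L, hL, h⟩ := exists_canon_aux h2 hζ hsqrtT _ _ (bf X) le_rfl
  exact ⟨L, hL, (bcong_iff_isom _ _).2 h.symm⟩

end Existence

/-! ### Uniqueness of the singular part -/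

section Reduction

variable {V W V' W' : Type*} [AddCommGroup V] [Module F V] [AddCommGroup W] [Module F W]
  [AddCommGroup V'] [Module F V'] [AddCommGroup W'] [Module F W']

/-- `C` is the form induced by `B` on the left orthogonal of the left radical of `B`,
modulo that radical. -/
def IsRed (B : BilinForm F V) (C : BilinForm F W) : Prop :=
  ∃ s : W →ₗ[F] V, (∀ x y, B (s x) (s y) = C x y) ∧ (∀ x, (∀ y, B (s x) y = 0) → x = 0) ∧
    ∀ v, (∀ r, (∀ y, B r y = 0) → B v r = 0) ↔ ∃ x, ∀ y, B v y = B (s x) y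

lemma IsRed.congr {B : BilinForm F V} {B' : BilinForm F V'} {C : BilinForm F W}
    {C' : BilinForm F W'} (h : IsRed B C) (hB : Isom B B') (hC : Isom C C') : IsRed B' C' := by
  obtain ⟨s, h1, h2, h3⟩ := h
  obtain ⟨e, he⟩ := hB
  obtain ⟨f, hf⟩ := hC
  have he' : ∀ u v, B' (e u) v = B u (e.symm v) := fun u v => by
    rw [← he, e.apply_symm_apply]
  have he'' : ∀ u v, B' u v = B (e.symm u) (e.symm v) := fun u v => by
    rw [← he, e.apply_symm_apply, e.apply_symm_apply]
  refine ⟨e.toLinearMap ∘ₗ s ∘ₗ f.symm.toLinearMap, fun x y => ?_, fun x hx => ?_, fun v => ?_⟩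
  · simp [he, h1, ← hf]
  · refine f.symm.map_eq_zero_iff.1 (h2 _ fun y => ?_)
    rw [← he]
    exact hx (e y)
  · have := h3 (e.symm v)
    constructor
    · intro h
      obtain ⟨x, hx⟩ := this.1 fun r hr => by
        rw [← he, e.apply_symm_apply]
        exact h _ fun y => by rw [he', hr]
      exact ⟨f x, fun y => by simp [he'', hx]⟩
    · rintro ⟨x, hx⟩ r hr
      rw [he'']
      refine this.2 ⟨f.symm x, fun y => ?_⟩ _ fun y => ?_
      · rw [← he, e.apply_symm_apply, hx]
        simp [he]
      · rw [← he, e.apply_symm_apply, hr]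

lemma IsRed.isom {B : BilinForm F V} {C : BilinForm F W} {C' : BilinForm F W'}
    (h : IsRed B C) (h' : IsRed B C') : Isom C C' := by
  obtain ⟨s, h1, h2, h3⟩ := h
  obtain ⟨s', h1', h2', h3'⟩ := h'
  have hinj : Function.Injective (B ∘ₗ s) := by
    rw [← LinearMap.ker_eq_bot, LinearMap.ker_eq_bot']
    exact fun x hx => h2 x fun y => LinearMap.congr_fun hx y
  have hinj' : Function.Injective (B ∘ₗ s') := by
    rw [← LinearMap.ker_eq_bot, LinearMap.ker_eq_bot']
    exact fun x hx => h2' x fun y => LinearMap.congr_fun hx y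
  have hrange : LinearMap.range (B ∘ₗ s) = LinearMap.range (B ∘ₗ s') := by
    refine le_antisymm ?_ ?_
    · rintro _ ⟨x, rfl⟩
      obtain ⟨x', hx'⟩ := (h3' (s x)).1 ((h3 _).2 ⟨x, fun _ => rfl⟩)
      exact ⟨x', LinearMap.ext fun y => (hx' y).symm⟩
    · rintro _ ⟨x, rfl⟩
      obtain ⟨x', hx'⟩ := (h3 (s' x)).1 ((h3' _).2 ⟨x, fun _ => rfl⟩)
      exact ⟨x', LinearMap.ext fun y => (hx' y).symm⟩
  let e : W ≃ₗ[F] W' := (LinearEquiv.ofInjective _ hinj).trans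
    ((LinearEquiv.ofEq _ _ hrange).trans (LinearEquiv.ofInjective _ hinj').symm)
  have he : ∀ x y, B (s' (e x)) y = B (s x) y := fun x y => by
    have : (LinearEquiv.ofInjective _ hinj') (e x) =
        LinearEquiv.ofEq _ _ hrange (LinearEquiv.ofInjective _ hinj x) := by simp [e]
    exact LinearMap.congr_fun (congrArg Subtype.val this) y
  refine ⟨e, fun x y => ?_⟩
  rw [← h1', ← h1, he]
  have := (h3 (s x)).2 ⟨x, fun _ => rfl⟩ (s' (e y) - s y) fun z => by
    rw [map_sub, LinearMap.sub_apply, he, sub_self]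
  rwa [map_sub, sub_eq_zero] at this

lemma IsRed.prod {B : BilinForm F V} {C : BilinForm F W} {B' : BilinForm F V'}
    {C' : BilinForm F W'} (h : IsRed B C) (h' : IsRed B' C') :
    IsRed (prodForm B B') (prodForm C C') := by
  obtain ⟨s, h1, h2, h3⟩ := h
  obtain ⟨s', h1', h2', h3'⟩ := h'
  refine ⟨s.prodMap s', fun x y => by simp [h1, h1'], fun x hx => Prod.ext ?_ ?_, fun v => ?_⟩
  · exact h2 _ fun y => by simpa using hx (y, 0)
  · exact h2' _ fun y => by simpa using hx (0, y)
  · constructor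
    · intro h
      obtain ⟨x, hx⟩ := (h3 v.1).1 fun r hr => by simpa using h (r, 0) fun y => by simp [hr]
      obtain ⟨x', hx'⟩ := (h3' v.2).1 fun r hr => by simpa using h (0, r) fun y => by simp [hr]
      exact ⟨(x, x'), fun y => by simp [hx, hx']⟩
    · rintro ⟨x, hx⟩ r hr
      rw [prodForm_apply, (h3 v.1).2 ⟨x.1, fun y => by simpa using hx (y, 0)⟩ _
        fun y => by simpa using hr (y, 0), (h3' v.2).2 ⟨x.2, fun y => by simpa using hx (0, y)⟩ _
        fun y => by simpa using hr (0, y), add_zero]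

lemma isRed_of_nondeg {B : BilinForm F V} (h : ∀ u, (∀ v, B u v = 0) → u = 0) : IsRed B B :=
  ⟨LinearMap.id, fun _ _ => rfl, h, fun v =>
    ⟨fun _ => ⟨v, fun _ => rfl⟩, fun _ r hr => by rw [h r hr, map_zero]⟩⟩

lemma bf_J_succ (m : ℕ) (x y : Fin (m + 1) → F) :
    bf ⟨m + 1, J F (m + 1) 0⟩ x y = ∑ i : Fin m, x i.succ * y i.castSucc := by
  rw [bf_apply, dotProduct, Fin.sum_univ_succ]
  have h0 : (J F (m + 1) 0 *ᵥ y) 0 = 0 := by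
    simp only [mulVec, dotProduct, J, of_apply]
    exact Finset.sum_eq_zero fun j _ => by simp
  have h1 : ∀ i : Fin m, (J F (m + 1) 0 *ᵥ y) i.succ = y i.castSucc := fun i => by
    simp only [mulVec, dotProduct, J, of_apply]
    rw [Finset.sum_eq_single i.castSucc]
    · simp [Fin.ext_iff]
    · intro j _ hj
      have : (i : ℕ) ≠ j := fun h => hj (Fin.ext h.symm)
      simp [this]
    · simp
  simp only [h0, h1, mul_zero, zero_add]

lemma forall_bf_J_eq_zero (m : ℕ) (x : Fin (m + 1) → F) :
    (∀ y, bf ⟨m + 1, J F (m + 1) 0⟩ x y = 0) ↔ ∀ i : Fin m, x i.succ = 0 := by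
  constructor
  · intro h i
    have := h (Pi.single i.castSucc 1)
    rw [bf_J_succ, Finset.sum_eq_single i] at this
    · simpa using this
    · intro j _ hj
      rw [Pi.single_eq_of_ne (by simpa using hj), mul_zero]
    · simp
  · intro h y
    rw [bf_J_succ]
    exact Finset.sum_eq_zero fun i _ => by rw [h, zero_mul]

lemma forall_bf_J_eq_zero' (m : ℕ) (x : Fin (m + 1) → F) :
    (∀ y, bf ⟨m + 1, J F (m + 1) 0⟩ y x = 0) ↔ ∀ i : Fin m, x i.castSucc = 0 := by
  constructor
  · intro h i
    have := h (Pi.single i.succ 1)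
    rw [bf_J_succ, Finset.sum_eq_single i] at this
    · simpa using this
    · intro j _ hj
      rw [Pi.single_eq_of_ne (by simpa using hj), zero_mul]
    · simp
  · intro h y
    rw [bf_J_succ]
    exact Finset.sum_eq_zero fun i _ => by rw [h, mul_zero]

lemma sum_mul_cons_eq (m : ℕ) (x y : Fin m → F) :
    ∑ i : Fin m, x i * (Fin.cons 0 y : Fin (m + 1) → F) i.castSucc = bf ⟨m, J F m 0⟩ x y := by
  cases m with
  | zero => rw [Finset.univ_eq_empty, Finset.sum_empty, Subsingleton.elim x 0, map_zero]; rfl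
  | succ k =>
    rw [bf_J_succ, Fin.sum_univ_succ]
    simp

lemma isRed_J (n : ℕ) : IsRed (bf ⟨n, J F n 0⟩) (bf ⟨n - 2, J F (n - 2) 0⟩) := by
  match n with
  | 0 =>
    have : Subsingleton (Fin 0 → F) := inferInstance
    exact isRed_of_nondeg fun u _ => this.elim _ _
  | 1 =>
    have : Subsingleton (Fin 0 → F) := inferInstance
    refine ⟨0, fun x y => ?_, fun x _ => this.elim _ _, fun v => ⟨fun _ => ⟨0, fun y => ?_⟩,
      fun _ r _ => ?_⟩⟩
    · rw [show x = 0 from this.elim _ _]; simp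
    · rw [bf_J_succ]; simp
    · rw [bf_J_succ]; simp
  | m + 2 =>
    let s : (Fin m → F) →ₗ[F] (Fin (m + 2) → F) :=
      { toFun := fun x => Fin.cons 0 (Fin.cons 0 x)
        map_add' := fun x y => by
          ext i; refine Fin.cases ?_ (fun i => Fin.cases ?_ (fun i => ?_) i) i <;> simp
        map_smul' := fun x y => by
          ext i; refine Fin.cases ?_ (fun i => Fin.cases ?_ (fun i => ?_) i) i <;> simp }
    have hs : ∀ x, s x = Fin.cons 0 (Fin.cons 0 x) := fun _ => rfl
    refine ⟨s, fun (x y : Fin m → F) => ?_, fun x hx => ?_, fun v => ⟨fun h => ?_, ?_⟩⟩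
    · rw [bf_J_succ, Fin.sum_univ_succ, hs, hs]
      refine Eq.trans ?_ (sum_mul_cons_eq m x y)
      simp only [Fin.cons_succ, Fin.cons_zero, zero_mul, zero_add, ← Fin.succ_castSucc]
    · rw [forall_bf_J_eq_zero] at hx
      ext i
      simpa [hs] using hx i.succ
    · have h1 := h (Pi.single 0 1) (by rw [forall_bf_J_eq_zero]; intro i; simp)
      rw [bf_J_succ, Fin.sum_univ_succ] at h1
      simp at h1
      refine ⟨fun i => v i.succ.succ, fun y => ?_⟩
      rw [bf_J_succ, bf_J_succ]
      refine Finset.sum_congr rfl fun i _ => ?_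
      refine Fin.cases ?_ (fun i => ?_) i
      · simp [hs, h1]
      · simp [hs]
    · rintro ⟨x, hx⟩ r hr
      rw [forall_bf_J_eq_zero] at hr
      rw [hx, bf_J_succ]
      refine Finset.sum_eq_zero fun i _ => ?_
      refine Fin.cases ?_ (fun i => ?_) i
      · simp [hs]
      · rw [← Fin.succ_castSucc, hr, mul_zero]

end Reduction

section Radical

variable {V W : Type*} [AddCommGroup V] [Module F V] [AddCommGroup W] [Module F W]

lemma finrank_submodule_prod [FiniteDimensional F V] [FiniteDimensional F W] (P : Submodule F V)
    (Q : Submodule F W) :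
    Module.finrank F (P.prod Q) = Module.finrank F P + Module.finrank F Q := by
  rw [← Module.finrank_prod]
  exact LinearEquiv.finrank_eq
    { toFun := fun x => (⟨x.1.1, x.2.1⟩, ⟨x.1.2, x.2.2⟩)
      invFun := fun x => ⟨(x.1, x.2), x.1.2, x.2.2⟩
      map_add' := fun _ _ => rfl
      map_smul' := fun _ _ => rfl
      left_inv := fun _ => rfl
      right_inv := fun _ => rfl }

/-- The left radical of a form. -/
def leftRad (B : BilinForm F V) : Submodule F V := LinearMap.ker B

/-- The intersection of the left and the right radical of a form. -/
def biRad (B : BilinForm F V) : Submodule F V := LinearMap.ker B ⊓ LinearMap.ker (LinearMap.flip B)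

lemma mem_leftRad {B : BilinForm F V} {u : V} : u ∈ leftRad B ↔ ∀ v, B u v = 0 :=
  ⟨fun h v => LinearMap.congr_fun (LinearMap.mem_ker.1 h) v,
    fun h => LinearMap.mem_ker.2 (LinearMap.ext h)⟩

lemma mem_biRad {B : BilinForm F V} {u : V} :
    u ∈ biRad B ↔ (∀ v, B u v = 0) ∧ ∀ v, B v u = 0 :=
  ⟨fun h => ⟨mem_leftRad.1 h.1, fun v => LinearMap.congr_fun (LinearMap.mem_ker.1 h.2) v⟩,
    fun h => ⟨mem_leftRad.2 h.1, LinearMap.mem_ker.2 (LinearMap.ext h.2)⟩⟩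

lemma Isom.finrank_leftRad {B : BilinForm F V} {C : BilinForm F W} (h : Isom B C) :
    Module.finrank F (leftRad B) = Module.finrank F (leftRad C) := by
  obtain ⟨e, he⟩ := h
  rw [← LinearEquiv.finrank_map_eq e (leftRad B)]
  suffices (leftRad B).map (e : V →ₗ[F] W) = leftRad C by rw [this]
  ext w
  rw [Submodule.mem_map_equiv, mem_leftRad, mem_leftRad, ← e.toEquiv.forall_congr_right]
  simp [← he]

lemma Isom.finrank_biRad {B : BilinForm F V} {C : BilinForm F W} (h : Isom B C) :
    Module.finrank F (biRad B) = Module.finrank F (biRad C) := by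
  obtain ⟨e, he⟩ := h
  rw [← LinearEquiv.finrank_map_eq e (biRad B)]
  suffices (biRad B).map (e : V →ₗ[F] W) = biRad C by rw [this]
  ext w
  rw [Submodule.mem_map_equiv, mem_biRad, mem_biRad]
  refine and_congr ?_ ?_ <;> rw [e.symm.toEquiv.forall_congr_left] <;> simp [← he]

lemma finrank_leftRad_of_nondeg {B : BilinForm F V} (h : ∀ u, (∀ v, B u v = 0) → u = 0) :
    Module.finrank F (leftRad B) = 0 := by
  rw [show leftRad B = ⊥ from (Submodule.eq_bot_iff _).2 fun u hu => h u (mem_leftRad.1 hu)]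
  exact finrank_bot F V

lemma finrank_biRad_of_nondeg {B : BilinForm F V} (h : ∀ u, (∀ v, B u v = 0) → u = 0) :
    Module.finrank F (biRad B) = 0 := by
  rw [show biRad B = ⊥ from (Submodule.eq_bot_iff _).2 fun u hu => h u (mem_biRad.1 hu).1]
  exact finrank_bot F V

variable [FiniteDimensional F V] [FiniteDimensional F W]

lemma finrank_leftRad_prod (B : BilinForm F V) (C : BilinForm F W) :
    Module.finrank F (leftRad (prodForm B C)) =
      Module.finrank F (leftRad B) + Module.finrank F (leftRad C) := by
  rw [← finrank_submodule_prod]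
  suffices leftRad (prodForm B C) = (leftRad B).prod (leftRad C) by rw [this]
  ext x
  simp only [Submodule.mem_prod, mem_leftRad, prodForm_apply]
  exact ⟨fun h => ⟨fun v => by simpa using h (v, 0), fun v => by simpa using h (0, v)⟩,
    fun h v => by rw [h.1, h.2, add_zero]⟩

lemma finrank_biRad_prod (B : BilinForm F V) (C : BilinForm F W) :
    Module.finrank F (biRad (prodForm B C)) =
      Module.finrank F (biRad B) + Module.finrank F (biRad C) := by
  rw [← finrank_submodule_prod]
  suffices biRad (prodForm B C) = (biRad B).prod (biRad C) by rw [this]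
  ext x
  simp only [Submodule.mem_prod, mem_biRad, prodForm_apply]
  exact ⟨fun h => ⟨⟨fun v => by simpa using h.1 (v, 0), fun v => by simpa using h.2 (v, 0)⟩,
      fun v => by simpa using h.1 (0, v), fun v => by simpa using h.2 (0, v)⟩,
    fun h => ⟨fun v => by rw [h.1.1, h.2.1, add_zero], fun v => by rw [h.1.2, h.2.2, add_zero]⟩⟩

lemma span_single_zero (m : ℕ) (x : Fin (m + 1) → F) :
    x ∈ Submodule.span F {(Pi.single 0 1 : Fin (m + 1) → F)} ↔ ∀ i : Fin m, x i.succ = 0 := by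
  rw [Submodule.mem_span_singleton]
  constructor
  · rintro ⟨c, rfl⟩ i
    simp
  · intro h
    refine ⟨x 0, funext fun i => Fin.cases ?_ (fun i => ?_) i⟩
    · simp
    · simp [h]

lemma finrank_leftRad_J (n : ℕ) :
    Module.finrank F (leftRad (bf ⟨n, J F n 0⟩)) = if 0 < n then 1 else 0 := by
  cases n with
  | zero =>
    have : Subsingleton (Fin 0 → F) := inferInstance
    exact finrank_leftRad_of_nondeg fun u _ => this.elim _ _
  | succ m =>
    rw [if_pos m.succ_pos]
    have : leftRad (bf ⟨m + 1, J F (m + 1) 0⟩) =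
        Submodule.span F {(Pi.single 0 1 : Fin (m + 1) → F)} := by
      ext x
      rw [span_single_zero, mem_leftRad, forall_bf_J_eq_zero]
    rw [this]
    exact finrank_span_singleton fun h => by simpa using congrFun h 0

lemma finrank_biRad_J (n : ℕ) :
    Module.finrank F (biRad (bf ⟨n, J F n 0⟩)) = if n = 1 then 1 else 0 := by
  match n with
  | 0 =>
    have : Subsingleton (Fin 0 → F) := inferInstance
    exact finrank_biRad_of_nondeg fun u _ => this.elim _ _
  | 1 =>
    rw [if_pos rfl]
    have : biRad (bf ⟨0 + 1, J F (0 + 1) 0⟩) =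
        Submodule.span F {(Pi.single 0 1 : Fin (0 + 1) → F)} := by
      ext x
      rw [span_single_zero, mem_biRad, forall_bf_J_eq_zero, forall_bf_J_eq_zero']
      exact ⟨fun h => h.1, fun h => ⟨h, fun i => i.elim0⟩⟩
    rw [this]
    exact finrank_span_singleton fun h => by simpa using congrFun h 0
  | m + 2 =>
    rw [if_neg (by omega)]
    have : biRad (bf ⟨m + 1 + 1, J F (m + 1 + 1) 0⟩) = ⊥ := by
      refine (Submodule.eq_bot_iff _).2 fun x hx => ?_
      rw [mem_biRad, forall_bf_J_eq_zero, forall_bf_J_eq_zero'] at hx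
      exact funext fun i => Fin.cases (hx.2 0) hx.1 i
    rw [this]
    exact finrank_bot F _

end Radical

section Jordan

/-- The direct sum of singular Jordan blocks of the given sizes. -/
abbrev jordanSum (F : Type*) [Field F] (ns : List ℕ) : Block F :=
  bsum (ns.map fun n => ⟨n, J F n 0⟩)

lemma isRed_jordanSum (ns : List ℕ) :
    IsRed (bf (jordanSum F ns)) (bf (jordanSum F (ns.map (· - 2)))) := by
  induction ns with
  | nil =>
    have : Subsingleton (Fin 0 → F) := inferInstance
    exact isRed_of_nondeg fun u _ => this.elim _ _
  | cons n ns ih => exact ((isRed_J n).prod ih).congr (isom_bsum_cons _ _) (isom_bsum_cons _ _)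

lemma finrank_leftRad_jordanSum (ns : List ℕ) :
    Module.finrank F (leftRad (bf (jordanSum F ns))) = ns.countP (0 < ·) := by
  induction ns with
  | nil =>
    have : Subsingleton (Fin 0 → F) := inferInstance
    exact finrank_leftRad_of_nondeg fun u _ => this.elim _ _
  | cons n ns ih =>
    have := (isom_bsum_cons ⟨n, J F n 0⟩ (ns.map fun n => ⟨n, J F n 0⟩)).finrank_leftRad
    rw [finrank_leftRad_prod, finrank_leftRad_J, ih] at this
    rw [jordanSum, List.map_cons, ← this, List.countP_cons, add_comm]
    simp

lemma finrank_biRad_jordanSum (ns : List ℕ) :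
    Module.finrank F (biRad (bf (jordanSum F ns))) = ns.count 1 := by
  induction ns with
  | nil =>
    have : Subsingleton (Fin 0 → F) := inferInstance
    exact finrank_biRad_of_nondeg fun u _ => this.elim _ _
  | cons n ns ih =>
    have := (isom_bsum_cons ⟨n, J F n 0⟩ (ns.map fun n => ⟨n, J F n 0⟩)).finrank_biRad
    rw [finrank_biRad_prod, finrank_biRad_J, ih] at this
    rw [jordanSum, List.map_cons, ← this, List.count_cons, add_comm]
    simp

lemma count_map_sub_two (ns : List ℕ) {n : ℕ} (hn : 0 < n) :
    (ns.map (· - 2)).count n = ns.count (n + 2) := by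
  induction ns with
  | nil => rfl
  | cons k ns ih =>
    rw [List.map_cons, List.count_cons, List.count_cons, ih]
    simp only [beq_iff_eq, show (k - 2 = n) = (k = n + 2) by rw [eq_iff_iff]; omega]

lemma countP_pos_eq (ns : List ℕ) :
    ns.countP (0 < ·) = ns.count 1 + ns.count 2 + (ns.map (· - 2)).countP (0 < ·) := by
  induction ns with
  | nil => rfl
  | cons k ns ih =>
    simp only [List.map_cons, List.count_cons, List.countP_cons, ih, beq_iff_eq, decide_eq_true_eq]
    split_ifs <;> omega

lemma jordanSum_size_of_forall_eq_zero (ns : List ℕ) (h : ∀ n ∈ ns, n = 0) :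
    (jordanSum F ns).1 = 0 := by
  induction ns with
  | nil => rfl
  | cons n ns ih =>
    have h1 := ih fun k hk => h k (List.mem_cons_of_mem _ hk)
    have h2 := h n List.mem_cons_self
    show n + (jordanSum F ns).1 = 0
    omega

variable {V W : Type*} [AddCommGroup V] [Module F V] [AddCommGroup W] [Module F W]
  [FiniteDimensional F V] [FiniteDimensional F W]

lemma jordanSum_unique {N : BilinForm F V} {N' : BilinForm F W}
    (hN : ∀ u, (∀ v, N u v = 0) → u = 0) (hN' : ∀ u, (∀ v, N' u v = 0) → u = 0) (K : ℕ) :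
    ∀ ns ms : List ℕ, (∀ n ∈ ns, n ≤ K) → (∀ n ∈ ms, n ≤ K) →
      Isom (prodForm (bf (jordanSum F ns)) N) (prodForm (bf (jordanSum F ms)) N') →
      (∀ n, 0 < n → ns.count n = ms.count n) ∧ Isom N N' := by
  induction K with
  | zero =>
    intro ns ms hns hms h
    have hns' : ∀ n ∈ ns, n = 0 := fun n hn => Nat.le_zero.1 (hns n hn)
    have hms' : ∀ n ∈ ms, n = 0 := fun n hn => Nat.le_zero.1 (hms n hn)
    have h1 : Subsingleton (Fin (jordanSum F ns).1 → F) := by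
      rw [jordanSum_size_of_forall_eq_zero ns hns']; infer_instance
    have h2 : Subsingleton (Fin (jordanSum F ms).1 → F) := by
      rw [jordanSum_size_of_forall_eq_zero ms hms']; infer_instance
    refine ⟨fun n hn => ?_, ((isom_prod_of_subsingleton _ N).trans h).trans
      (isom_prod_of_subsingleton _ N').symm⟩
    rw [List.count_eq_zero_of_not_mem fun h => hn.ne' (hns' n h),
      List.count_eq_zero_of_not_mem fun h => hn.ne' (hms' n h)]
  | succ K ih =>
    intro ns ms hns hms h
    have hred : Isom (prodForm (bf (jordanSum F (ns.map (· - 2)))) N)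
        (prodForm (bf (jordanSum F (ms.map (· - 2)))) N') :=
      (((isRed_jordanSum ns).prod (isRed_of_nondeg hN)).congr h (Isom.refl _)).isom
        ((isRed_jordanSum ms).prod (isRed_of_nondeg hN'))
    obtain ⟨h3, hI⟩ := ih _ _
      (by simp only [List.mem_map, forall_exists_index, and_imp, forall_apply_eq_imp_iff₂]
          intro n hn; have := hns n hn; omega)
      (by simp only [List.mem_map, forall_exists_index, and_imp, forall_apply_eq_imp_iff₂]
          intro n hn; have := hms n hn; omega) hred
    have hP := h.finrank_leftRad
    have hP' := hred.finrank_leftRad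
    have h1 := h.finrank_biRad
    rw [finrank_leftRad_prod, finrank_leftRad_prod, finrank_leftRad_of_nondeg hN,
      finrank_leftRad_of_nondeg hN', finrank_leftRad_jordanSum, finrank_leftRad_jordanSum] at hP hP'
    rw [finrank_biRad_prod, finrank_biRad_prod, finrank_biRad_of_nondeg hN,
      finrank_biRad_of_nondeg hN', finrank_biRad_jordanSum, finrank_biRad_jordanSum] at h1
    rw [countP_pos_eq ns, countP_pos_eq ms] at hP
    refine ⟨fun n hn => ?_, hI⟩
    match n, hn with
    | 1, _ => exact h1
    | 2, _ => omega
    | m + 3, _ => rw [← count_map_sub_two ns m.succ_pos, ← count_map_sub_two ms m.succ_pos,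
        h3 _ m.succ_pos]

end Jordan

/-! ### Multiplicities of cyclic summands of an endomorphism -/

section Multiplicity

variable {V W : Type*} [AddCommGroup V] [Module F V] [AddCommGroup W] [Module F W]

/-- The vectors killed by `q ^ k`. -/
def powKer (σ : Module.End F V) (q : F[X]) (k : ℕ) : Submodule F V :=
  LinearMap.ker (aeval σ (q ^ k))

/-- The vectors killed by `q ^ k` which are congruent to multiples of `q` modulo those killed by
`q ^ (k - 1)`. -/
def powKer' (σ : Module.End F V) (q : F[X]) (k : ℕ) : Submodule F V :=
  powKer σ q k ⊓ (LinearMap.range (aeval σ (q ^ k))).comap (aeval σ (q ^ (k - 1)))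

/-- The dimension over `F` of the part of type `q ^ k` in the primary decomposition for `σ`. -/
def cycMult (σ : Module.End F V) (q : F[X]) (k : ℕ) : ℕ :=
  Module.finrank F (powKer σ q k) - Module.finrank F (powKer' σ q k)

lemma mem_powKer {σ : Module.End F V} {q : F[X]} {k : ℕ} {u : V} :
    u ∈ powKer σ q k ↔ aeval σ (q ^ k) u = 0 := LinearMap.mem_ker

lemma mem_powKer' {σ : Module.End F V} {q : F[X]} {k : ℕ} {u : V} :
    u ∈ powKer' σ q k ↔ aeval σ (q ^ k) u = 0 ∧
      ∃ z, aeval σ (q ^ k) z = aeval σ (q ^ (k - 1)) u := Iff.rfl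

lemma powKer'_le (σ : Module.End F V) (q : F[X]) (k : ℕ) : powKer' σ q k ≤ powKer σ q k :=
  inf_le_left

lemma aeval_prodMap_apply (σ : Module.End F V) (σ' : Module.End F W) (f : F[X]) (x : V × W) :
    aeval (σ.prodMap σ' : Module.End F (V × W)) f x = (aeval σ f x.1, aeval σ' f x.2) := by
  have := aeval_algHom_apply (LinearMap.prodMapAlgHom F V W) (σ, σ') f
  rw [aeval_prod_apply] at this
  exact LinearMap.congr_fun this x

lemma aeval_conj_apply {σ : Module.End F V} {σ' : Module.End F W} (e : V →ₗ[F] W)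
    (h : ∀ v, e (σ v) = σ' (e v)) (f : F[X]) (v : V) : e (aeval σ f v) = aeval σ' f (e v) := by
  induction f using Polynomial.induction_on generalizing v with
  | C a => simp [Module.algebraMap_end_apply]
  | add f g hf hg => simp [hf, hg]
  | monomial n a ih =>
    rw [pow_succ, ← mul_assoc, aeval_mul_apply (C a * X ^ n) X v,
      aeval_mul_apply (C a * X ^ n) X (e v), aeval_X, aeval_X, ih, h]

lemma cycMult_conj {σ : Module.End F V} {σ' : Module.End F W} (e : V ≃ₗ[F] W)
    (h : ∀ v, e (σ v) = σ' (e v)) (q : F[X]) (k : ℕ) : cycMult σ q k = cycMult σ' q k := by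
  have h1 : ∀ f v, e (aeval σ f v) = aeval σ' f (e v) := aeval_conj_apply (e : V →ₗ[F] W) h
  have h2 : (powKer σ q k).map (e : V →ₗ[F] W) = powKer σ' q k := by
    ext w
    rw [Submodule.mem_map_equiv, mem_powKer, mem_powKer, ← e.map_eq_zero_iff, h1,
      e.apply_symm_apply]
  have h3 : (powKer' σ q k).map (e : V →ₗ[F] W) = powKer' σ' q k := by
    ext w
    rw [Submodule.mem_map_equiv, mem_powKer', mem_powKer', ← e.map_eq_zero_iff, h1,
      e.apply_symm_apply]
    refine and_congr_right fun _ => ⟨fun ⟨z, hz⟩ => ⟨e z, ?_⟩, fun ⟨z, hz⟩ => ⟨e.symm z, ?_⟩⟩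
    · rw [← h1, hz, h1, e.apply_symm_apply]
    · apply e.injective
      rw [h1, h1, e.apply_symm_apply, e.apply_symm_apply, hz]
  rw [cycMult, cycMult, ← h2, ← h3, LinearEquiv.finrank_map_eq, LinearEquiv.finrank_map_eq]

lemma powKer_prod (σ : Module.End F V) (σ' : Module.End F W) (q : F[X]) (k : ℕ) :
    powKer (σ.prodMap σ') q k = (powKer σ q k).prod (powKer σ' q k) := by
  ext x
  rw [Submodule.mem_prod, mem_powKer, mem_powKer, mem_powKer, aeval_prodMap_apply, Prod.mk_eq_zero]

lemma powKer'_prod (σ : Module.End F V) (σ' : Module.End F W) (q : F[X]) (k : ℕ) :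
    powKer' (σ.prodMap σ') q k = (powKer' σ q k).prod (powKer' σ' q k) := by
  ext x
  simp only [Submodule.mem_prod, mem_powKer', aeval_prodMap_apply, Prod.mk_eq_zero, Prod.mk.injEq,
    Prod.exists]
  exact ⟨fun ⟨h, a, b, h1, h2⟩ => ⟨⟨h.1, a, h1⟩, h.2, b, h2⟩,
    fun ⟨⟨h1, a, h2⟩, h3, b, h4⟩ => ⟨⟨h1, h3⟩, a, b, h2, h4⟩⟩

lemma cycMult_prod [FiniteDimensional F V] [FiniteDimensional F W] (σ : Module.End F V)
    (σ' : Module.End F W) (q : F[X]) (k : ℕ) :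
    cycMult (σ.prodMap σ') q k = cycMult σ q k + cycMult σ' q k := by
  rw [cycMult, cycMult, cycMult, powKer_prod, powKer'_prod, finrank_submodule_prod,
    finrank_submodule_prod]
  have h1 := Submodule.finrank_mono (powKer'_le σ q k)
  have h2 := Submodule.finrank_mono (powKer'_le σ' q k)
  omega

lemma powKer'_eq_of_cycMult [FiniteDimensional F V] {σ : Module.End F V} {q : F[X]} {k : ℕ}
    (h : cycMult σ q k = 0) : powKer' σ q k = powKer σ q k :=
  Submodule.eq_of_le_of_finrank_le (powKer'_le σ q k) (Nat.sub_eq_zero_iff_le.1 h)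

/-- `σ` makes the space a cyclic module with annihilator `p ^ l`. -/
def IsCycEnd (σ : Module.End F V) (p : F[X]) (l : ℕ) : Prop :=
  ∃ g, aeval σ (p ^ l) g = 0 ∧ aeval σ (p ^ (l - 1)) g ≠ 0 ∧ ∀ x, ∃ f : F[X], aeval σ f g = x

lemma IsCycEnd.powKer_eq_bot {σ : Module.End F V} {p q : F[X]} {l k : ℕ} (h : IsCycEnd σ p l)
    (hpq : IsCoprime p q) : powKer σ q k = ⊥ := by
  obtain ⟨g, hg, -, hs⟩ := h
  obtain ⟨a, b, hab⟩ := hpq.pow (m := l) (n := k)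
  refine (Submodule.eq_bot_iff _).2 fun u hu => ?_
  obtain ⟨f, rfl⟩ := hs u
  have h1 : aeval σ (1 : F[X]) (aeval σ f g) = 0 := by
    rw [← hab, map_add, LinearMap.add_apply, aeval_mul_apply, aeval_mul_apply,
      mem_powKer.1 hu, aeval_apply_comm (p ^ l), hg, map_zero, map_zero, map_zero, add_zero]
  simpa using h1

lemma finrank_range_of_isCycEnd [FiniteDimensional F V] {σ : Module.End F V} {p : F[X]} {l : ℕ}
    (hp : Irreducible p) (hm : p.Monic) (hl : 0 < l) (h : IsCycEnd σ p l) :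
    Module.finrank F (LinearMap.range (aeval σ (p ^ (l - 1)))) = p.natDegree := by
  obtain ⟨g, hg, hg', hs⟩ := h
  let φ : degreeLT F p.natDegree →ₗ[F] V :=
    { toFun := fun f => aeval σ (p ^ (l - 1) * (f : F[X])) g
      map_add' := fun f f' => by simp [mul_add]
      map_smul' := fun c f => by simp }
  have hφ : ∀ f, φ f = aeval σ (p ^ (l - 1) * (f : F[X])) g := fun _ => rfl
  have hlp : p ^ l = p ^ (l - 1) * p := by rw [← pow_succ, Nat.sub_add_cancel hl]
  have hinj : Function.Injective φ := by
    rw [← LinearMap.ker_eq_bot, LinearMap.ker_eq_bot']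
    intro f hf
    have h1 := pow_dvd_of_aeval_eq_zero hp hg hg' hf
    rw [hlp, mul_dvd_mul_iff_left (pow_ne_zero _ hp.ne_zero)] at h1
    have h2 := mem_degreeLT.1 f.2
    rw [← degree_eq_natDegree hp.ne_zero] at h2
    exact Subtype.ext (eq_zero_of_dvd_of_degree_lt h1 h2)
  have hrange : LinearMap.range φ = LinearMap.range (aeval σ (p ^ (l - 1))) := by
    refine le_antisymm ?_ ?_
    · rintro _ ⟨f, rfl⟩
      exact ⟨aeval σ (f : F[X]) g, by rw [hφ, aeval_mul_apply]⟩
    · rintro _ ⟨x, rfl⟩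
      obtain ⟨f, rfl⟩ := hs x
      refine ⟨⟨f %ₘ p, ?_⟩, ?_⟩
      · rw [mem_degreeLT, ← degree_eq_natDegree hp.ne_zero]
        exact degree_modByMonic_lt f hm
      · rw [hφ, ← aeval_mul_apply]
        refine (aeval_eq_of_dvd_sub hg ?_).symm
        rw [← mul_sub, hlp]
        refine mul_dvd_mul_left _ ⟨f /ₘ p, ?_⟩
        rw [sub_eq_iff_eq_add, add_comm, modByMonic_add_div]
  rw [← hrange, LinearMap.finrank_range_of_inj hinj,
    (degreeLTEquiv F p.natDegree).finrank_eq, Module.finrank_fin_fun]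

lemma cycMult_of_isCycEnd [FiniteDimensional F V] {σ : Module.End F V} {p q : F[X]} {l k : ℕ}
    (hp : Irreducible p) (hm : p.Monic) (hl : 0 < l) (h : IsCycEnd σ p l)
    (hq : Irreducible q) (hmq : q.Monic) (hk : 0 < k) [Decidable (q = p ∧ k = l)] :
    cycMult σ q k = if q = p ∧ k = l then p.natDegree else 0 := by
  by_cases hqp : q = p
  · subst hqp
    have h' := h
    obtain ⟨g, hg, hg', hs⟩ := h'
    have hall : ∀ x, aeval σ (q ^ l) x = 0 := fun x => by
      obtain ⟨f, rfl⟩ := hs x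
      rw [aeval_apply_comm, hg, map_zero]
    rcases lt_trichotomy k l with hkl | rfl | hkl
    · rw [if_neg (by omega), cycMult, Nat.sub_eq_zero_iff_le]
      refine Submodule.finrank_mono fun u hu => mem_powKer'.2 ⟨mem_powKer.1 hu, ?_⟩
      obtain ⟨f, rfl⟩ := hs u
      have h1 := mem_powKer.1 hu
      rw [← aeval_mul_apply] at h1
      have h2 := pow_dvd_of_aeval_eq_zero hp hg hg' h1
      rw [← Nat.add_sub_of_le hkl.le, pow_add,
        mul_dvd_mul_iff_left (pow_ne_zero _ hp.ne_zero)] at h2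
      obtain ⟨c, rfl⟩ := (dvd_pow_self q (by omega)).trans h2
      refine ⟨aeval σ c g, ?_⟩
      rw [← aeval_mul_apply, ← aeval_mul_apply, ← mul_assoc, ← pow_succ, Nat.sub_add_cancel hk]
    · rw [if_pos ⟨rfl, rfl⟩, cycMult, ← finrank_range_of_isCycEnd hp hm hl h]
      have h1 : powKer σ q k = ⊤ := eq_top_iff.2 fun x _ => mem_powKer.2 (hall x)
      have h2 : powKer' σ q k = LinearMap.ker (aeval σ (q ^ (k - 1))) := by
        ext x
        rw [mem_powKer', LinearMap.mem_ker]
        constructor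
        · rintro ⟨-, z, hz⟩
          rw [← hz, hall]
        · exact fun hx => ⟨hall x, 0, by rw [hx, map_zero]⟩
      rw [h1, h2, finrank_top, ← LinearMap.finrank_range_add_finrank_ker (aeval σ (q ^ (k - 1))),
        Nat.add_sub_cancel]
    · rw [if_neg (by omega), cycMult, Nat.sub_eq_zero_iff_le]
      refine Submodule.finrank_mono fun u hu => mem_powKer'.2 ⟨mem_powKer.1 hu, 0, ?_⟩
      rw [map_zero, aeval_eq_zero_of_dvd (hall u) (pow_dvd_pow q (by omega))]
  · rw [if_neg fun h => hqp h.1, cycMult, h.powKer_eq_bot, finrank_bot, Nat.zero_sub]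
    refine (hp.coprime_iff_not_dvd).2 fun hd => hqp ?_
    exact (eq_of_monic_of_associated hm hmq (hp.associated_of_dvd hq hd)).symm

end Multiplicity

section DualPoly

variable {V : Type*} [AddCommGroup V] [Module F V] {σ τ : Module.End F V}

lemma aeval_reflect_apply (h : ∀ v, τ (σ v) = v) {N : ℕ} {f : F[X]} (hf : f.natDegree ≤ N)
    (v : V) : aeval τ (reflect N f) v = (τ ^ N) (aeval σ f v) := by
  have hpow : ∀ n v, (τ ^ n) ((σ ^ n) v) = v := by
    intro n
    induction n with
    | zero => exact fun v => rfl
    | succ n ih =>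
      intro v
      rw [pow_succ, pow_succ', Module.End.mul_apply, Module.End.mul_apply, h, ih]
  refine induction_with_natDegree_le
    (fun f => aeval τ (reflect N f) v = (τ ^ N) (aeval σ f v)) N ?_ (fun n c _ hn => ?_)
    (fun f g _ hg hf' hg' => ?_) f hf
  · simp
  · rw [reflect_C_mul_X_pow, revAt_le hn]
    simp only [map_mul, aeval_C, map_pow, aeval_X, Module.End.mul_apply,
      Module.algebraMap_end_apply, map_smul]
    congr 1
    conv_rhs => rw [← Nat.sub_add_cancel hn, pow_add, Module.End.mul_apply, hpow]
  · rw [reflect_add, map_add, map_add, LinearMap.add_apply, LinearMap.add_apply, map_add,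
      hf', hg']

lemma aeval_dualPoly_apply (h : ∀ v, τ (σ v) = v) (f : F[X]) (v : V) :
    aeval τ (dualPoly (RingHom.id F) f) v =
      (f.coeff 0)⁻¹ • (τ ^ f.natDegree) (aeval σ f v) := by
  rw [dualPoly, aeval_mul_apply, aeval_C, Module.algebraMap_end_apply, Polynomial.map_id, reverse,
    aeval_reflect_apply h le_rfl, RingHom.id_apply]

lemma dualPoly_dualPoly {p : F[X]} (hm : p.Monic) (h0 : p.eval 0 ≠ 0) :
    dualPoly (RingHom.id F) (dualPoly (RingHom.id F) p) = p := by
  have h1 : p.coeff 0 ≠ 0 := by rwa [coeff_zero_eq_eval_zero]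
  have h2 : p.reverse.reverse = p := by
    rw [reverse, natDegree_reverse_of_eval h0, reverse]
    ext i
    rw [coeff_reflect, coeff_reflect, revAt_invol]
  have h3 : (C (p.coeff 0)⁻¹).reverse = C (p.coeff 0)⁻¹ := reverse_C _
  simp only [dualPoly, Polynomial.map_id, RingHom.id_apply, reverse_mul_of_domain, h2, h3,
    mul_coeff_zero, coeff_zero_reverse, coeff_C_zero, hm.leadingCoeff, mul_one, inv_inv]
  rw [← mul_assoc, ← C_mul, mul_inv_cancel₀ h1, C_1, one_mul]

lemma eval_zero_dualPoly {p : F[X]} (hm : p.Monic) (h0 : p.eval 0 ≠ 0) :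
    (dualPoly (RingHom.id F) p).eval 0 ≠ 0 := by
  have h1 : p.coeff 0 ≠ 0 := by rwa [coeff_zero_eq_eval_zero]
  rw [← coeff_zero_eq_eval_zero, dualPoly, mul_coeff_zero, Polynomial.map_id, coeff_zero_reverse,
    hm.leadingCoeff, coeff_C_zero, mul_one]
  exact inv_ne_zero h1

lemma irreducible_dualPoly {p : F[X]} (hp : Irreducible p) (hm : p.Monic) (h0 : p.eval 0 ≠ 0) :
    Irreducible (dualPoly (RingHom.id F) p) := by
  have hunit : ∀ f : F[X], f.eval 0 ≠ 0 → IsUnit (dualPoly (RingHom.id F) f) → IsUnit f :=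
    fun f hf h => by
      have h1 := natDegree_eq_zero_of_isUnit h
      rw [natDegree_dualPoly hf] at h1
      rw [isUnit_iff_degree_eq_zero, degree_eq_natDegree (fun h => hf (by rw [h, eval_zero])), h1]
      rfl
  refine ⟨fun h => hp.not_isUnit (hunit p h0 h), fun {a b} hab => ?_⟩
  have h1 := eval_zero_dualPoly hm h0
  rw [hab, eval_mul] at h1
  have h2 : p = dualPoly (RingHom.id F) a * dualPoly (RingHom.id F) b := by
    rw [← dualPoly_mul, ← hab, dualPoly_dualPoly hm h0]
  exact (hp.isUnit_or_isUnit h2).imp (hunit a (left_ne_zero_of_mul h1))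
    (hunit b (right_ne_zero_of_mul h1))

end DualPoly

section Companion

lemma aeval_toLin'_transpose {m : ℕ} (S : Mat F m) (f : F[X]) :
    aeval (Matrix.toLin' Sᵀ) f =
      Matrix.toLin' (LinearMap.toMatrix' (aeval (Matrix.toLin' S) f))ᵀ := by
  have h1 : ∀ T : Mat F m, aeval (Matrix.toLin' T) f = Matrix.toLin' (aeval T f) := fun T =>
    aeval_algHom_apply (Matrix.toLinAlgEquiv' (R := F) (n := Fin m)).toAlgHom T f
  rw [h1, h1, LinearMap.toMatrix'_toLin', aeval_eq_sum_range, aeval_eq_sum_range,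
    Matrix.transpose_sum]
  simp only [Matrix.transpose_smul, Matrix.transpose_pow]

lemma isCycEnd_of_apply {p : F[X]} {l : ℕ} (hp : Irreducible p) {m : ℕ}
    (hd : (p ^ l).natDegree = m) {ρ : Module.End F (Fin m → F)} {g : Fin m → F}
    (hg : aeval ρ (p ^ l) g = 0) (hg' : aeval ρ (p ^ (l - 1)) g ≠ 0) :
    IsCycEnd ρ p l :=
  ⟨g, hg, hg', exists_aeval_eq hp hd hg hg'⟩

variable {p : F[X]} {l : ℕ} (hp : Irreducible p) (hm : p.Monic) (hl : 0 < l) (h0 : p.eval 0 ≠ 0)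
include hp hm hl

lemma isCycEnd_companion : IsCycEnd (Matrix.toLin' (companion F (p ^ l))) p l := by
  obtain ⟨g, hg, hg'⟩ := exists_companion_cyclic hp hm hl
  exact isCycEnd_of_apply hp rfl hg hg'

lemma isCycEnd_companion_transpose :
    IsCycEnd (Matrix.toLin' (companion F (p ^ l))ᵀ) p l := by
  obtain ⟨g, hg, hg', hs⟩ := isCycEnd_companion hp hm hl
  have h1 : aeval (Matrix.toLin' (companion F (p ^ l))) (p ^ l) = 0 := LinearMap.ext fun x => by
    obtain ⟨f, rfl⟩ := hs x
    rw [aeval_apply_comm, hg, map_zero, LinearMap.zero_apply]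
  have h2 : aeval (Matrix.toLin' (companion F (p ^ l))ᵀ) (p ^ l) = 0 := by
    rw [aeval_toLin'_transpose, h1]
    simp
  have h3 : aeval (Matrix.toLin' (companion F (p ^ l))ᵀ) (p ^ (l - 1)) ≠ 0 := fun h => by
    rw [aeval_toLin'_transpose, map_eq_zero_iff _ (LinearEquiv.injective _),
      Matrix.transpose_eq_zero, map_eq_zero_iff _ (LinearEquiv.injective _)] at h
    exact hg' (by rw [h, LinearMap.zero_apply])
  obtain ⟨g', hg'⟩ : ∃ g', aeval (Matrix.toLin' (companion F (p ^ l))ᵀ) (p ^ (l - 1)) g' ≠ 0 := by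
    by_contra! h
    exact h3 (LinearMap.ext h)
  exact isCycEnd_of_apply hp rfl (by rw [h2, LinearMap.zero_apply]) hg'

include h0

lemma isUnit_det_companion : IsUnit (companion F (p ^ l)).det := by
  rw [← Matrix.isUnit_iff_isUnit_det, ← Matrix.mulVec_injective_iff_isUnit]
  obtain ⟨g, hg, hg', hs⟩ := isCycEnd_companion hp hm hl
  refine (injective_iff_map_eq_zero (Matrix.toLin' (companion F (p ^ l)))).2 fun x hx => ?_
  obtain ⟨f, rfl⟩ := hs x
  have h1 : aeval (Matrix.toLin' (companion F (p ^ l))) (X * f) g = 0 := by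
    rw [aeval_mul_apply, aeval_X, hx]
  have hX : IsCoprime (p ^ l) X := by
    refine IsCoprime.pow_left ((hp.coprime_iff_not_dvd).2 fun hd => h0 ?_)
    obtain ⟨c, hc⟩ := (hp.dvd_symm irreducible_X hd)
    rw [hc, eval_mul, eval_X, zero_mul]
  obtain ⟨c, rfl⟩ := hX.dvd_of_dvd_mul_left (pow_dvd_of_aeval_eq_zero hp hg hg' h1)
  rw [mul_comm, aeval_mul_apply, hg, map_zero]

lemma isCycEnd_companion_inv_transpose :
    IsCycEnd (Matrix.toLin' (companion F (p ^ l))ᵀ⁻¹) (dualPoly (RingHom.id F) p) l := by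
  obtain ⟨g, hg, hg', -⟩ := isCycEnd_companion_transpose hp hm hl
  have hS : IsUnit (companion F (p ^ l))ᵀ.det := by
    rw [Matrix.det_transpose]; exact isUnit_det_companion hp hm hl h0
  have h1 : ∀ v,
      Matrix.toLin' (companion F (p ^ l))ᵀ⁻¹ (Matrix.toLin' (companion F (p ^ l))ᵀ v) = v :=
    fun v => by rw [Matrix.toLin'_apply, Matrix.toLin'_apply, Matrix.mulVec_mulVec,
      Matrix.nonsing_inv_mul _ hS, Matrix.one_mulVec]
  have h2 : ∀ v,
      Matrix.toLin' (companion F (p ^ l))ᵀ (Matrix.toLin' (companion F (p ^ l))ᵀ⁻¹ v) = v :=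
    fun v => by rw [Matrix.toLin'_apply, Matrix.toLin'_apply, Matrix.mulVec_mulVec,
      Matrix.mul_nonsing_inv _ hS, Matrix.one_mulVec]
  have h00 : ∀ n, (p ^ n).eval 0 ≠ 0 := fun n => by rw [eval_pow]; exact pow_ne_zero _ h0
  refine isCycEnd_of_apply (irreducible_dualPoly hp hm h0) ?_ (g := g) ?_ ?_
  · rw [← dualPoly_pow, natDegree_dualPoly (h00 l)]
  · rw [← dualPoly_pow, aeval_dualPoly_apply h1, hg, map_zero, smul_zero]
  · rw [← dualPoly_pow, aeval_dualPoly_apply h1]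
    refine smul_ne_zero (inv_ne_zero ?_) fun h => hg' ?_
    · rw [coeff_zero_eq_eval_zero]; exact h00 _
    · have hinj : Function.Injective (Matrix.toLin' (companion F (p ^ l))ᵀ⁻¹) :=
        Function.LeftInverse.injective h2
      rw [Module.End.pow_apply] at h
      exact (hinj.iterate _) (h.trans (Function.iterate_fixed (map_zero _) _).symm)

end Companion

/-! ### Multiplicities of the canonical blocks -/

section SkewForm

/-- The form on `F ^ m × F ^ m` with matrix `[S ⟍ 1]`. -/
def skewForm {m : ℕ} (S : Mat F m) : BilinForm F ((Fin m → F) × (Fin m → F)) :=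
  (bf ⟨m, 1⟩).compl₁₂ (LinearMap.fst F _ _) (LinearMap.snd F _ _) +
    (bf ⟨m, S⟩).compl₁₂ (LinearMap.snd F _ _) (LinearMap.fst F _ _)

lemma skewForm_apply {m : ℕ} (S : Mat F m) (u v : (Fin m → F) × (Fin m → F)) :
    skewForm S u v = u.1 ⬝ᵥ v.2 + u.2 ⬝ᵥ S *ᵥ v.1 := by
  show bf ⟨m, 1⟩ u.1 v.2 + bf ⟨m, S⟩ u.2 v.1 = _
  rw [bf_apply, bf_apply]
  show u.1 ⬝ᵥ (1 : Mat F m) *ᵥ v.2 + _ = _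
  rw [Matrix.one_mulVec]

lemma isom_skewForm {m : ℕ} (S : Mat F m) : Isom (skewForm S)
    (bf ⟨m + m, Matrix.reindex finSumFinEquiv finSumFinEquiv (Matrix.fromBlocks 0 1 S 0)⟩) := by
  refine ⟨(LinearEquiv.sumArrowLequivProdArrow _ _ F F).symm.trans
    (LinearEquiv.funCongrLeft F F finSumFinEquiv.symm), fun u v => ?_⟩
  rw [bf_apply, skewForm_apply]
  simp only [dotProduct, Matrix.mulVec]
  rw [← finSumFinEquiv.sum_comp]
  simp_rw [← finSumFinEquiv.sum_comp]
  simp [Fintype.sum_sum_type, Matrix.one_apply]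
  rfl

lemma isom_skewIBlock (χ : F[X]) : Isom (skewForm (companion F χ)) (bf (skewIBlock χ)) :=
  isom_skewForm _

lemma asym_skewForm {m : ℕ} {S : Mat F m} (hS : IsUnit S.det) :
    Asym (skewForm S) ((Matrix.toLin' S).prodMap (Matrix.toLin' Sᵀ⁻¹))
      ((Matrix.toLin' S⁻¹).prodMap (Matrix.toLin' Sᵀ)) := by
  have hS' : IsUnit Sᵀ.det := by rwa [Matrix.det_transpose]
  refine ⟨fun u v => ?_, fun v => ?_, fun v => ?_, fun u hu => Prod.ext ?_ ?_⟩
  · rw [skewForm_apply, skewForm_apply]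
    simp only [LinearMap.prodMap_apply, Matrix.toLin'_apply]
    rw [add_comm, dotProduct_comm u.2]
    congr 1
    rw [Matrix.dotProduct_mulVec, ← Matrix.mulVec_transpose, Matrix.mulVec_mulVec,
      Matrix.mul_nonsing_inv _ hS', Matrix.one_mulVec, dotProduct_comm]
  · simp only [LinearMap.prodMap_apply, Matrix.toLin'_apply, Matrix.mulVec_mulVec]
    rw [Matrix.mul_nonsing_inv _ hS, Matrix.nonsing_inv_mul _ hS', Matrix.one_mulVec,
      Matrix.one_mulVec]
  · simp only [LinearMap.prodMap_apply, Matrix.toLin'_apply, Matrix.mulVec_mulVec]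
    rw [Matrix.nonsing_inv_mul _ hS, Matrix.mul_nonsing_inv _ hS', Matrix.one_mulVec,
      Matrix.one_mulVec]
  · refine dotProduct_eq_zero u.1 fun w => ?_
    have := hu (0, w)
    rwa [skewForm_apply, Matrix.mulVec_zero, dotProduct_zero, add_zero] at this
  · refine dotProduct_eq_zero u.2 fun w => ?_
    have := hu (S⁻¹ *ᵥ w, 0)
    rwa [skewForm_apply, Matrix.mulVec_mulVec, Matrix.mul_nonsing_inv _ hS, Matrix.one_mulVec,
      dotProduct_zero, zero_add] at this

end SkewForm

/-! ### Gauss sums -/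

section QuadraticSum

variable [Fintype F]

/-- A nontrivial additive character. -/
abbrev addChar (F : Type*) [Field F] [Fintype F] : AddChar F ℂ :=
  AddChar.FiniteField.primitiveChar_to_Complex F

open Classical in
lemma sum_sq_mul (h2 : (2 : F) ≠ 0) {a : F} (ha : a ≠ 0) :
    ∑ t : F, addChar F (a * t ^ 2) = (quadraticChar F a : ℂ) *
      gaussSum ((quadraticChar F).ringHomComp (Int.castRingHom ℂ)) (addChar F) := by
  have hF : ringChar F ≠ 2 := fun h => h2 (by simpa [h] using ringChar.Nat.cast_ringChar (R := F))
  have hψ := AddChar.FiniteField.primitiveChar_to_Complex_isPrimitive F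
  have h0 : ∑ s : F, addChar F (a * s) = 0 := by
    simpa [ha, mul_comm] using AddChar.sum_mulShift a hψ
  have h1 : ∑ t : F, addChar F (a * t ^ 2) =
      ∑ s : F, ((quadraticChar F s : ℂ) + 1) * addChar F (a * s) := by
    rw [← Finset.sum_fiberwise' (s := Finset.univ) (g := fun t : F => t ^ 2)
      (f := fun s => addChar F (a * s))]
    refine Finset.sum_congr rfl fun s _ => ?_
    rw [Finset.sum_const, nsmul_eq_mul]
    congr 1
    have := quadraticChar_card_sqrts hF s
    rw [← Int.cast_one, ← Int.cast_add, ← this, Int.cast_natCast]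
    congr 2
    ext t
    simp
  rw [h1]
  simp only [add_mul, one_mul, Finset.sum_add_distrib, h0, add_zero]
  have := gaussSum_mulShift ((quadraticChar F).ringHomComp (Int.castRingHom ℂ)) (addChar F)
    (Units.mk0 a ha)
  rw [← this, ← mul_assoc]
  have h3 : (quadraticChar F a : ℂ) * (quadraticChar F a : ℂ) = 1 := by
    rw [← Int.cast_mul, ← sq, quadraticChar_sq_one ha, Int.cast_one]
  simp only [Units.val_mk0, MulChar.ringHomComp_apply, eq_intCast, h3, one_mul, gaussSum,
    AddChar.mulShift_apply]

lemma sum_sq_ne_zero (h2 : (2 : F) ≠ 0) {a : F} (ha : a ≠ 0) :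
    ∑ t : F, addChar F (a * t ^ 2) ≠ 0 := by
  classical
  have hF : ringChar F ≠ 2 := fun h => h2 (by simpa [h] using ringChar.Nat.cast_ringChar (R := F))
  rw [sum_sq_mul h2 ha]
  refine mul_ne_zero ?_ (gaussSum_ne_zero_of_nontrivial (by simp) ?_
    (AddChar.FiniteField.primitiveChar_to_Complex_isPrimitive F))
  · rcases quadraticChar_dichotomy ha with h | h <;> simp [h]
  · exact (MulChar.ringHomComp_ne_one_iff (RingHom.injective_int _)).2 (quadraticChar_ne_one hF)

lemma sum_sq_nonsquare_mul (h2 : (2 : F) ≠ 0) {ζ a : F} (hζ : ¬ IsSquare ζ) (ha : a ≠ 0) :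
    ∑ t : F, addChar F (ζ * a * t ^ 2) = - ∑ t : F, addChar F (a * t ^ 2) := by
  classical
  have hζ0 : ζ ≠ 0 := by rintro rfl; exact hζ (IsSquare.zero)
  rw [sum_sq_mul h2 ha, sum_sq_mul h2 (mul_ne_zero hζ0 ha), map_mul,
    quadraticChar_neg_one_iff_not_isSquare.2 hζ]
  push_cast
  ring

/-- Summing a function of a nonzero linear functional. -/
lemma sum_comp_functional {V : Type*} [AddCommGroup V] [Module F V] [Fintype V] (ℓ : V →ₗ[F] F)
    {g : V} (hg : ℓ g = 1) : ∃ c : ℂ, c ≠ 0 ∧ ∀ h : F → ℂ, ∑ x, h (ℓ x) = c * ∑ t, h t := by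
  classical
  refine ⟨(Finset.univ.filter fun x => ℓ x = 0).card, ?_, fun h => ?_⟩
  · rw [Nat.cast_ne_zero, Finset.card_ne_zero]
    exact ⟨0, by simp⟩
  · rw [← Finset.sum_fiberwise' (s := Finset.univ) (g := ℓ) (f := h), Finset.mul_sum]
    refine Finset.sum_congr rfl fun t _ => ?_
    rw [Finset.sum_const, nsmul_eq_mul]
    congr 2
    refine Finset.card_bij' (fun x _ => x - t • g) (fun x _ => x + t • g) ?_ ?_ ?_ ?_ <;>
      simp +contextual [hg]

end QuadraticSum

section Eigen

variable {V : Type*} [AddCommGroup V] [Module F V] {B : BilinForm F V} {σ τ : Module.End F V}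
  {lam : F}

lemma dualPoly_X_sub_C {lam : F} (h : lam * lam = 1) :
    dualPoly (RingHom.id F) (X - C lam) = X - C lam := by
  have h0 : lam ≠ 0 := by rintro rfl; simp at h
  have hm := monic_dualPoly (p := X - C lam) (by simpa using h0)
  have hd := natDegree_dualPoly (p := X - C lam) (by simpa using h0)
  rw [natDegree_X_sub_C] at hd
  obtain ⟨a, ha⟩ : ∃ a, dualPoly (RingHom.id F) (X - C lam) = X - C a := by
    refine ⟨-(dualPoly (RingHom.id F) (X - C lam)).coeff 0, ?_⟩
    conv_lhs => rw [hm.as_sum, hd]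
    simp
  rw [ha]
  have h' := congrArg (fun q => coeff q 0) ha
  simp only [dualPoly, Polynomial.map_id, RingHom.id_apply, coeff_C_mul, coeff_zero_reverse,
    leadingCoeff_X_sub_C, coeff_sub, coeff_X_zero, coeff_C_zero, zero_sub, mul_one] at h'
  field_simp at h'
  congr 2
  have : lam * (a - lam) = 0 := by linear_combination h' - h
  exact sub_eq_zero.1 ((mul_eq_zero.1 this).resolve_left h0)

namespace Asym

variable (hB : Asym B σ τ) (hlam : lam * lam = 1)
include hB hlam

lemma apply_eq_zero_of_mem_ker {n : ℕ} {w : V} (hw : aeval σ ((X - C lam : F[X]) ^ n) w = 0)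
    (f : F[X]) (z : V) : B (aeval σ (f * (X - C lam : F[X]) ^ n) z) w = 0 := by
  have h : aeval τ ((X - C lam : F[X]) ^ n) w = 0 := by
    have := aeval_dualPoly_apply hB.left_inv ((X - C lam : F[X]) ^ n) w
    rwa [dualPoly_pow, dualPoly_X_sub_C hlam, hw, map_zero, smul_zero] at this
  rw [mul_comm, aeval_mul_apply, hB.adj, h, map_zero]

omit hB in
lemma apply_aeval_of_eigen {x : V} (hB : Asym B σ τ) (hx : σ x = lam • x) (f : F[X]) (y : V) :
    B x (aeval σ f y) = f.eval lam * B x y := by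
  have hx' : τ x = lam • x := by
    have := congrArg (fun v => lam • τ v) hx
    simpa [hB.left_inv, smul_smul, hlam] using this.symm
  induction f using Polynomial.induction_on generalizing y with
  | C a => simp [Module.algebraMap_end_apply]
  | add f g hf hg => simp [hf, hg, add_mul]
  | monomial n a ih =>
    rw [pow_succ, ← mul_assoc, aeval_mul_apply, aeval_X, ih, hB.adj_one', hx', map_smul,
      LinearMap.smul_apply, smul_eq_mul, eval_mul_X]
    ring

/-- On a cyclic space of type `(X - lam) ^ n`, the quadratic form is a multiple of the square of a
linear functional. -/
lemma exists_functional {n : ℕ} (hn : 0 < n) {g : V}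
    (hg : aeval σ ((X - C lam : F[X]) ^ n) g = 0)
    (hg' : aeval σ ((X - C lam : F[X]) ^ (n - 1)) g ≠ 0)
    (hs : ∀ x, ∃ f : F[X], aeval σ f g = x) :
    ∃ (ℓ : V →ₗ[F] F) (b : F), b ≠ 0 ∧ ℓ g = 1 ∧ ∀ x,
      aeval σ ((X - C lam : F[X]) ^ n) x = 0 ∧
      B (aeval σ ((X - C lam : F[X]) ^ (n - 1)) x) x = b * ℓ x ^ 2 := by
  set w := aeval σ ((X - C lam : F[X]) ^ (n - 1)) g with hw
  have hw' : σ w = lam • w := by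
    rw [← Nat.sub_add_cancel hn, pow_succ', aeval_mul_apply, ← hw] at hg
    simpa [sub_eq_zero, Module.algebraMap_end_apply] using hg
  have hf : ∀ (f : F[X]) y, B w (aeval σ f y) = f.eval lam * B w y :=
    apply_aeval_of_eigen hlam hB hw'
  have hb : B w g ≠ 0 := fun h => hg' <| hB.nondeg w fun v => by
    obtain ⟨f, rfl⟩ := hs v
    rw [hf, h, mul_zero]
  refine ⟨(B w g)⁻¹ • B w, B w g, hb, by simp [hb], fun x => ?_⟩
  obtain ⟨f, rfl⟩ := hs x
  refine ⟨by rw [aeval_apply_comm, hg, map_zero], ?_⟩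
  have h1 : aeval σ f w = f.eval lam • w := by
    obtain ⟨q, hq⟩ : X - C lam ∣ f - C (f.eval lam) := X_sub_C_dvd_sub_C_eval
    rw [← sub_add_cancel f (C (f.eval lam)), hq, mul_comm, map_add, LinearMap.add_apply,
      aeval_mul_apply]
    simp [hw', Module.algebraMap_end_apply]
  rw [aeval_apply_comm, ← hw, h1, map_smul, LinearMap.smul_apply, LinearMap.smul_apply, hf]
  simp only [smul_eq_mul]
  field_simp

end Asym

end Eigen

section GaussRatio

variable [Fintype F] {V W : Type*} [AddCommGroup V] [Module F V] [Fintype V]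
  [AddCommGroup W] [Module F W] [Fintype W]

open Classical in
/-- The normalized Gauss sum of the quadratic form `B ((σ - lam) ^ (n - 1) x) x` on the kernel of
`(σ - lam) ^ n`. -/
def gaussRatio (B : BilinForm F V) (σ : Module.End F V) (lam : F) (n : ℕ) : ℂ :=
  (∑ x : V, if aeval σ ((X - C lam : F[X]) ^ n) x = 0 then
    addChar F (B (aeval σ ((X - C lam : F[X]) ^ (n - 1)) x) x) else 0) /
  ∑ x : V, if aeval σ ((X - C lam : F[X]) ^ n) x = 0 then 1 else 0

lemma gaussRatio_prod (B : BilinForm F V) (D : BilinForm F W) (σ : Module.End F V)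
    (σ' : Module.End F W) (lam : F) (n : ℕ) :
    gaussRatio (prodForm B D) (σ.prodMap σ') lam n =
      gaussRatio B σ lam n * gaussRatio D σ' lam n := by
  classical
  simp only [gaussRatio, div_mul_div_comm, Finset.sum_mul_sum, Fintype.sum_prod_type]
  simp only [aeval_prodMap_apply, prodForm_apply, AddChar.map_add_eq_mul, Prod.mk_eq_zero]
  congr 1 <;> refine Finset.sum_congr rfl fun x _ => Finset.sum_congr rfl fun y _ => ?_ <;>
    split_ifs <;> simp_all

lemma gaussRatio_conj {B : BilinForm F V} {D : BilinForm F W} {σ : Module.End F V}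
    {σ' : Module.End F W} (e : V ≃ₗ[F] W) (he : ∀ u v, D (e u) (e v) = B u v)
    (h : ∀ v, e (σ v) = σ' (e v)) (lam : F) (n : ℕ) :
    gaussRatio B σ lam n = gaussRatio D σ' lam n := by
  classical
  rw [gaussRatio, gaussRatio, ← Equiv.sum_comp e.toEquiv, ← Equiv.sum_comp e.toEquiv]
  have h' : ∀ (f : F[X]) v, aeval σ' f (e v) = e (aeval σ f v) :=
    fun f v => (aeval_conj_apply (e : V →ₗ[F] W) h f v).symm
  simp only [LinearEquiv.coe_toEquiv, h', he, LinearEquiv.map_eq_zero_iff]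

namespace Asym

variable {B : BilinForm F V} {σ τ : Module.End F V} (hB : Asym B σ τ) {lam : F}
  (hlam : lam * lam = 1)
include hB hlam

lemma gaussRatio_eq_one {n : ℕ} (h : cycMult σ (X - C lam) n = 0) : gaussRatio B σ lam n = 1 := by
  classical
  have hle := powKer'_eq_of_cycMult h
  have : ∀ x : V, (if aeval σ ((X - C lam : F[X]) ^ n) x = 0 then
    addChar F (B (aeval σ ((X - C lam : F[X]) ^ (n - 1)) x) x) else 0) =
      if aeval σ ((X - C lam : F[X]) ^ n) x = 0 then 1 else 0 := by
    intro x
    split_ifs with hx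
    · obtain ⟨-, z, hz⟩ := mem_powKer'.1 (hle.symm ▸ mem_powKer.2 hx)
      have := hB.apply_eq_zero_of_mem_ker hlam hx 1 z
      rw [one_mul, hz] at this
      rw [this, AddChar.map_zero_eq_one]
    · rfl
  rw [gaussRatio, Finset.sum_congr rfl fun x _ => this x, div_self]
  rw [Finset.sum_boole, Nat.cast_ne_zero, Finset.card_ne_zero]
  exact ⟨0, by simp⟩

lemma gaussRatio_of_generator (h2 : (2 : F) ≠ 0) {ζ : F} (hζ : ¬ IsSquare ζ) {n : ℕ} (hn : 0 < n)
    {g : V} (hg : aeval σ ((X - C lam : F[X]) ^ n) g = 0)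
    (hg' : aeval σ ((X - C lam : F[X]) ^ (n - 1)) g ≠ 0)
    (hs : ∀ x, ∃ f : F[X], aeval σ f g = x) {D : BilinForm F V} (hD : ∀ u v, D u v = ζ * B u v) :
    gaussRatio B σ lam n ≠ 0 ∧ gaussRatio D σ lam n = -gaussRatio B σ lam n := by
  obtain ⟨ℓ, b, hb, hℓ, h⟩ := hB.exists_functional hlam hn hg hg' hs
  obtain ⟨c, hc, hsum⟩ := sum_comp_functional ℓ hℓ
  simp only [gaussRatio, (h _).1, (h _).2, if_true, hD, ← mul_assoc]
  rw [hsum fun t => addChar F (b * t ^ 2), hsum fun t => addChar F (ζ * b * t ^ 2),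
    sum_sq_nonsquare_mul h2 hζ hb]
  refine ⟨div_ne_zero (mul_ne_zero hc (sum_sq_ne_zero h2 hb)) ?_, by ring⟩
  simp

end Asym

end GaussRatio

section Asymmetry

variable {V W : Type*} [AddCommGroup V] [Module F V] [AddCommGroup W] [Module F W]

lemma neg_one_pow_mul_self (n : ℕ) : ((-1 : F) ^ n) * (-1) ^ n = 1 := by
  rw [← mul_pow, neg_one_mul, neg_neg, one_pow]

lemma Asym.prod {B : BilinForm F V} {D : BilinForm F W} {σ τ : Module.End F V}
    {σ' τ' : Module.End F W} (h : Asym B σ τ) (h' : Asym D σ' τ') :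
    Asym (prodForm B D) (σ.prodMap σ') (τ.prodMap τ') where
  swap u v := by simp [h.swap u.1 v.1, h'.swap u.2 v.2]
  right_inv v := by simp [h.right_inv, h'.right_inv]
  left_inv v := by simp [h.left_inv, h'.left_inv]
  nondeg u hu := Prod.ext (h.nondeg _ fun v => by simpa using hu (v, 0))
    (h'.nondeg _ fun v => by simpa using hu (0, v))

lemma Asym.conj_eq {B : BilinForm F V} {D : BilinForm F W} {σ τ : Module.End F V}
    {σ' τ' : Module.End F W} (h : Asym B σ τ) (h' : Asym D σ' τ') (e : V ≃ₗ[F] W)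
    (he : ∀ u v, D (e u) (e v) = B u v) (v : V) : e (σ v) = σ' (e v) := by
  rw [← sub_eq_zero]
  refine h'.nondeg _ fun w => ?_
  obtain ⟨w, rfl⟩ := e.surjective w
  rw [map_sub, LinearMap.sub_apply, he, ← h.swap, ← h'.swap, he, sub_self]

lemma Asym.isom {B : BilinForm F V} {D : BilinForm F W} {σ τ : Module.End F V} (h : Asym B σ τ)
    (e : V ≃ₗ[F] W) (he : ∀ u v, D (e u) (e v) = B u v) : ∃ σ' τ', Asym D σ' τ' := by
  refine ⟨e.conj σ, e.conj τ, ⟨fun u v => ?_, fun v => ?_, fun v => ?_, fun u hu => ?_⟩⟩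
  · obtain ⟨u, rfl⟩ := e.surjective u
    obtain ⟨v, rfl⟩ := e.surjective v
    simp [LinearEquiv.conj_apply, he, h.swap u v]
  · simp [LinearEquiv.conj_apply, h.right_inv]
  · simp [LinearEquiv.conj_apply, h.left_inv]
  · obtain ⟨u, rfl⟩ := e.surjective u
    rw [h.nondeg u fun v => by rw [← he, hu], map_zero]

end Asymmetry

/-- The data for a nonsingular summand. -/
inductive Lab (F : Type*) [Field F]
  | skew (p : F[X]) (l : ℕ)
  | root (p : F[X]) (l : ℕ)
  | gam (n : ℕ)
  | zgam (n : ℕ)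

namespace Lab

/-- The summand described by the data. -/
def blk (ζ : F) (sqrtT : (q : F[X]) → Mat F q.natDegree) : Lab F → Block F
  | skew p l => skewIBlock (p ^ l)
  | root p l => ⟨(p ^ l).natDegree, sqrtT (p ^ l)⟩
  | gam n => ⟨n, Gamma F n⟩
  | zgam n => ⟨n, ζ • Gamma F n⟩

/-- The conditions on the data of a canonical summand. -/
def Valid : Lab F → Prop
  | skew p l => p.Monic ∧ Irreducible p ∧ 0 < l ∧ (p ^ l).eval 0 ≠ 0 ∧
      (dualPoly (RingHom.id F) p ≠ p ∨ p = X + C ((-1 : F) ^ ((p ^ l).natDegree + 1)))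
  | root p l => p.Monic ∧ Irreducible p ∧ 0 < l ∧ (p ^ l).eval 0 ≠ 0 ∧
      dualPoly (RingHom.id F) p = p ∧ 2 ≤ p.natDegree
  | gam n => 0 < n
  | zgam n => 0 < n

open Classical in
/-- The multiplicities of the asymmetry of a nonsingular summand. -/
def mult : Lab F → F[X] → ℕ → ℕ
  | skew p l, q, k => (if q = p ∧ k = l then p.natDegree else 0) +
      if q = dualPoly (RingHom.id F) p ∧ k = l then (dualPoly (RingHom.id F) p).natDegree else 0
  | root p l, q, k => if q = p ∧ k = l then p.natDegree else 0
  | gam n, q, k => if q = X - C ((-1) ^ (n + 1)) ∧ k = n then 1 else 0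
  | zgam n, q, k => if q = X - C ((-1) ^ (n + 1)) ∧ k = n then 1 else 0

/-- The Gauss sums of a nonsingular summand, given those of the matrices `Γₙ`. -/
def ratio (c : ℕ → ℂ) : Lab F → ℕ → ℂ
  | skew _ _, _ => 1
  | root _ _, _ => 1
  | gam n, k => if k = n then c n else 1
  | zgam n, k => if k = n then -c n else 1

lemma mult_eq_zero_of_valid (h2 : (2 : F) ≠ 0) {n : ℕ} : ∀ {a : Lab F}, a.Valid → a ≠ gam n →
    a ≠ zgam n → a.mult (X - C ((-1) ^ (n + 1))) n = 0
  | skew p l, ⟨hm, hp, hl, h0, h⟩, _, _ => by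
    have hd := dualPoly_X_sub_C (neg_one_pow_mul_self (F := F) (n + 1))
    have h0' : p.eval 0 ≠ 0 := by
      rw [eval_pow] at h0; exact ne_zero_pow hl.ne' h0
    have key : ¬ (X - C ((-1) ^ (n + 1)) = p ∧ n = l) := by
      rintro ⟨rfl, rfl⟩
      rcases h with h | h
      · exact h hd
      · rw [natDegree_pow, natDegree_X_sub_C, mul_one, sub_eq_add_neg, add_right_inj, ← C_neg,
          C_inj] at h
        have h3 : (2 : F) * (-1) ^ (n + 1) = 0 := by linear_combination -h
        exact (mul_ne_zero h2 (pow_ne_zero _ (neg_ne_zero.2 one_ne_zero))) h3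
    have key' : ¬ (X - C ((-1) ^ (n + 1)) = dualPoly (RingHom.id F) p ∧ n = l) := by
      rintro ⟨h', rfl⟩
      refine key ⟨?_, rfl⟩
      rw [← dualPoly_dualPoly hm h0', ← h', hd]
    simp only [mult, if_neg key, if_neg key']
  | root p l, ⟨hm, hp, hl, h0, h, hdeg⟩, _, _ => by
    have key : ¬ (X - C ((-1) ^ (n + 1)) = p ∧ n = l) := by
      rintro ⟨rfl, rfl⟩
      rw [natDegree_X_sub_C] at hdeg
      omega
    simp only [mult, if_neg key]
  | gam m, _, h, _ => if_neg fun h' => h (by rw [h'.2])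
  | zgam m, _, _, h => if_neg fun h' => h (by rw [h'.2])

end Lab

/-! ### Invariants of the canonical blocks -/

section Invariants

variable [Fintype F] {V W : Type*} [AddCommGroup V] [Module F V] [Fintype V]
  [AddCommGroup W] [Module F W] [Fintype W]

/-- The form `B` is nondegenerate and its asymmetry has the multiplicities `v` and the Gauss sums
`γ`. -/
def HasInv (B : BilinForm F V) (v : F[X] → ℕ → ℕ) (γ : ℕ → ℂ) : Prop :=
  ∃ σ τ, Asym B σ τ ∧
    (∀ q k, Irreducible q → q.Monic → 0 < k → cycMult σ q k = v q k) ∧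
    ∀ n, 0 < n → gaussRatio B σ ((-1) ^ (n + 1)) n = γ n

lemma HasInv.isom {B : BilinForm F V} {D : BilinForm F W} {v : F[X] → ℕ → ℕ} {γ : ℕ → ℂ}
    (h : HasInv B v γ) (hBD : Isom B D) : HasInv D v γ := by
  obtain ⟨σ, τ, hA, hv, hγ⟩ := h
  obtain ⟨e, he⟩ := hBD
  obtain ⟨σ', τ', hA'⟩ := hA.isom e he
  have hc := hA.conj_eq hA' e he
  exact ⟨σ', τ', hA', fun q k hq hm hk => by rw [← cycMult_conj e hc, hv q k hq hm hk],
    fun n hn => by rw [← gaussRatio_conj e he hc, hγ n hn]⟩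

lemma HasInv.unique {B : BilinForm F V} {v v' : F[X] → ℕ → ℕ} {γ γ' : ℕ → ℂ}
    (h : HasInv B v γ) (h' : HasInv B v' γ') :
    (∀ q k, Irreducible q → q.Monic → 0 < k → v q k = v' q k) ∧ ∀ n, 0 < n → γ n = γ' n := by
  obtain ⟨σ, τ, hA, hv, hγ⟩ := h
  obtain ⟨σ', τ', hA', hv', hγ'⟩ := h'
  obtain rfl : σ = σ' := LinearMap.ext fun v =>
    hA.conj_eq hA' (LinearEquiv.refl F V) (fun _ _ => rfl) v
  exact ⟨fun q k hq hm hk => by rw [← hv q k hq hm hk, ← hv' q k hq hm hk],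
    fun n hn => by rw [← hγ n hn, ← hγ' n hn]⟩

lemma HasInv.prod {B : BilinForm F V} {D : BilinForm F W} {v v' : F[X] → ℕ → ℕ} {γ γ' : ℕ → ℂ}
    (h : HasInv B v γ) (h' : HasInv D v' γ') :
    HasInv (prodForm B D) (fun q k => v q k + v' q k) (fun n => γ n * γ' n) := by
  obtain ⟨σ, τ, hA, hv, hγ⟩ := h
  obtain ⟨σ', τ', hA', hv', hγ'⟩ := h'
  exact ⟨_, _, hA.prod hA', fun q k hq hm hk => by rw [cycMult_prod, hv q k hq hm hk,
    hv' q k hq hm hk], fun n hn => by rw [gaussRatio_prod, hγ n hn, hγ' n hn]⟩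

lemma hasInv_of_subsingleton [Subsingleton V] (B : BilinForm F V) :
    HasInv B (fun _ _ => 0) (fun _ => 1) := by
  have hA : Asym B LinearMap.id LinearMap.id := ⟨fun u v => by
    rw [Subsingleton.elim u 0, Subsingleton.elim v 0]; simp, fun _ => rfl, fun _ => rfl,
    fun _ _ => Subsingleton.elim _ _⟩
  have h : ∀ q k, cycMult (LinearMap.id : Module.End F V) q k = 0 := fun q k => by
    rw [cycMult, Module.finrank_zero_of_subsingleton, Nat.zero_sub]
  exact ⟨_, _, hA, fun q k _ _ _ => h q k,
    fun n _ => hA.gaussRatio_eq_one (neg_one_pow_mul_self _) (h _ _)⟩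

namespace Lab

variable (h2 : (2 : F) ≠ 0)
include h2

lemma hasInv_of_mult {X : Block F} {σ τ} (hA : Asym (bf X) σ τ) {a : Lab F} (ha : a.Valid)
    (h : ∀ q k, Irreducible q → q.Monic → 0 < k → cycMult σ q k = a.mult q k) (c : ℕ → ℂ)
    (hc : ∀ n, 0 < n → a = gam n ∨ a = zgam n →
      gaussRatio (bf X) σ ((-1) ^ (n + 1)) n = a.ratio c n) :
    HasInv (bf X) a.mult (a.ratio c) := by
  refine ⟨σ, τ, hA, h, fun n hn => ?_⟩
  by_cases h' : a = gam n ∨ a = zgam n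
  · exact hc n hn h'
  · push Not at h'
    rw [hA.gaussRatio_eq_one (neg_one_pow_mul_self _)]
    · rcases a with ⟨p, l⟩ | ⟨p, l⟩ | m | m
      · rfl
      · rfl
      · exact (if_neg fun hh => h'.1 (by rw [hh])).symm
      · exact (if_neg fun hh => h'.2 (by rw [hh])).symm
    · rw [h _ _ (irreducible_X_sub_C _) (monic_X_sub_C _) hn, mult_eq_zero_of_valid h2 ha h'.1 h'.2]

variable {ζ : F} (hζ : ¬ IsSquare ζ)

lemma hasInv_skew {sqrtT : (q : F[X]) → Mat F q.natDegree} {p : F[X]} {l : ℕ}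
    (ha : (skew p l).Valid) (c : ℕ → ℂ) :
    HasInv (bf ((skew p l).blk ζ sqrtT)) (skew p l).mult ((skew p l).ratio c) := by
  classical
  obtain ⟨hm, hp, hl, h0, -⟩ := id ha
  have h0' : p.eval 0 ≠ 0 := by
    rw [eval_pow] at h0; exact ne_zero_pow hl.ne' h0
  have hA := asym_skewForm (isUnit_det_companion hp hm hl h0')
  obtain ⟨e, he⟩ := isom_skewIBlock (p ^ l)
  obtain ⟨σ, τ, hA'⟩ := hA.isom e he
  refine hasInv_of_mult h2 hA' ha (fun q k hq hmq hk => ?_) c (by rintro n - (h | h) <;> cases h)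
  rw [← cycMult_conj e (hA.conj_eq hA' e he), cycMult_prod,
    cycMult_of_isCycEnd hp hm hl (isCycEnd_companion hp hm hl) hq hmq hk,
    cycMult_of_isCycEnd (irreducible_dualPoly hp hm h0') (monic_dualPoly h0') hl
      (isCycEnd_companion_inv_transpose hp hm hl h0') hq hmq hk]
  rfl

lemma hasInv_root {sqrtT : (q : F[X]) → Mat F q.natDegree} (hsqrtT : IsCosquareRoot sqrtT)
    {p : F[X]} {l : ℕ} (ha : (root p l).Valid) (c : ℕ → ℂ) :
    HasInv (bf ((root p l).blk ζ sqrtT)) (root p l).mult ((root p l).ratio c) := by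
  classical
  obtain ⟨hm, hp, hl, h0, hd, hdeg⟩ := id ha
  obtain ⟨hu, h⟩ := hsqrtT p l hm hp hl h0 hd hdeg
  refine hasInv_of_mult h2 (asym_of_eq hu h) ha (fun q k hq hmq hk => ?_) c
    (by rintro n - (h | h) <;> cases h)
  exact cycMult_of_isCycEnd hp hm hl (isCycEnd_companion hp hm hl) hq hmq hk

include hζ in
lemma exists_hasInv_gam (sqrtT : (q : F[X]) → Mat F q.natDegree) (n : ℕ) :
    ∃ d : ℂ, d ≠ 0 ∧ (0 < n → ∀ c : ℕ → ℂ, c n = d → ∀ a : Lab F, a = gam n ∨ a = zgam n →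
      HasInv (bf (a.blk ζ sqrtT)) a.mult (a.ratio c)) := by
  classical
  rcases Nat.eq_zero_or_pos n with rfl | hn
  · exact ⟨1, one_ne_zero, fun h => absurd h (lt_irrefl _)⟩
  have hζ0 : ζ ≠ 0 := by rintro rfl; exact hζ IsSquare.zero
  obtain ⟨-, hd, ρ, ρ', g, hA, hg, hg'⟩ := isCyc_Gamma h2 hn
  have hp := irreducible_X_sub_C ((-1 : F) ^ (n + 1))
  have hm := monic_X_sub_C ((-1 : F) ^ (n + 1))
  have hcyc := isCycEnd_of_apply hp hd hg hg'
  obtain ⟨h0, h1⟩ := hA.gaussRatio_of_generator (neg_one_pow_mul_self _) h2 hζ hn hg hg'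
    (exists_aeval_eq hp hd hg hg') (D := bf ⟨n, ζ • Gamma F n⟩) (bf_smul ζ _)
  have hmult : ∀ q k, Irreducible q → q.Monic → 0 < k →
      cycMult ρ q k = if q = X - C ((-1) ^ (n + 1)) ∧ k = n then 1 else 0 := fun q k hq hmq hk => by
    rw [cycMult_of_isCycEnd hp hm hn hcyc hq hmq hk, natDegree_X_sub_C]
  refine ⟨_, h0, fun _ c hc a ha => ?_⟩
  rcases ha with rfl | rfl
  · refine hasInv_of_mult (X := ⟨n, Gamma F n⟩) (a := gam n) h2 hA hn hmult c ?_
    rintro m - (h | h) <;> cases h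
    simp [ratio, hc]
  · refine hasInv_of_mult (X := ⟨n, ζ • Gamma F n⟩) (a := zgam n) h2 (hA.smul_matrix hζ0) hn
      hmult c ?_
    rintro m - (h | h) <;> cases h
    simp [ratio, hc, h1]

include hζ in
lemma hasInv_blk {sqrtT : (q : F[X]) → Mat F q.natDegree} (hsqrtT : IsCosquareRoot sqrtT) :
    ∃ c : ℕ → ℂ, (∀ n, c n ≠ 0) ∧ ∀ a : Lab F, a.Valid →
      HasInv (bf (a.blk ζ sqrtT)) a.mult (a.ratio c) := by
  choose c hc h using exists_hasInv_gam h2 hζ sqrtT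
  refine ⟨c, hc, fun a ha => ?_⟩
  rcases a with ⟨p, l⟩ | ⟨p, l⟩ | m | m
  · exact hasInv_skew h2 ha c
  · exact hasInv_root h2 hsqrtT ha c
  · exact h m ha c rfl _ (Or.inl rfl)
  · exact h m ha c rfl _ (Or.inr rfl)

end Lab

lemma hasInv_bsum {ζ : F} {sqrtT : (q : F[X]) → Mat F q.natDegree} {c : ℕ → ℂ}
    (h : ∀ a : Lab F, a.Valid → HasInv (bf (a.blk ζ sqrtT)) a.mult (a.ratio c)) :
    ∀ M : List (Lab F), (∀ a ∈ M, a.Valid) → HasInv (bf (bsum (M.map (Lab.blk ζ sqrtT))))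
      (fun q k => (M.map fun a => a.mult q k).sum) (fun n => (M.map fun a => a.ratio c n).prod)
  | [], _ => by
    have : Subsingleton (Fin (bsum (([] : List (Lab F)).map (Lab.blk ζ sqrtT))).1 → F) :=
      inferInstanceAs (Subsingleton (Fin 0 → F))
    exact hasInv_of_subsingleton _
  | a :: M, hM => by
    have h1 := h a (hM a List.mem_cons_self)
    have h3 := hasInv_bsum h M fun b hb => hM b (List.mem_cons_of_mem _ hb)
    exact (h1.prod h3).isom (isom_bsum_cons _ _)

end Invariants

/-! ### Recovering the canonical blocks from the invariants -/

section Matching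

/-- Two lists with equal total weights can be matched if each weight identifies its items. -/
lemma exists_perm_forall₂ {α ι : Type*} (w : α → ι → ℕ) (R : α → α → Prop) (P : α → Prop)
    (h1 : ∀ a, P a → ∃ i, 0 < w a i)
    (h2 : ∀ a b i, P a → P b → 0 < w a i → 0 < w b i → R a b ∧ ∀ j, w a j = w b j) :
    ∀ L₂ L₁ : List α, (∀ a ∈ L₁, P a) → (∀ a ∈ L₂, P a) →
      (∀ i, (L₁.map (w · i)).sum = (L₂.map (w · i)).sum) →
      ∃ L, L₁.Perm L ∧ List.Forall₂ R L L₂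
  | [], L₁, hL₁, _, h => by
    rcases L₁ with - | ⟨a, L₁⟩
    · exact ⟨[], List.Perm.refl _, List.Forall₂.nil⟩
    · obtain ⟨i, hi⟩ := h1 a (hL₁ a List.mem_cons_self)
      have := h i
      simp only [List.map_cons, List.sum_cons, List.map_nil, List.sum_nil] at this
      omega
  | b :: L₂, L₁, hL₁, hL₂, h => by
    obtain ⟨i, hi⟩ := h1 b (hL₂ b List.mem_cons_self)
    obtain ⟨a, ha, hai⟩ : ∃ a ∈ L₁, 0 < w a i := by
      by_contra! hc
      have h0 : (L₁.map (w · i)).sum = 0 := by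
        rw [List.sum_eq_zero_iff]
        simpa using hc
      have := h i
      rw [h0, List.map_cons, List.sum_cons] at this
      omega
    obtain ⟨s, t, rfl⟩ := List.append_of_mem ha
    obtain ⟨hR, hw⟩ := h2 a b i (hL₁ a ha) (hL₂ b List.mem_cons_self) hai hi
    obtain ⟨L, hL, hL'⟩ := exists_perm_forall₂ w R P h1 h2 L₂ (s ++ t)
      (fun x hx => hL₁ x (List.perm_middle.symm.subset (List.mem_cons_of_mem _ hx)))
      (fun x hx => hL₂ x (List.mem_cons_of_mem _ hx)) fun j => by
        have := h j
        rw [(List.perm_middle.map (w · j)).sum_eq, List.map_cons, List.map_cons, List.sum_cons,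
          List.sum_cons, hw j] at this
        exact Nat.add_left_cancel this
    exact ⟨a :: L, List.perm_middle.trans (hL.cons a), hL'.cons hR⟩

namespace Lab

/-- The summands on which the asymmetry has an eigenvalue `±1` of the orthogonal kind. -/
def IsGam : Lab F → Prop
  | skew _ _ => False
  | root _ _ => False
  | gam _ => True
  | zgam _ => True

open Classical in
/-- The weights by which the summands are recognized. -/
def weight (a : Lab F) :
    Lab F ⊕ {x : F[X] × ℕ // Irreducible x.1 ∧ x.1.Monic ∧ 0 < x.2} → ℕ
  | .inl b => if a = b ∧ a.IsGam then 1 else 0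
  | .inr x => if a.IsGam then 0 else a.mult x.1.1 x.1.2

lemma exists_weight_pos {a : Lab F} (ha : a.Valid) : ∃ i, 0 < a.weight i := by
  classical
  rcases a with ⟨p, l⟩ | ⟨p, l⟩ | m | m
  · obtain ⟨hm, hp, hl, -⟩ := ha
    exact ⟨.inr ⟨(p, l), hp, hm, hl⟩, by simp [weight, IsGam, mult, hp.natDegree_pos]⟩
  · obtain ⟨hm, hp, hl, -⟩ := ha
    exact ⟨.inr ⟨(p, l), hp, hm, hl⟩, by simp [weight, IsGam, mult, hp.natDegree_pos]⟩
  · exact ⟨.inl (gam m), by simp [weight, IsGam]⟩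
  · exact ⟨.inl (zgam m), by simp [weight, IsGam]⟩

lemma of_mult_skew_pos {p q : F[X]} {l k : ℕ} (h : 0 < (skew p l).mult q k) :
    k = l ∧ (q = p ∨ q = dualPoly (RingHom.id F) p) := by
  classical
  by_contra hc
  have h1 : ¬ (q = p ∧ k = l) := fun h => hc ⟨h.2, Or.inl h.1⟩
  have h2 : ¬ (q = dualPoly (RingHom.id F) p ∧ k = l) := fun h => hc ⟨h.2, Or.inr h.1⟩
  simp only [mult, if_neg h1, if_neg h2, add_zero, lt_irrefl] at h

lemma of_mult_root_pos {p q : F[X]} {l k : ℕ} (h : 0 < (root p l).mult q k) : k = l ∧ q = p := by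
  classical
  by_contra hc
  have h1 : ¬ (q = p ∧ k = l) := fun h => hc ⟨h.2, h.1⟩
  simp only [mult, if_neg h1, lt_irrefl] at h

lemma not_root_of_skew {p p' q : F[X]} {l l' k : ℕ} (ha : (skew p l).Valid)
    (hb : (root p' l').Valid) (h : 0 < (skew p l).mult q k) (h' : 0 < (root p' l').mult q k) :
    False := by
  obtain ⟨hm, -, hl, h0, h2⟩ := ha
  obtain ⟨-, -, -, -, hd, hdeg⟩ := hb
  have h0' : p.eval 0 ≠ 0 := by
    rw [eval_pow] at h0; exact ne_zero_pow hl.ne' h0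
  obtain ⟨rfl, hq⟩ := of_mult_skew_pos h
  obtain ⟨rfl, rfl⟩ := of_mult_root_pos h'
  have hpq : q = p := by
    rcases hq with h | h
    · exact h
    · rw [← dualPoly_dualPoly hm h0', ← h, hd]
  subst hpq
  rcases h2 with h2 | h2
  · exact h2 hd
  · rw [h2, natDegree_X_add_C] at hdeg
    omega

lemma equiv0_of_weight {ζ : F} {sqrtT : (q : F[X]) → Mat F q.natDegree} {a b : Lab F} {i}
    (ha : a.Valid) (hb : b.Valid) (hai : 0 < a.weight i) (hbi : 0 < b.weight i) :
    Equiv0 (a.blk ζ sqrtT) (b.blk ζ sqrtT) ∧ ∀ j, a.weight j = b.weight j := by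
  classical
  rcases i with c | ⟨⟨q, k⟩, hq⟩
  · simp only [weight] at hai hbi
    split_ifs at hai hbi with h h'
    · obtain rfl : a = b := h.1.trans h'.1.symm
      exact ⟨Or.inl rfl, fun _ => rfl⟩
    all_goals omega
  · simp only [weight] at hai hbi
    split_ifs at hai with h
    · omega
    split_ifs at hbi with h'
    · omega
    rcases a with ⟨p, l⟩ | ⟨p, l⟩ | m | m
    · rcases b with ⟨p', l'⟩ | ⟨p', l'⟩ | m' | m'
      · obtain ⟨rfl, h1⟩ := of_mult_skew_pos hai
        obtain ⟨rfl, h2⟩ := of_mult_skew_pos hbi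
        obtain ⟨hm, hp, hl, h0, hc⟩ := id ha
        obtain ⟨hm', -, -, h0', -⟩ := hb
        rw [eval_pow] at h0 h0'
        have hdd := dualPoly_dualPoly hm (ne_zero_pow hl.ne' h0)
        have hdd' := dualPoly_dualPoly hm' (ne_zero_pow hl.ne' h0')
        have key : p' = p ∨ p' = dualPoly (RingHom.id F) p := by
          rcases h1 with h1 | h1 <;> rcases h2 with h2 | h2
          · exact Or.inl (h2.symm.trans h1)
          · exact Or.inr (by rw [← h1, h2, hdd'])
          · exact Or.inr (h2.symm.trans h1)
          · exact Or.inl (by rw [← hdd, ← h1, h2, hdd'])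
        rcases key with rfl | rfl
        · exact ⟨Or.inl rfl, fun _ => rfl⟩
        · refine ⟨Or.inr ⟨p, k, hm, hp, hl, by rwa [eval_pow], hc, rfl, ?_⟩, fun j => ?_⟩
          · rw [dualPoly_pow]
            rfl
          · rcases j with j | j
            · simp [weight, IsGam]
            · simp only [weight, if_neg h, if_neg h', mult, hdd]
              exact Nat.add_comm _ _
      · exact (not_root_of_skew ha hb hai hbi).elim
      · exact (h' trivial).elim
      · exact (h' trivial).elim
    · rcases b with ⟨p', l'⟩ | ⟨p', l'⟩ | m' | m'
      · exact (not_root_of_skew hb ha hbi hai).elim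
      · obtain ⟨rfl, rfl⟩ := of_mult_root_pos hai
        obtain ⟨rfl, rfl⟩ := of_mult_root_pos hbi
        exact ⟨Or.inl rfl, fun _ => rfl⟩
      · exact (h' trivial).elim
      · exact (h' trivial).elim
    · exact (h trivial).elim
    · exact (h trivial).elim

open Classical in
lemma sum_mult (x : {x : F[X] × ℕ // Irreducible x.1 ∧ x.1.Monic ∧ 0 < x.2}) (M : List (Lab F)) :
    (M.map fun a => a.mult x.1.1 x.1.2).sum = (M.map (weight · (.inr x))).sum +
      if x.1.1 = X - C ((-1) ^ (x.1.2 + 1)) then M.count (gam x.1.2) + M.count (zgam x.1.2)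
        else 0 := by
  induction M with
  | nil => simp
  | cons a M ih =>
    rw [List.map_cons, List.map_cons, List.sum_cons, List.sum_cons, ih, List.count_cons,
      List.count_cons]
    obtain ⟨⟨q, k⟩, hx⟩ := x
    rcases a with ⟨p, l⟩ | ⟨p, l⟩ | m | m
    · simp [weight, IsGam, add_assoc]
    · simp [weight, IsGam, add_assoc]
    · by_cases h : m = k
      · subst h
        by_cases h' : q = X - (-1) ^ (m + 1)
        · simp [weight, IsGam, mult, h']; omega
        · simp [weight, IsGam, mult, h']
      · simp [weight, IsGam, mult, h, Ne.symm h]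
    · by_cases h : m = k
      · subst h
        by_cases h' : q = X - (-1) ^ (m + 1)
        · simp [weight, IsGam, mult, h']; omega
        · simp [weight, IsGam, mult, h']
      · simp [weight, IsGam, mult, h, Ne.symm h]

open Classical in
lemma sum_weight_inl (b : Lab F) (M : List (Lab F)) :
    (M.map (weight · (.inl b))).sum = if b.IsGam then M.count b else 0 := by
  induction M with
  | nil => simp
  | cons a M ih =>
    rw [List.map_cons, List.sum_cons, ih, List.count_cons]
    by_cases h : a = b
    · subst h
      by_cases h' : a.IsGam <;> simp [weight, h', add_comm]
    · simp [weight, h]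

open Classical in
lemma prod_ratio (c : ℕ → ℂ) (n : ℕ) (M : List (Lab F)) :
    (M.map fun a => a.ratio c n).prod =
      c n ^ (M.count (gam n) + M.count (zgam n)) * (-1) ^ M.count (zgam n) := by
  induction M with
  | nil => simp
  | cons a M ih =>
    rw [List.map_cons, List.prod_cons, ih, List.count_cons, List.count_cons]
    rcases a with ⟨p, l⟩ | ⟨p, l⟩ | m | m
    · simp [ratio]
    · simp [ratio]
    · by_cases h : m = n
      · subst h
        simp [ratio]
        ring
      · simp [ratio, h, Ne.symm h]
    · by_cases h : m = n
      · subst h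
        simp [ratio]
        ring
      · simp [ratio, h, Ne.symm h]

open Classical in
lemma exists_perm_of_invariants (h2 : (2 : F) ≠ 0) {ζ : F}
    {sqrtT : (q : F[X]) → Mat F q.natDegree} {c : ℕ → ℂ} (hc : ∀ n, c n ≠ 0)
    {M₁ M₂ : List (Lab F)} (hM₁ : ∀ a ∈ M₁, a.Valid) (hM₂ : ∀ a ∈ M₂, a.Valid)
    (hz₁ : ∀ n, M₁.count (zgam n) ≤ 1) (hz₂ : ∀ n, M₂.count (zgam n) ≤ 1)
    (hmult : ∀ q k, Irreducible q → q.Monic → 0 < k →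
      (M₁.map fun a => a.mult q k).sum = (M₂.map fun a => a.mult q k).sum)
    (hratio : ∀ n, 0 < n →
      (M₁.map fun a => a.ratio c n).prod = (M₂.map fun a => a.ratio c n).prod) :
    ∃ M, M₁.Perm M ∧ List.Forall₂ (fun a b => Equiv0 (a.blk ζ sqrtT) (b.blk ζ sqrtT)) M M₂ := by
  have hsum : ∀ n, 0 < n → M₁.count (gam n) + M₁.count (zgam n) =
      M₂.count (gam n) + M₂.count (zgam n) := fun n hn => by
    let x : {x : F[X] × ℕ // Irreducible x.1 ∧ x.1.Monic ∧ 0 < x.2} :=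
      ⟨(X - C ((-1) ^ (n + 1)), n), irreducible_X_sub_C _, monic_X_sub_C _, hn⟩
    have h0 : ∀ M : List (Lab F), (∀ a ∈ M, a.Valid) → (M.map (weight · (.inr x))).sum = 0 :=
      fun M hM => by
        rw [List.sum_eq_zero_iff]
        simp only [List.mem_map, forall_exists_index, and_imp]
        rintro _ a ha rfl
        simp only [weight]
        split_ifs with h
        · rfl
        · exact mult_eq_zero_of_valid h2 (hM a ha) (by rintro rfl; exact h trivial)
            (by rintro rfl; exact h trivial)
    have := hmult _ n x.2.1 x.2.2.1 hn
    rw [sum_mult x M₁, sum_mult x M₂, h0 M₁ hM₁, h0 M₂ hM₂, if_pos rfl, if_pos rfl, zero_add,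
      zero_add] at this
    exact this
  have hz : ∀ n, 0 < n → M₁.count (zgam n) = M₂.count (zgam n) := fun n hn => by
    have := hratio n hn
    rw [prod_ratio, prod_ratio, hsum n hn] at this
    have h3 := mul_left_cancel₀ (pow_ne_zero _ (hc n)) this
    have h4 := hz₁ n
    have h5 := hz₂ n
    generalize M₁.count (zgam n) = a at *
    generalize M₂.count (zgam n) = b at *
    interval_cases a <;> interval_cases b <;> first | rfl | norm_num at h3
  have hcount : ∀ b : Lab F, b.IsGam → M₁.count b = M₂.count b := fun b hb => by
    by_cases hv : b.Valid
    · rcases b with ⟨p, l⟩ | ⟨p, l⟩ | m | m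
      · exact hb.elim
      · exact hb.elim
      · have h3 := hsum m hv
        have h4 := hz m hv
        omega
      · exact hz m hv
    · rw [List.count_eq_zero_of_not_mem fun h => hv (hM₁ b h),
        List.count_eq_zero_of_not_mem fun h => hv (hM₂ b h)]
  refine exists_perm_forall₂ weight _ Valid (fun a ha => exists_weight_pos ha)
    (fun a b i ha hb hai hbi => equiv0_of_weight ha hb hai hbi) M₂ M₁ hM₁ hM₂ fun i => ?_
  rcases i with b | x
  · rw [sum_weight_inl, sum_weight_inl]
    split_ifs with h
    · exact hcount b h
    · rfl
  · have h3 := hmult _ _ x.2.1 x.2.2.1 x.2.2.2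
    rw [sum_mult x M₁, sum_mult x M₂, hsum _ x.2.2.2] at h3
    exact Nat.add_right_cancel h3

end Lab

end Matching

/-! ### Uniqueness of the canonical form -/

section Uniqueness

variable {ζ : F} {sqrtT : (q : F[X]) → Mat F q.natDegree}

lemma exists_labels {L : List (Block F)} (hL : ∀ b ∈ L, IsSummand ζ sqrtT b) :
    ∃ (ns : List ℕ) (M : List (Lab F)), (∀ n ∈ ns, 0 < n) ∧ (∀ a ∈ M, a.Valid) ∧
      L.Perm ((ns.map fun n => (⟨n, J F n 0⟩ : Block F)) ++ M.map (Lab.blk ζ sqrtT)) := by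
  induction L with
  | nil => exact ⟨[], [], by simp, by simp, List.Perm.refl _⟩
  | cons b L ih =>
    obtain ⟨ns, M, hns, hM, hp⟩ := ih fun c hc => hL c (List.mem_cons_of_mem _ hc)
    have key : (∃ a : Lab F, a.Valid ∧ b = a.blk ζ sqrtT) → ∃ (ns : List ℕ) (M : List (Lab F)),
        (∀ n ∈ ns, 0 < n) ∧ (∀ a ∈ M, a.Valid) ∧ (b :: L).Perm
          ((ns.map fun n => (⟨n, J F n 0⟩ : Block F)) ++ M.map (Lab.blk ζ sqrtT)) := by
      rintro ⟨a, ha, rfl⟩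
      exact ⟨ns, a :: M, hns, List.forall_mem_cons.2 ⟨ha, hM⟩,
        (hp.cons _).trans List.perm_middle.symm⟩
    rcases hL b List.mem_cons_self with h | h | h | h
    · obtain ⟨n, hn, rfl⟩ := h
      exact ⟨n :: ns, M, List.forall_mem_cons.2 ⟨hn, hns⟩, hM, hp.cons _⟩
    · obtain ⟨p, l, h1, h2, h3, h4, h5, rfl⟩ := h
      exact key ⟨.skew p l, ⟨h1, h2, h3, h4, h5⟩, rfl⟩
    · obtain ⟨p, l, h1, h2, h3, h4, h5, h6, rfl⟩ := h
      exact key ⟨.root p l, ⟨h1, h2, h3, h4, h5, h6⟩, rfl⟩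
    · obtain ⟨n, hn, rfl | rfl⟩ := h
      · exact key ⟨.gam n, hn, rfl⟩
      · exact key ⟨.zgam n, hn, rfl⟩

lemma isom_bsum_append (L M : List (Block F)) :
    Isom (prodForm (bf (bsum L)) (bf (bsum M))) (bf (bsum (L ++ M))) := by
  induction L with
  | nil =>
    have : Subsingleton (Fin (bsum ([] : List (Block F))).1 → F) :=
      inferInstanceAs (Subsingleton (Fin 0 → F))
    exact (isom_prod_of_subsingleton _ _).symm
  | cons X L ih =>
    exact ((isom_bsum_cons X L).symm.prod (Isom.refl _)).trans <|
      (isom_prod_assoc _ _ _).trans <| ((Isom.refl _).prod ih).trans (isom_bsum_cons X _)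

open Classical in
lemma count_zgam_le {Ls : List (Block F)} {M : List (Lab F)}
    (h : Canon0 ζ sqrtT (Ls ++ M.map (Lab.blk ζ sqrtT))) (n : ℕ) : M.count (.zgam n) ≤ 1 := by
  by_contra! hc
  have h1 := (List.replicate_sublist_iff.2 hc).map (Lab.blk ζ sqrtT)
  exact h.2 n ⟨_, _, h1.trans (List.sublist_append_right _ _), rfl, rfl⟩

theorem canon_unique [Fintype F] (h2 : (2 : F) ≠ 0) (hζ : ¬ IsSquare ζ)
    (hsqrtT : IsCosquareRoot sqrtT) {L₁ L₂ : List (Block F)} (hL₁ : Canon0 ζ sqrtT L₁)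
    (hL₂ : Canon0 ζ sqrtT L₂) (h : Isom (bf (bsum L₁)) (bf (bsum L₂))) :
    ∃ L₂' : List (Block F), L₁.Perm L₂' ∧ List.Forall₂ Equiv0 L₂' L₂ := by
  classical
  obtain ⟨ns, M₁, hns, hM₁, hp₁⟩ := exists_labels hL₁.1
  obtain ⟨ms, M₂, hms, hM₂, hp₂⟩ := exists_labels hL₂.1
  obtain ⟨c, hc, hinv⟩ := Lab.hasInv_blk h2 hζ hsqrtT
  have hI₁ := hasInv_bsum hinv M₁ hM₁
  have hI₂ := hasInv_bsum hinv M₂ hM₂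
  have hnd : ∀ {M : List (Lab F)} {v γ}, HasInv (bf (bsum (M.map (Lab.blk ζ sqrtT)))) v γ →
      ∀ u, (∀ v, bf (bsum (M.map (Lab.blk ζ sqrtT))) u v = 0) → u = 0 :=
    fun ⟨_, _, hA, _⟩ => hA.nondeg
  have hiso : Isom (prodForm (bf (jordanSum F ns)) (bf (bsum (M₁.map (Lab.blk ζ sqrtT)))))
      (prodForm (bf (jordanSum F ms)) (bf (bsum (M₂.map (Lab.blk ζ sqrtT))))) :=
    (isom_bsum_append _ _).trans <| (isom_bsum_perm hp₁.symm).trans <| h.trans <|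
      (isom_bsum_perm hp₂).trans (isom_bsum_append _ _).symm
  obtain ⟨hcount, hisoM⟩ := jordanSum_unique (hnd hI₁) (hnd hI₂) (ns.sum + ms.sum) ns ms
    (fun n hn => (List.single_le_sum (by simp) n hn).trans (Nat.le_add_right _ _))
    (fun n hn => (List.single_le_sum (by simp) n hn).trans (Nat.le_add_left _ _)) hiso
  have hperm : ns.Perm ms := List.perm_iff_count.2 fun n => by
    rcases Nat.eq_zero_or_pos n with rfl | hn
    · rw [List.count_eq_zero_of_not_mem fun h => (hns 0 h).ne rfl,
        List.count_eq_zero_of_not_mem fun h => (hms 0 h).ne rfl]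
    · exact hcount n hn
  obtain ⟨hmult, hratio⟩ := (hI₁.isom hisoM).unique hI₂
  obtain ⟨M, hM, hM'⟩ := Lab.exists_perm_of_invariants (ζ := ζ) (sqrtT := sqrtT) h2 hc hM₁ hM₂
    (count_zgam_le (hL₁.perm hp₁)) (count_zgam_le (hL₂.perm hp₂)) hmult hratio
  have h3 : L₁.Perm ((ms.map fun n => (⟨n, J F n 0⟩ : Block F)) ++ M.map (Lab.blk ζ sqrtT)) :=
    hp₁.trans ((hperm.map _).append (hM.map _))
  have h6 : List.Forall₂ Equiv0 (M.map (Lab.blk ζ sqrtT)) (M₂.map (Lab.blk ζ sqrtT)) := by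
    rw [List.forall₂_map_left_iff, List.forall₂_map_right_iff]
    exact hM'
  have h7 : List.Forall₂ Equiv0 (ms.map fun n => (⟨n, J F n 0⟩ : Block F))
      (ms.map fun n => (⟨n, J F n 0⟩ : Block F)) := List.forall₂_same.2 fun _ _ => Or.inl rfl
  have h4 : List.Forall₂ Equiv0 ((ms.map fun n => (⟨n, J F n 0⟩ : Block F)) ++
      M.map (Lab.blk ζ sqrtT)) ((ms.map fun n => (⟨n, J F n 0⟩ : Block F)) ++
      M₂.map (Lab.blk ζ sqrtT)) :=
    List.rel_append h7 h6
  have h5 : Relation.Comp (List.Forall₂ Equiv0) List.Perm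
      ((ms.map fun n => (⟨n, J F n 0⟩ : Block F)) ++ M.map (Lab.blk ζ sqrtT)) L₂ :=
    ⟨_, h4, hp₂.symm⟩
  rw [List.forall₂_comp_perm_eq_perm_comp_forall₂] at h5
  obtain ⟨L, hL, hL'⟩ := h5
  exact ⟨L, h3.trans hL, hL'⟩

end Uniqueness

theorem stmt0 (F : Type*) [Field F] [Fintype F] (hchar : (2 : F) ≠ 0)
    (ζ : F) (hζ : ¬ IsSquare ζ)
    (sqrtT : (q : Polynomial F) → Mat F q.natDegree)
    (hsqrtT : ∀ (pp : Polynomial F) (l : ℕ), pp.Monic → Irreducible pp → 0 < l →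
      (pp ^ l).eval 0 ≠ 0 → dualPoly (RingHom.id F) pp = pp → 2 ≤ pp.natDegree →
      IsUnit (sqrtT (pp ^ l)).det ∧ sqrtT (pp ^ l) = (sqrtT (pp ^ l))ᵀ * companion F (pp ^ l))
    (n : ℕ) (A : Mat F n) :
    (∃ L : List (Block F), Canon0 ζ sqrtT L ∧ BCong ⟨n, A⟩ (bsum L)) ∧
    (∀ L₁ L₂ : List (Block F), Canon0 ζ sqrtT L₁ → Canon0 ζ sqrtT L₂ →
      BCong ⟨n, A⟩ (bsum L₁) → BCong ⟨n, A⟩ (bsum L₂) →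
      ∃ L₂' : List (Block F), L₁.Perm L₂' ∧ List.Forall₂ Equiv0 L₂' L₂) := by
  refine ⟨exists_canon hchar hζ hsqrtT ⟨n, A⟩, fun L₁ L₂ h₁ h₂ hb₁ hb₂ =>
    canon_unique hchar hζ hsqrtT h₁ h₂ ?_⟩
  exact ((bcong_iff_isom _ _).1 hb₁).symm.trans ((bcong_iff_isom _ _).1 hb₂)

end Stmt0
end
end Can
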